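/- Fix an integer d ≥ 1 and a natural number j. If j is not of the form 2s+1 for some s ∈ {1,…,n}, then Ext^j_S(S/I^d, S) = 0 (the Ext group is subsingleton). -/

import Mathlib

open MvPolynomial

namespace PfaffExt

section Fock

variable {ι : Type*} [LinearOrder ι]

/-- The Koszul sign `(-1)^#{i ∈ I | i < j}`. -/
def fsgn (j : ι) (I : Finset ι) : ℤ := ∏ i ∈ I, if i < j then -1 else 1

theorem fsgn_insert_of_lt {i j : ι} {I : Finset ι} (hj : j ∉ I) (h : j < i) :
    fsgn i (insert j I) = - fsgn i I := by
  simp [fsgn, Finset.prod_insert hj, h]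

theorem fsgn_insert_of_le {i j : ι} {I : Finset ι} (h : i ≤ j) :
    fsgn i (insert j I) = fsgn i I := by
  by_cases hj : j ∈ I
  · simp [Finset.insert_eq_of_mem hj]
  · simp [fsgn, Finset.prod_insert hj, h.not_gt]

theorem fsgn_erase_of_lt {i j : ι} {I : Finset ι} (hj : j ∈ I) (h : j < i) :
    fsgn i (I.erase j) = - fsgn i I := by
  conv_rhs => rw [← Finset.insert_erase hj]
  rw [fsgn_insert_of_lt (Finset.notMem_erase j I) h, neg_neg]

theorem fsgn_erase_of_le {i j : ι} {I : Finset ι} (h : i ≤ j) :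
    fsgn i (I.erase j) = fsgn i I := by
  by_cases hj : j ∈ I
  · conv_rhs => rw [← Finset.insert_erase hj]
    rw [fsgn_insert_of_le h]
  · rw [Finset.erase_eq_of_notMem hj]

theorem fsgn_mul_self (j : ι) (I : Finset ι) : fsgn j I * fsgn j I = 1 := by
  rw [fsgn, ← Finset.prod_mul_distrib]
  exact Finset.prod_eq_one fun i _ => by split_ifs <;> norm_num

/-- Functions on finite subsets of `ι`: the exterior algebra on `ι` with coefficients in `M`. -/
def Fock (ι M : Type*) := Finset ι → M

section

variable {ι R M : Type*}

instance : CoeFun (Fock ι M) (fun _ => Finset ι → M) := ⟨fun z => z⟩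

@[ext] theorem Fock.ext {z w : Fock ι M} (h : ∀ I, z I = w I) : z = w := funext h

instance [AddCommGroup M] : AddCommGroup (Fock ι M) :=
  inferInstanceAs (AddCommGroup (Finset ι → M))

instance [CommRing R] [AddCommGroup M] [Module R M] : Module R (Fock ι M) :=
  inferInstanceAs (Module R (Finset ι → M))

@[simp] theorem Fock.add_apply [AddCommGroup M] (z w : Fock ι M) (I) : (z + w) I = z I + w I := rfl
@[simp] theorem Fock.sub_apply [AddCommGroup M] (z w : Fock ι M) (I) : (z - w) I = z I - w I := rfl
@[simp] theorem Fock.neg_apply [AddCommGroup M] (z : Fock ι M) (I) : (-z) I = - z I := rfl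
@[simp] theorem Fock.zero_apply [AddCommGroup M] (I) : (0 : Fock ι M) I = 0 := rfl
@[simp] theorem Fock.smul_apply [CommRing R] [AddCommGroup M] [Module R M] (r : R) (z : Fock ι M)
    (I) : (r • z) I = r • z I := rfl
@[simp] theorem Fock.sum_apply [AddCommGroup M] {α : Type*} (s : Finset α) (f : α → Fock ι M) (I) :
    (∑ a ∈ s, f a) I = ∑ a ∈ s, f a I :=
  Finset.sum_apply (M := fun _ => M) I s f

end

variable (R : Type*) {M : Type*} [CommRing R] [AddCommGroup M] [Module R M]

/-- Creation operator (exterior multiplication by the `j`-th basis vector). -/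
def cr (j : ι) : Module.End R (Fock ι M) where
  toFun z I := if j ∈ I then fsgn j I • z (I.erase j) else 0
  map_add' z w := Fock.ext fun I => by
    change (if j ∈ I then fsgn j I • (z + w) (I.erase j) else 0) = (if j ∈ I then fsgn j I • z (I.erase j) else 0) + (if j ∈ I then fsgn j I • w (I.erase j) else 0)
    split_ifs <;> simp
  map_smul' r z := Fock.ext fun I => by
    change (if j ∈ I then fsgn j I • (r • z) (I.erase j) else 0) = r • (if j ∈ I then fsgn j I • z (I.erase j) else 0)
    split_ifs <;> simp [smul_comm r (fsgn j I)]

/-- Annihilation operator (contraction with the `j`-th coordinate function). -/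
def an (j : ι) : Module.End R (Fock ι M) where
  toFun z I := if j ∈ I then 0 else fsgn j I • z (insert j I)
  map_add' z w := Fock.ext fun I => by
    change (if j ∈ I then 0 else fsgn j I • (z + w) (insert j I)) = (if j ∈ I then 0 else fsgn j I • z (insert j I)) + (if j ∈ I then 0 else fsgn j I • w (insert j I))
    split_ifs <;> simp
  map_smul' r z := Fock.ext fun I => by
    change (if j ∈ I then 0 else fsgn j I • (r • z) (insert j I)) = r • (if j ∈ I then 0 else fsgn j I • z (insert j I))
    split_ifs <;> simp [smul_comm r (fsgn j I)]

variable {R}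

theorem cr_apply (j : ι) (z : Fock ι M) (I : Finset ι) :
    cr R j z I = if j ∈ I then fsgn j I • z (I.erase j) else 0 := rfl

theorem an_apply (j : ι) (z : Fock ι M) (I : Finset ι) :
    an R j z I = if j ∈ I then 0 else fsgn j I • z (insert j I) := rfl

/-- Componentwise action of an operator on the coefficients. -/
def lft : Module.End R M →ₐ[R] Module.End R (Fock ι M) where
  toFun A :=
    { toFun := fun z I => A (z I)
      map_add' := fun z w => Fock.ext fun I => map_add A (z I) (w I)
      map_smul' := fun r z => Fock.ext fun I => map_smul A r (z I) }
  map_one' := rfl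
  map_mul' _ _ := rfl
  map_zero' := rfl
  map_add' _ _ := rfl
  commutes' _ := rfl

@[simp] theorem lft_apply (A : Module.End R M) (z : Fock ι M) (I : Finset ι) :
    lft A z I = A (z I) := rfl

theorem commute_lft_cr (A : Module.End R M) (j : ι) : Commute (lft A) (cr R j) := by
  refine LinearMap.ext fun z => Fock.ext fun I => ?_
  by_cases h : j ∈ I <;> simp [cr_apply, h]

theorem commute_lft_an (A : Module.End R M) (j : ι) : Commute (lft A) (an R j) := by
  refine LinearMap.ext fun z => Fock.ext fun I => ?_
  by_cases h : j ∈ I <;> simp [an_apply, h]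

theorem cr_mul_self (i : ι) : (cr R i * cr R i : Module.End R (Fock ι M)) = 0 := by
  refine LinearMap.ext fun z => Fock.ext fun I => ?_
  simp [cr_apply]

theorem an_mul_self (i : ι) : (an R i * an R i : Module.End R (Fock ι M)) = 0 := by
  refine LinearMap.ext fun z => Fock.ext fun I => ?_
  simp [an_apply]

private theorem cr_cr_of_lt {i j : ι} (h : i < j) :
    (cr R i * cr R j : Module.End R (Fock ι M)) = - (cr R j * cr R i) := by
  refine LinearMap.ext fun z => Fock.ext fun I => ?_
  by_cases hi : i ∈ I <;> by_cases hj : j ∈ I <;>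
    simp [cr_apply, hi, hj, h.ne, h.ne', fsgn_erase_of_lt _ h, fsgn_erase_of_le h.le,
      Finset.erase_right_comm (a := i) (b := j), smul_smul, mul_comm (fsgn i I)]

private theorem an_an_of_lt {i j : ι} (h : i < j) :
    (an R i * an R j : Module.End R (Fock ι M)) = - (an R j * an R i) := by
  refine LinearMap.ext fun z => Fock.ext fun I => ?_
  by_cases hi : i ∈ I <;> by_cases hj : j ∈ I <;>
    simp [an_apply, hi, hj, h.ne, h.ne', fsgn_insert_of_lt _ h, fsgn_insert_of_le h.le,
      Finset.insert_comm i j, smul_smul, mul_comm (fsgn i I)]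

theorem cr_mul_cr (i j : ι) :
    (cr R i * cr R j : Module.End R (Fock ι M)) = - (cr R j * cr R i) := by
  rcases lt_trichotomy i j with h | rfl | h
  · exact cr_cr_of_lt h
  · simp [cr_mul_self]
  · rw [cr_cr_of_lt h, neg_neg]

theorem an_mul_an (i j : ι) :
    (an R i * an R j : Module.End R (Fock ι M)) = - (an R j * an R i) := by
  rcases lt_trichotomy i j with h | rfl | h
  · exact an_an_of_lt h
  · simp [an_mul_self]
  · rw [an_an_of_lt h, neg_neg]

theorem an_mul_cr_of_ne {i j : ι} (h : i ≠ j) :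
    (an R i * cr R j : Module.End R (Fock ι M)) = - (cr R j * an R i) := by
  refine LinearMap.ext fun z => Fock.ext fun I => ?_
  rcases lt_or_gt_of_ne h with h' | h' <;>
  by_cases hi : i ∈ I <;> by_cases hj : j ∈ I <;>
    simp [cr_apply, an_apply, hi, hj, h, h.symm, h'.le, fsgn_insert_of_lt, h',
      fsgn_insert_of_le, fsgn_erase_of_lt, fsgn_erase_of_le, smul_smul, mul_comm (fsgn i I),
      Finset.erase_insert_of_ne h]

theorem an_mul_cr_self (i : ι) :
    (an R i * cr R i : Module.End R (Fock ι M)) = 1 - cr R i * an R i := by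
  refine LinearMap.ext fun z => Fock.ext fun I => ?_
  by_cases hi : i ∈ I <;>
    simp [cr_apply, an_apply, hi, fsgn_insert_of_le, fsgn_erase_of_le, smul_smul, fsgn_mul_self]

theorem an_mul_cr (i j : ι) :
    (an R i * cr R j : Module.End R (Fock ι M)) = (if i = j then 1 else 0) - cr R j * an R i := by
  split_ifs with h
  · subst h; exact an_mul_cr_self i
  · rw [an_mul_cr_of_ne h, zero_sub]

theorem cr_mul_an_apply_self (i : ι) (z : Fock ι M) (I : Finset ι) :
    cr R i (an R i z) I = if i ∈ I then z I else 0 := by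
  by_cases hi : i ∈ I <;>
    simp [cr_apply, an_apply, hi, fsgn_erase_of_le, smul_smul, fsgn_mul_self]

variable [Fintype ι]

/-- `cr` and `an` are mutually transpose. -/
theorem sum_cr_eq_sum_an {P : Type*} [AddCommGroup P] (B : M →+ M →+ P) (j : ι)
    (z w : Fock ι M) :
    ∑ I, B (cr R j z I) (w I) = ∑ I, B (z I) (an R j w I) := by
  have h1 : ∑ I, B (cr R j z I) (w I)
      = ∑ I with j ∈ I, fsgn j I • B (z (I.erase j)) (w I) := by
    rw [Finset.sum_filter]
    refine Finset.sum_congr rfl fun I _ => ?_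
    by_cases h : j ∈ I <;> simp [cr_apply, h]
  have h2 : ∑ I, B (z I) (an R j w I)
      = ∑ I with j ∉ I, fsgn j I • B (z I) (w (insert j I)) := by
    rw [Finset.sum_filter]
    refine Finset.sum_congr rfl fun I _ => ?_
    by_cases h : j ∈ I <;> simp [an_apply, h]
  rw [h1, h2]
  refine Finset.sum_bij' (fun I _ => I.erase j) (fun I _ => insert j I) ?_ ?_ ?_ ?_ ?_
  · simp
  · simp
  · intro I hI; simp only [Finset.mem_filter] at hI; simp [hI.2]
  · intro I hI; simp only [Finset.mem_filter] at hI; simp [hI.2]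
  · intro I hI; simp only [Finset.mem_filter] at hI; simp [hI.2, fsgn_erase_of_le]

end Fock

section FunctionModel

variable {N : ℕ} {R : Type*} [CommRing R]

/-- Functions on exponents; the model for polynomials in `T_0, …, T_{N-1}` over `R`. -/
def Mon (N : ℕ) (R : Type*) := (Fin N → ℕ) → R

instance : CoeFun (Mon N R) (fun _ => (Fin N → ℕ) → R) := ⟨fun z => z⟩

@[ext] theorem Mon.ext {z w : Mon N R} (h : ∀ τ, z τ = w τ) : z = w := funext h

instance : AddCommGroup (Mon N R) := inferInstanceAs (AddCommGroup ((Fin N → ℕ) → R))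
instance : Module R (Mon N R) := inferInstanceAs (Module R ((Fin N → ℕ) → R))

@[simp] theorem Mon.add_apply (z w : Mon N R) (τ) : (z + w) τ = z τ + w τ := rfl
@[simp] theorem Mon.sub_apply (z w : Mon N R) (τ) : (z - w) τ = z τ - w τ := rfl
@[simp] theorem Mon.neg_apply (z : Mon N R) (τ) : (-z) τ = - z τ := rfl
@[simp] theorem Mon.zero_apply (τ) : (0 : Mon N R) τ = 0 := rfl
@[simp] theorem Mon.smul_apply (r : R) (z : Mon N R) (τ) : (r • z) τ = r * z τ := rfl
@[simp] theorem Mon.zsmul_apply (r : ℤ) (z : Mon N R) (τ) : (r • z) τ = r • z τ := rfl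
@[simp] theorem Mon.sum_apply {α : Type*} (s : Finset α) (f : α → Mon N R) (τ) :
    (∑ a ∈ s, f a) τ = ∑ a ∈ s, f a τ :=
  Finset.sum_apply (M := fun _ => R) τ s f

/-- Multiplication by `T_j`. -/
def mT (j : Fin N) : Module.End R (Mon N R) where
  toFun z τ := if τ j = 0 then 0 else z (τ - Pi.single j 1)
  map_add' z w := Mon.ext fun τ => by
    change (if τ j = 0 then 0 else (z + w) (τ - Pi.single j 1))
      = (if τ j = 0 then 0 else z (τ - Pi.single j 1)) + if τ j = 0 then 0 else w (τ - Pi.single j 1)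
    split_ifs <;> simp
  map_smul' r z := Mon.ext fun τ => by
    change (if τ j = 0 then 0 else (r • z) (τ - Pi.single j 1))
      = r * if τ j = 0 then 0 else z (τ - Pi.single j 1)
    split_ifs <;> simp

/-- The transpose of multiplication by `T_j`. -/
def mS (j : Fin N) : Module.End R (Mon N R) where
  toFun z τ := z (τ + Pi.single j 1)
  map_add' _ _ := rfl
  map_smul' _ _ := rfl

/-- The derivative with respect to `T_j`. -/
def mD (j : Fin N) : Module.End R (Mon N R) where
  toFun z τ := ((τ j + 1 : ℕ) : R) * z (τ + Pi.single j 1)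
  map_add' _ _ := Mon.ext fun _ => mul_add _ _ _
  map_smul' _ _ := Mon.ext fun _ => mul_left_comm _ _ _

theorem mT_apply (j : Fin N) (z : Mon N R) (τ) :
    mT j z τ = if τ j = 0 then 0 else z (τ - Pi.single j 1) := rfl
theorem mS_apply (j : Fin N) (z : Mon N R) (τ) : mS j z τ = z (τ + Pi.single j 1) := rfl
theorem mD_apply (j : Fin N) (z : Mon N R) (τ) :
    mD j z τ = ((τ j + 1 : ℕ) : R) * z (τ + Pi.single j 1) := rfl

theorem mT_mul_mT (i j : Fin N) : (mT i * mT j : Module.End R (Mon N R)) = mT j * mT i := by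
  refine LinearMap.ext fun z => Mon.ext fun τ => ?_
  rcases eq_or_ne i j with rfl | h
  · rfl
  · by_cases hi : τ i = 0 <;> by_cases hj : τ j = 0 <;>
      simp [mT_apply, hi, hj, h, h.symm, tsub_right_comm (b := Pi.single i 1)]

theorem mD_mul_mT_self (i : Fin N) :
    (mD i * mT i : Module.End R (Mon N R)) = mT i * mD i + 1 := by
  refine LinearMap.ext fun z => Mon.ext fun τ => ?_
  have e1 : τ + Pi.single i 1 - Pi.single i 1 = τ := add_tsub_cancel_right _ _
  by_cases hi : τ i = 0
  · simp [mT_apply, mD_apply, hi, e1]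
  · have e2 : τ - Pi.single i 1 + Pi.single i 1 = τ := by
      refine tsub_add_cancel_of_le fun k => ?_
      rcases eq_or_ne k i with rfl | h
      · simp; omega
      · simp [h]
    have e3 : ((τ i - 1 : ℕ) : R) + 1 = τ i := by
      have : τ i - 1 + 1 = τ i := by omega
      exact_mod_cast congrArg (Nat.cast (R := R)) this
    simp [mT_apply, mD_apply, hi, e1, e2, e3]; ring

theorem mD_mul_mT_of_ne {i j : Fin N} (h : i ≠ j) :
    (mD i * mT j : Module.End R (Mon N R)) = mT j * mD i := by
  refine LinearMap.ext fun z => Mon.ext fun τ => ?_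
  have e : τ + Pi.single i 1 - Pi.single j 1 = τ - Pi.single j 1 + Pi.single i 1 := by
    funext k
    rcases eq_or_ne k i with rfl | hk
    · simp [h]
    · simp [hk]
  by_cases hj : τ j = 0 <;> simp [mT_apply, mD_apply, hj, h, h.symm, e]

theorem mD_mul_mT (i j : Fin N) :
    (mD i * mT j : Module.End R (Mon N R)) = mT j * mD i + if i = j then 1 else 0 := by
  split_ifs with h
  · subst h; exact mD_mul_mT_self i
  · rw [mD_mul_mT_of_ne h, add_zero]

/-- The space carrying the complexes. -/
abbrev Cx (N : ℕ) (R : Type*) := Fock (Fin N) (Mon N R)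

/-- The Clifford operators attached to the skew matrix `X`. -/
def theta (X : Fin N → Fin N → R) (j : Fin N) : Module.End R (Cx N R) :=
  cr R j + ∑ k, X k j • an R k

/-- The differential. -/
def dif (X : Fin N → Fin N → R) : Module.End R (Cx N R) :=
  ∑ j, lft (mT j) * theta X j

theorem theta_anticomm {X : Fin N → Fin N → R} (hX : ∀ i j, X i j = - X j i)
    (i j : Fin N) : theta X i * theta X j = - (theta X j * theta X i) := by
  have h1 : ∀ i j : Fin N, (cr R i * ∑ k, X k j • an R k : Module.End R (Cx N R))
      = X i j • 1 - (∑ k, X k j • an R k) * cr R i := by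
    intro i j
    rw [Finset.mul_sum, Finset.sum_mul, eq_sub_iff_add_eq, ← Finset.sum_add_distrib]
    simp only [mul_smul_comm, smul_mul_assoc, an_mul_cr, smul_sub]
    simp
  have h2 : ((∑ k, X k i • an R k) * ∑ k, X k j • an R k : Module.End R (Cx N R))
      = - ((∑ k, X k j • an R k) * ∑ k, X k i • an R k) := by
    simp only [Finset.mul_sum, Finset.sum_mul, mul_smul_comm, smul_mul_assoc]
    simp only [Finset.smul_sum]
    rw [Finset.sum_comm, ← Finset.sum_neg_distrib]
    refine Finset.sum_congr rfl fun a _ => ?_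
    rw [← Finset.sum_neg_distrib]
    refine Finset.sum_congr rfl fun b _ => ?_
    rw [an_mul_an, smul_neg, smul_neg, smul_comm]
  unfold theta
  rw [add_mul, mul_add, mul_add, add_mul, mul_add, mul_add, cr_mul_cr i j, h1 i j, h1 j i, h2,
    hX i j, neg_smul]
  abel

theorem commute_lft_theta (X : Fin N → Fin N → R) (A : Module.End R (Mon N R))
    (j : Fin N) : Commute (lft A) (theta X j) := by
  unfold theta
  refine (commute_lft_cr A j).add_right (Commute.sum_right _ _ _ fun k _ => ?_)
  exact (commute_lft_an A k).smul_right _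

theorem commute_mT_dif (X : Fin N → Fin N → R) (i : Fin N) :
    Commute (lft (mT i)) (dif X) := by
  refine Commute.sum_right _ _ _ fun j _ => Commute.mul_right ?_ (commute_lft_theta X _ j)
  exact (show Commute (mT i) (mT j) from mT_mul_mT i j).map lft

theorem dif_mul_dif [Algebra ℚ R] {X : Fin N → Fin N → R}
    (hX : ∀ i j, X i j = - X j i) : dif X * dif X = 0 := by
  have h : dif X * dif X = - (dif X * dif X) := by
    conv_lhs => rw [dif, Finset.sum_mul_sum, Finset.sum_comm]
    conv_rhs => rw [dif, Finset.sum_mul_sum]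
    rw [← Finset.sum_neg_distrib]
    refine Finset.sum_congr rfl fun i _ => ?_
    rw [← Finset.sum_neg_distrib]
    refine Finset.sum_congr rfl fun j _ => ?_
    rw [(commute_lft_theta X _ _).symm.mul_mul_mul_comm,
      (commute_lft_theta X _ _).symm.mul_mul_mul_comm, ← map_mul, ← map_mul, mT_mul_mT,
      theta_anticomm hX, mul_neg]
  have h2 : (2 : R) • (dif X * dif X) = 0 := by
    rw [two_smul]; nth_rewrite 1 [h]; simp
  have h3 : algebraMap ℚ R 2⁻¹ * 2 = 1 := by
    rw [← map_ofNat (algebraMap ℚ R) 2, ← map_mul]; norm_num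
  rw [← one_smul R (dif X * dif X), ← h3, mul_smul, h2, smul_zero]

/-- `z` is supported in `T`-degree `b` and in exterior degrees `a` with `m ≤ a + b` and
`a + b ≡ m` modulo 2. -/
def InL (m b : ℤ) (z : Cx N R) : Prop :=
  ∀ I τ, z I τ ≠ 0 → ((∑ i, τ i : ℕ) : ℤ) = b ∧ m ≤ (I.card : ℤ) + b ∧ Even ((I.card : ℤ) + b - m)

variable {m b : ℤ}

theorem InL.zero : InL m b (0 : Cx N R) := fun _ _ h => absurd rfl h

theorem InL.add {z w : Cx N R} (hz : InL m b z) (hw : InL m b w) : InL m b (z + w) := by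
  intro I τ h
  by_cases h1 : z I τ = 0
  · refine hw I τ fun h2 => h ?_
    simp [h1, h2]
  · exact hz I τ h1

theorem InL.smul {z : Cx N R} (r : R) (hz : InL m b z) : InL m b (r • z) := by
  intro I τ h
  refine hz I τ fun h2 => h ?_
  simp [h2]

theorem InL.neg {z : Cx N R} (hz : InL m b z) : InL m b (-z) := by
  simpa using hz.smul (-1)

theorem InL.sub {z w : Cx N R} (hz : InL m b z) (hw : InL m b w) : InL m b (z - w) := by
  simpa [sub_eq_add_neg] using hz.add hw.neg

theorem InL.sum {α : Type*} {s : Finset α} {f : α → Cx N R} (h : ∀ a ∈ s, InL m b (f a)) :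
    InL m b (∑ a ∈ s, f a) := by
  classical
  induction s using Finset.induction_on with
  | empty => exact InL.zero
  | insert a s ha ih =>
    rw [Finset.sum_insert ha]
    exact (h a (by simp)).add (ih fun c hc => h c (by simp [hc]))

theorem sum_add_single (τ : Fin N → ℕ) (j : Fin N) :
    ∑ i, (τ + Pi.single j 1 : Fin N → ℕ) i = ∑ i, τ i + 1 := by
  simp [Finset.sum_add_distrib]

theorem sum_sub_single {τ : Fin N → ℕ} {j : Fin N} (h : τ j ≠ 0) :
    ∑ i, (τ - Pi.single j 1 : Fin N → ℕ) i + 1 = ∑ i, τ i := by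
  rw [← sum_add_single _ j, tsub_add_cancel_of_le]
  intro k
  rcases eq_or_ne k j with rfl | h'
  · simp; omega
  · simp [h']

theorem InL.mT_cr {z : Cx N R} (hz : InL m b z) (i j : Fin N) :
    InL m (b + 1) (lft (mT i) (cr R j z)) := by
  intro I τ h
  by_cases hτ : τ i = 0
  · simp [mT_apply, hτ] at h
  by_cases hI : j ∈ I
  · have h' : z (I.erase j) (τ - Pi.single i 1) ≠ 0 := by
      intro h'; simp [mT_apply, hτ, cr_apply, hI, h'] at h
    obtain ⟨h1, h2, h3⟩ := hz _ _ h'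
    have := sum_sub_single hτ
    have := Finset.card_erase_add_one hI
    rw [Int.even_iff] at *
    refine ⟨by omega, by omega, by omega⟩
  · simp [mT_apply, hτ, cr_apply, hI] at h

theorem InL.mT_an {z : Cx N R} (hz : InL m b z) (i j : Fin N) :
    InL m (b + 1) (lft (mT i) (an R j z)) := by
  intro I τ h
  by_cases hτ : τ i = 0
  · simp [mT_apply, hτ] at h
  by_cases hI : j ∈ I
  · simp [mT_apply, hτ, an_apply, hI] at h
  · have h' : z (insert j I) (τ - Pi.single i 1) ≠ 0 := by
      intro h'; simp [mT_apply, hτ, an_apply, hI, h'] at h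
    obtain ⟨h1, h2, h3⟩ := hz _ _ h'
    have := sum_sub_single hτ
    have := Finset.card_insert_of_notMem hI
    rw [Int.even_iff] at *
    refine ⟨by omega, by omega, by omega⟩

theorem InL.dif (X : Fin N → Fin N → R) {z : Cx N R} (hz : InL m b z) :
    InL m (b + 1) (dif X z) := by
  unfold PfaffExt.dif
  rw [LinearMap.sum_apply]
  refine InL.sum fun j _ => ?_
  rw [Module.End.mul_apply, theta, LinearMap.add_apply, map_add, LinearMap.sum_apply, map_sum]
  refine (hz.mT_cr j j).add (InL.sum fun k _ => ?_)
  rw [LinearMap.smul_apply, map_smul]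
  exact (hz.mT_an j k).smul _

theorem InL.mT {z : Cx N R} (hz : InL m b z) (i : Fin N) :
    InL (m + 1) (b + 1) (lft (mT i) z) := by
  intro I τ h
  by_cases hτ : τ i = 0
  · simp [mT_apply, hτ] at h
  · obtain ⟨h1, h2, h3⟩ := hz I (τ - Pi.single i 1) (by simpa [mT_apply, hτ] using h)
    have := sum_sub_single hτ
    rw [Int.even_iff] at *
    refine ⟨by omega, by omega, by omega⟩

theorem InL.mS {z : Cx N R} (hz : InL m b z) (i : Fin N) :
    InL (m - 1) (b - 1) (lft (mS i) z) := by
  intro I τ h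
  obtain ⟨h1, h2, h3⟩ := hz I (τ + Pi.single i 1) h
  have := sum_add_single τ i
  rw [Int.even_iff] at *
  refine ⟨by omega, by omega, by omega⟩

theorem mT_injective (j : Fin N) : Function.Injective (lft (ι := Fin N) (mT (R := R) j)) := by
  intro z w h
  funext I τ
  have := congrFun (congrFun h I) (τ + Pi.single j 1)
  simpa [mT_apply] using this

end FunctionModel

section Homotopy

variable {N : ℕ} {R : Type*} [CommRing R]

/-- The Koszul-type homotopy. -/
def sg (N : ℕ) (R : Type*) [CommRing R] : Module.End R (Cx N R) := ∑ i, lft (mD i) * an R i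

/-- The nilpotent part of the Laplacian. -/
def nil (X : Fin N → Fin N → R) : Module.End R (Cx N R) :=
  - ∑ i, (∑ k, X k i • an R k) * an R i

theorem an_mul_theta (X : Fin N → Fin N → R) (i j : Fin N) :
    an R i * theta X j = (if i = j then 1 else 0) - theta X j * an R i := by
  have : (an R i * ∑ k, X k j • an R k : Module.End R (Cx N R))
      = - ((∑ k, X k j • an R k) * an R i) := by
    rw [Finset.mul_sum, Finset.sum_mul, ← Finset.sum_neg_distrib]
    refine Finset.sum_congr rfl fun k _ => ?_
    rw [mul_smul_comm, smul_mul_assoc, an_mul_an, smul_neg]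
  rw [theta, mul_add, this, an_mul_cr, add_mul]
  abel

private theorem ring_aux {A : Type*} [Ring A] {T D θ a u : A} (h1 : Commute θ D)
    (h2 : Commute a T) (h3 : D * T = T * D + u) (h4 : a * θ = u - θ * a) (h5 : u = 0 ∨ u = 1) :
    T * θ * (D * a) + D * a * (T * θ) = u * (D * T - θ * a) := by
  rw [h1.mul_mul_mul_comm, h2.mul_mul_mul_comm, h4, h3]
  rcases h5 with rfl | rfl <;> noncomm_ring

theorem dif_sg (X : Fin N → Fin N → R) :
    dif X * sg N R + sg N R * dif X = ∑ i, (lft (mD i) * lft (mT i) - theta X i * an R i) := by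
  rw [dif, sg, Finset.sum_mul_sum, Finset.sum_mul_sum, Finset.sum_comm, ← Finset.sum_add_distrib]
  refine Finset.sum_congr rfl fun i _ => ?_
  rw [← Finset.sum_add_distrib, Finset.sum_eq_single i]
  · rw [ring_aux (commute_lft_theta X _ _).symm (commute_lft_an _ _).symm (u := 1), one_mul]
    · rw [← map_mul, ← map_mul, mD_mul_mT, if_pos rfl, map_add, map_one]
    · rw [an_mul_theta, if_pos rfl]
    · exact Or.inr rfl
  · intro j _ hij
    rw [ring_aux (commute_lft_theta X _ _).symm (commute_lft_an _ _).symm (u := 0), zero_mul]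
    · rw [← map_mul, ← map_mul, mD_mul_mT, if_neg hij.symm, add_zero, add_zero]
    · rw [an_mul_theta, if_neg hij.symm]
    · exact Or.inl rfl
  · exact fun h => absurd (Finset.mem_univ i) h

/-- The eigenvalue of the diagonal part of the Laplacian. -/
def lam (I : Finset (Fin N)) (τ : Fin N → ℕ) : ℕ := ∑ i, τ i + N - I.card

theorem dif_sg_apply (X : Fin N → Fin N → R) (z : Cx N R) (I : Finset (Fin N)) (τ : Fin N → ℕ) :
    (dif X * sg N R + sg N R * dif X) z I τ = (lam I τ : R) * z I τ + nil X z I τ := by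
  rw [dif_sg, Finset.sum_sub_distrib]
  have h1 : (∑ i, lft (mD i) * lft (mT i) : Module.End R (Cx N R)) z I τ
      = ((∑ i, τ i + N : ℕ) : R) * z I τ := by
    rw [LinearMap.sum_apply, Fock.sum_apply, Mon.sum_apply]
    simp [mD_apply, mT_apply, add_mul, Finset.sum_add_distrib, Finset.sum_mul]
  have h2 : ∑ i, theta X i * an R i = ∑ i, cr R i * an R i - nil X := by
    rw [nil, sub_neg_eq_add, ← Finset.sum_add_distrib]
    exact Finset.sum_congr rfl fun i _ => add_mul _ _ _
  have h3 : (∑ i, cr R i * an R i : Module.End R (Cx N R)) z I τ = (I.card : R) * z I τ := by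
    rw [LinearMap.sum_apply, Fock.sum_apply, Mon.sum_apply]
    have : ∀ i, (cr R i * an R i : Module.End R (Cx N R)) z I τ = if i ∈ I then z I τ else 0 := by
      intro i
      rw [Module.End.mul_apply, cr_mul_an_apply_self]
      split_ifs <;> simp
    simp [this]
  have h4 : (lam I τ : R) = ((∑ i, τ i + N : ℕ) : R) - I.card := by
    rw [lam, Nat.cast_sub]
    exact (card_finset_fin_le I).trans (Nat.le_add_left _ _)
  rw [LinearMap.sub_apply, h2, LinearMap.sub_apply, Fock.sub_apply, Mon.sub_apply, h1,
    Fock.sub_apply, Mon.sub_apply, h3, h4]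
  ring

theorem InL.nil (X : Fin N → Fin N → R) {m b : ℤ} {z : Cx N R} (hz : InL m b z) (hm : m ≤ b + 1) :
    InL m b (nil X z) := by
  unfold PfaffExt.nil
  rw [LinearMap.neg_apply, LinearMap.sum_apply]
  refine (InL.sum fun i _ => ?_).neg
  rw [Module.End.mul_apply, LinearMap.sum_apply]
  refine InL.sum fun k _ => ?_
  rw [LinearMap.smul_apply]
  refine InL.smul _ ?_
  intro I τ h
  by_cases hk : k ∈ I
  · simp [an_apply, hk] at h
  by_cases hi : i ∈ insert k I
  · simp [an_apply, hk, hi] at h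
  have h' : z (insert i (insert k I)) τ ≠ 0 := by
    intro h'; simp [an_apply, hk, hi, h'] at h
  obtain ⟨h1, h2, h3⟩ := hz _ _ h'
  have := Finset.card_insert_of_notMem hk
  have := Finset.card_insert_of_notMem hi
  rw [Int.even_iff] at *
  refine ⟨by omega, by omega, by omega⟩

theorem InL.sg {m b : ℤ} {z : Cx N R} (hz : InL m b z) (hm : m ≤ b) :
    InL m (b - 1) (sg N R z) := by
  unfold PfaffExt.sg
  rw [LinearMap.sum_apply]
  refine InL.sum fun i _ => ?_
  intro I τ h
  by_cases hi : i ∈ I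
  · simp [an_apply, hi] at h
  have h' : z (insert i I) (τ + Pi.single i 1) ≠ 0 := by
    intro h'; simp [an_apply, hi, mD_apply, h'] at h
  obtain ⟨h1, h2, h3⟩ := hz _ _ h'
  have := Finset.card_insert_of_notMem hi
  have := sum_add_single τ i
  rw [Int.even_iff] at *
  refine ⟨by omega, by omega, by omega⟩

variable [Algebra ℚ R]

/-- Partial inverse of the diagonal part of the Laplacian. -/
def lamInv (N : ℕ) (R : Type*) [CommRing R] [Algebra ℚ R] : Module.End R (Cx N R) where
  toFun z I τ := algebraMap ℚ R (lam I τ : ℚ)⁻¹ * z I τ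
  map_add' _ _ := Fock.ext fun _ => Mon.ext fun _ => mul_add _ _ _
  map_smul' _ _ := Fock.ext fun _ => Mon.ext fun _ => mul_left_comm _ _ _

theorem lamInv_apply (z : Cx N R) (I τ) :
    lamInv N R z I τ = algebraMap ℚ R (lam I τ : ℚ)⁻¹ * z I τ := rfl

theorem InL.lamInv {m b : ℤ} {z : Cx N R} (hz : InL m b z) : InL m b (lamInv N R z) := by
  intro I τ h
  exact hz I τ fun h' => h (by rw [lamInv_apply, h', mul_zero])

theorem pow_lamInv_nil (X : Fin N → Fin N → R) : (-(lamInv N R * nil X)) ^ (N + 1) = 0 := by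
  have key : ∀ c : ℕ, ∀ z : Cx N R, ∀ I : Finset (Fin N), N + 1 ≤ I.card + c →
      ((-(lamInv N R * nil X)) ^ c) z I = 0 := by
    intro c
    induction c with
    | zero => intro z I h; have := card_finset_fin_le I; omega
    | succ c ih =>
      intro z I h
      rw [pow_succ', Module.End.mul_apply]
      set w := ((-(lamInv N R * nil X)) ^ c) z with hw
      have : nil X w I = 0 := by
        rw [nil, LinearMap.neg_apply, LinearMap.sum_apply, Fock.neg_apply, Fock.sum_apply,
          Finset.sum_eq_zero, neg_zero]
        intro i _
        rw [Module.End.mul_apply, LinearMap.sum_apply, Fock.sum_apply, Finset.sum_eq_zero]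
        intro k _
        rw [LinearMap.smul_apply, Fock.smul_apply, an_apply, an_apply]
        split_ifs with h1 h2
        · simp
        · simp
        · rw [hw, ih, smul_zero, smul_zero, smul_zero]
          rw [Finset.card_insert_of_notMem h2, Finset.card_insert_of_notMem h1]
          omega
      ext τ
      rw [LinearMap.neg_apply, Module.End.mul_apply, Fock.neg_apply, Mon.neg_apply, lamInv_apply,
        this]
      simp
  refine LinearMap.ext fun z => Fock.ext fun I => ?_
  exact key _ z I (by omega)

/-- The inverse of the Laplacian in positive degrees. -/
def lapInv (X : Fin N → Fin N → R) : Module.End R (Cx N R) :=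
  (∑ k ∈ Finset.range (N + 1), (-(lamInv N R * nil X)) ^ k) * lamInv N R

theorem InL.lapInv (X : Fin N → Fin N → R) {m b : ℤ} {z : Cx N R} (hz : InL m b z)
    (hm : m ≤ b + 1) : InL m b (lapInv X z) := by
  rw [PfaffExt.lapInv, Module.End.mul_apply, LinearMap.sum_apply]
  refine InL.sum fun k hk => ?_
  clear hk
  induction k with
  | zero => exact hz.lamInv
  | succ k ih =>
    rw [pow_succ', Module.End.mul_apply, LinearMap.neg_apply, Module.End.mul_apply]
    exact (ih.nil X hm).lamInv.neg

theorem lamInv_lap (X : Fin N → Fin N → R) {m b : ℤ} {z : Cx N R} (hz : InL m b z) (hb : 1 ≤ b) :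
    lamInv N R ((dif X * sg N R + sg N R * dif X) z) = (1 + lamInv N R * nil X) z := by
  refine Fock.ext fun I => Mon.ext fun τ => ?_
  rw [lamInv_apply, dif_sg_apply, mul_add, LinearMap.add_apply, Module.End.one_apply,
    Module.End.mul_apply, Fock.add_apply, Mon.add_apply, lamInv_apply, ← mul_assoc]
  congr 1
  by_cases h : z I τ = 0
  · rw [h, mul_zero]
  have h1 := (hz I τ h).1
  have h2 : (lam I τ : ℚ) ≠ 0 := by
    have := card_finset_fin_le I
    have : lam I τ ≠ 0 := by unfold lam; omega
    exact_mod_cast this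
  rw [← map_natCast (algebraMap ℚ R), ← map_mul, inv_mul_cancel₀ h2, map_one, one_mul]

theorem lapInv_lap (X : Fin N → Fin N → R) {m b : ℤ} {z : Cx N R} (hz : InL m b z) (hb : 1 ≤ b) :
    lapInv X ((dif X * sg N R + sg N R * dif X) z) = z := by
  rw [lapInv, Module.End.mul_apply, lamInv_lap X hz hb, ← Module.End.mul_apply,
    ← sub_neg_eq_add, ← neg_sub, mul_neg, geom_sum_mul, pow_lamInv_nil]
  simp

theorem lap_lapInv (X : Fin N → Fin N → R) {m b : ℤ} {z : Cx N R} (hz : InL m b z)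
    (hm : m ≤ b + 1) (hb : 1 ≤ b) :
    (dif X * sg N R + sg N R * dif X) (lapInv X z) = z := by
  have inj : ∀ w : Cx N R, InL m b w → lamInv N R w = 0 → w = 0 := by
    intro w hw h
    refine Fock.ext fun I => Mon.ext fun τ => ?_
    by_contra h0
    have h1 := (hw I τ h0).1
    have h2 : (lam I τ : ℚ) ≠ 0 := by
      have := card_finset_fin_le I
      have : lam I τ ≠ 0 := by unfold lam; omega
      exact_mod_cast this
    have h3 : algebraMap ℚ R (lam I τ : ℚ) * lamInv N R w I τ = 0 := by rw [h]; simp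
    rw [lamInv_apply, ← mul_assoc, ← map_mul, mul_inv_cancel₀ h2, map_one, one_mul] at h3
    exact h0 (by simpa using h3)
  have hq := hz.lapInv X hm
  have hQ : InL m b ((dif X * sg N R + sg N R * dif X) (lapInv X z)) := by
    intro I τ h
    rw [dif_sg_apply] at h
    by_cases h' : lapInv X z I τ = 0
    · exact hq.nil X hm I τ fun h'' => h (by rw [h', h'', mul_zero, add_zero])
    · exact hq I τ h'
  rw [← sub_eq_zero]
  refine inj _ (hQ.sub hz) ?_
  rw [map_sub, lamInv_lap X hq hb, lapInv, ← Module.End.mul_apply, ← mul_assoc,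
    ← sub_neg_eq_add (1 : Module.End R (Cx N R)), mul_neg_geom_sum, pow_lamInv_nil]
  simp

/-- The contracting homotopy in positive degrees. -/
def hom (X : Fin N → Fin N → R) : Module.End R (Cx N R) := sg N R * lapInv X

theorem InL.hom (X : Fin N → Fin N → R) {m b : ℤ} {z : Cx N R} (hz : InL m b z) (hm : m ≤ b) :
    InL m (b - 1) (hom X z) :=
  (hz.lapInv X (by omega)).sg hm

theorem dif_hom {X : Fin N → Fin N → R} (hX : ∀ i j, X i j = - X j i) {m b : ℤ} {z : Cx N R}
    (hz : InL m b z) (hm : m ≤ b + 1) (hb : 1 ≤ b) (h : dif X z = 0) : dif X (hom X z) = z := by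
  have h1 := lap_lapInv X hz hm hb
  have h0 : ∀ w, dif X (dif X w) = 0 := fun w => by
    rw [← Module.End.mul_apply, dif_mul_dif hX]; rfl
  have h2 : dif X (lapInv X z) = 0 := by
    rw [← lapInv_lap X ((hz.lapInv X hm).dif X) (by omega)]
    have : (dif X * sg N R + sg N R * dif X) (dif X (lapInv X z)) = 0 := by
      have h3 := congrArg (dif X) h1
      rw [h, LinearMap.add_apply, map_add, Module.End.mul_apply, Module.End.mul_apply, h0,
        zero_add] at h3
      rw [LinearMap.add_apply, Module.End.mul_apply, Module.End.mul_apply, h0, map_zero, h3,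
        add_zero]
    rw [this, map_zero]
  rw [LinearMap.add_apply, Module.End.mul_apply, Module.End.mul_apply, h2, map_zero, add_zero] at h1
  exact h1

end Homotopy

section Split

variable {N : ℕ} {R : Type*} [CommRing R]

/-- Shift a subset by one. -/
def up (I : Finset (Fin N)) : Finset (Fin (N + 1)) := I.map ⟨Fin.succ, Fin.succ_injective N⟩

/-- Inverse of the shift, forgetting `0`. -/
def dn (I : Finset (Fin (N + 1))) : Finset (Fin N) := Finset.univ.filter fun i => i.succ ∈ I

@[simp] theorem succ_mem_up {I : Finset (Fin N)} {j : Fin N} : j.succ ∈ up I ↔ j ∈ I := by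
  simp [up]

@[simp] theorem zero_notMem_up {I : Finset (Fin N)} : (0 : Fin (N + 1)) ∉ up I := by
  simp [up]

@[simp] theorem card_up (I : Finset (Fin N)) : (up I).card = I.card := by simp [up]

@[simp] theorem dn_up (I : Finset (Fin N)) : dn (up I) = I := by ext; simp [dn]

@[simp] theorem dn_insert_up (I : Finset (Fin N)) : dn (insert 0 (up I)) = I := by
  ext; simp [dn]

theorem eq_up_or (I : Finset (Fin (N + 1))) : (∃ J, I = up J) ∨ ∃ J, I = insert 0 (up J) := by
  by_cases h : 0 ∈ I
  · refine Or.inr ⟨dn I, ?_⟩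
    ext i; induction i using Fin.cases <;> simp [h, dn]
  · refine Or.inl ⟨dn I, ?_⟩
    ext i; induction i using Fin.cases <;> simp [h, dn]

theorem up_insert (I : Finset (Fin N)) (j : Fin N) : up (insert j I) = insert j.succ (up I) := by
  simp [up]

theorem up_erase (I : Finset (Fin N)) (j : Fin N) : up (I.erase j) = (up I).erase j.succ := by
  ext i; induction i using Fin.cases <;> simp

@[simp] theorem fsgn_succ_up (j : Fin N) (I : Finset (Fin N)) : fsgn j.succ (up I) = fsgn j I := by
  simp [fsgn, up]

@[simp] theorem fsgn_zero (I : Finset (Fin (N + 1))) : fsgn 0 I = 1 := by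
  simp [fsgn]

@[simp] theorem fsgn_succ_insert_up (j : Fin N) (I : Finset (Fin N)) :
    fsgn j.succ (insert 0 (up I)) = - fsgn j I := by
  rw [fsgn_insert_of_lt zero_notMem_up (Fin.succ_pos j), fsgn_succ_up]

/-- The part of `z` with no `T_0` and no `0` in the exterior index. -/
def res0 : Cx (N + 1) R →ₗ[R] Cx N R where
  toFun z I τ := z (up I) (Fin.cons 0 τ : Fin (N + 1) → ℕ)
  map_add' _ _ := rfl
  map_smul' _ _ := rfl

/-- The part of `z` with no `T_0` and with `0` in the exterior index. -/
def res1 : Cx (N + 1) R →ₗ[R] Cx N R where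
  toFun z I τ := z (insert 0 (up I)) (Fin.cons 0 τ : Fin (N + 1) → ℕ)
  map_add' _ _ := rfl
  map_smul' _ _ := rfl

theorem res0_apply (z : Cx (N + 1) R) (I τ) :
    res0 z I τ = z (up I) (Fin.cons 0 τ : Fin (N + 1) → ℕ) := rfl

theorem res1_apply (z : Cx (N + 1) R) (I τ) :
    res1 z I τ = z (insert 0 (up I)) (Fin.cons 0 τ : Fin (N + 1) → ℕ) := rfl

theorem res0_cr (z : Cx (N + 1) R) (j : Fin N) : res0 (cr R j.succ z) = cr R j (res0 z) := by
  ext I τ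
  by_cases h : j ∈ I <;> simp [res0_apply, cr_apply, h, up_erase]

theorem res1_cr (z : Cx (N + 1) R) (j : Fin N) : res1 (cr R j.succ z) = - cr R j (res1 z) := by
  ext I τ
  have : (insert 0 (up I)).erase j.succ = insert 0 (up (I.erase j)) := by
    rw [up_erase, Finset.erase_insert_of_ne (Fin.succ_ne_zero j).symm]
  by_cases h : j ∈ I <;> simp [res1_apply, cr_apply, h, this, Fin.succ_ne_zero]

theorem res0_an (z : Cx (N + 1) R) (j : Fin N) : res0 (an R j.succ z) = an R j (res0 z) := by
  ext I τ
  by_cases h : j ∈ I <;> simp [res0_apply, an_apply, h, up_insert]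

theorem res1_an (z : Cx (N + 1) R) (j : Fin N) : res1 (an R j.succ z) = - an R j (res1 z) := by
  ext I τ
  have : insert j.succ (insert 0 (up I)) = insert 0 (up (insert j I)) := by
    rw [up_insert, Finset.insert_comm]
  by_cases h : j ∈ I <;> simp [res1_apply, an_apply, h, this, Fin.succ_ne_zero]

theorem res0_an_zero (z : Cx (N + 1) R) : res0 (an R 0 z) = res1 z := by
  ext I τ
  simp [res0_apply, res1_apply, an_apply]

theorem res1_an_zero (z : Cx (N + 1) R) : res1 (an R 0 z) = 0 := by
  ext I τ
  simp [res1_apply, an_apply]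

theorem cons_sub_single (τ : Fin N → ℕ) (j : Fin N) :
    (Fin.cons 0 τ : Fin (N + 1) → ℕ) - Pi.single j.succ 1
      = (Fin.cons 0 (τ - Pi.single j 1) : Fin (N + 1) → ℕ) := by
  funext i
  induction i using Fin.cases with
  | zero => simp
  | succ i => simp [Pi.single_apply]

theorem res0_mT (z : Cx (N + 1) R) (j : Fin N) :
    res0 (lft (mT j.succ) z) = lft (mT j) (res0 z) := by
  ext I τ
  by_cases h : τ j = 0 <;> simp [res0_apply, mT_apply, h, cons_sub_single]

theorem res1_mT (z : Cx (N + 1) R) (j : Fin N) :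
    res1 (lft (mT j.succ) z) = lft (mT j) (res1 z) := by
  ext I τ
  by_cases h : τ j = 0 <;> simp [res1_apply, mT_apply, h, cons_sub_single]

theorem res0_mT_zero (z : Cx (N + 1) R) : res0 (lft (mT 0) z) = 0 := by
  ext I τ
  simp [res0_apply, mT_apply]

theorem res1_mT_zero (z : Cx (N + 1) R) : res1 (lft (mT 0) z) = 0 := by
  ext I τ
  simp [res1_apply, mT_apply]

/-- Multiplication by the linear form `∑ y_j T_j`. -/
def Ty (y : Fin N → R) : Module.End R (Cx N R) := ∑ j, y j • lft (mT j)

/-- Remove the index `0` from a matrix. -/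
def rem0 (X : Fin (N + 1) → Fin (N + 1) → R) : Fin N → Fin N → R := fun i j => X i.succ j.succ

theorem res0_dif (X : Fin (N + 1) → Fin (N + 1) → R) (z : Cx (N + 1) R) :
    res0 (dif X z) = dif (rem0 X) (res0 z) + Ty (fun j => X 0 j.succ) (res1 z) := by
  rw [dif, LinearMap.sum_apply, map_sum, Fin.sum_univ_succ, Module.End.mul_apply, res0_mT_zero,
    zero_add, dif, Ty, LinearMap.sum_apply, LinearMap.sum_apply, ← Finset.sum_add_distrib]
  refine Finset.sum_congr rfl fun j _ => ?_
  rw [Module.End.mul_apply, res0_mT, Module.End.mul_apply, LinearMap.smul_apply, ← map_smul,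
    ← map_add]
  congr 1
  rw [theta, theta, LinearMap.add_apply, LinearMap.add_apply, map_add, res0_cr, add_assoc,
    LinearMap.sum_apply, LinearMap.sum_apply, map_sum, Fin.sum_univ_succ]
  simp only [LinearMap.smul_apply, map_smul, res0_an_zero, res0_an, rem0]
  rw [add_comm (X 0 j.succ • res1 z)]

theorem res1_dif (X : Fin (N + 1) → Fin (N + 1) → R) (z : Cx (N + 1) R) :
    res1 (dif X z) = - dif (rem0 X) (res1 z) := by
  rw [dif, LinearMap.sum_apply, map_sum, Fin.sum_univ_succ, Module.End.mul_apply, res1_mT_zero,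
    zero_add, dif, LinearMap.sum_apply, ← Finset.sum_neg_distrib]
  refine Finset.sum_congr rfl fun j _ => ?_
  rw [Module.End.mul_apply, res1_mT, Module.End.mul_apply, ← map_neg]
  congr 1
  rw [theta, theta, LinearMap.add_apply, LinearMap.add_apply, map_add, res1_cr,
    LinearMap.sum_apply, LinearMap.sum_apply, map_sum, Fin.sum_univ_succ]
  simp only [LinearMap.smul_apply, map_smul, res1_an_zero, res1_an, rem0, smul_neg, neg_add,
    smul_zero, zero_add, Finset.sum_neg_distrib]

/-- Glue two components together. -/
def glue (w0 w1 : Cx N R) : Cx (N + 1) R := fun I τ =>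
  if τ 0 = 0 then (if 0 ∈ I then w1 (dn I) (Fin.tail τ) else w0 (dn I) (Fin.tail τ)) else 0

@[simp] theorem res0_glue (w0 w1 : Cx N R) : res0 (glue w0 w1) = w0 := by
  ext I τ; simp [res0_apply, glue]

@[simp] theorem res1_glue (w0 w1 : Cx N R) : res1 (glue w0 w1) = w1 := by
  ext I τ; simp [res1_apply, glue]

variable {m b : ℤ}

theorem InL.res0 {z : Cx (N + 1) R} (hz : InL m b z) : InL m b (res0 z) := by
  intro I τ h
  have := hz _ _ h
  simpa [Fin.sum_univ_succ] using this

theorem InL.res1 {z : Cx (N + 1) R} (hz : InL m b z) : InL (m - 1) b (res1 z) := by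
  intro I τ h
  obtain ⟨h1, h2, h3⟩ := hz _ _ h
  rw [Finset.card_insert_of_notMem zero_notMem_up, card_up] at h2 h3
  rw [Fin.sum_univ_succ] at h1
  simp only [Fin.cons_zero, Fin.cons_succ, zero_add] at h1
  rw [Int.even_iff] at *
  exact ⟨h1, by omega, by omega⟩

theorem InL.glue {w0 w1 : Cx N R} (h0 : InL m b w0) (h1 : InL (m - 1) b w1) :
    InL m b (glue w0 w1) := by
  intro I τ h
  by_cases hτ : τ 0 = 0
  · have hs : ∑ i, τ i = ∑ i, Fin.tail τ i := by
      rw [Fin.sum_univ_succ, hτ, zero_add]; rfl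
    rcases eq_up_or I with ⟨J, rfl⟩ | ⟨J, rfl⟩
    · have := h0 J (Fin.tail τ) (by simpa [PfaffExt.glue, hτ] using h)
      rw [hs, card_up]; exact this
    · obtain ⟨a1, a2, a3⟩ := h1 J (Fin.tail τ) (by simpa [PfaffExt.glue, hτ] using h)
      rw [hs, Finset.card_insert_of_notMem zero_notMem_up, card_up]
      rw [Int.even_iff] at *
      exact ⟨a1, by omega, by omega⟩
  · simp [PfaffExt.glue, hτ] at h

theorem eq_mT_mS {z : Cx (N + 1) R} (h0 : res0 z = 0) (h1 : res1 z = 0) :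
    z = lft (mT 0) (lft (mS 0) z) := by
  ext I τ
  by_cases hτ : τ 0 = 0
  · have e : (Fin.cons 0 (Fin.tail τ) : Fin (N + 1) → ℕ) = τ := by
      conv_rhs => rw [← Fin.cons_self_tail τ, hτ]
    rcases eq_up_or I with ⟨J, rfl⟩ | ⟨J, rfl⟩
    · have : res0 z J (Fin.tail τ) = 0 := by rw [h0]; rfl
      rw [res0_apply, e] at this
      simp [mT_apply, hτ, this]
    · have : res1 z J (Fin.tail τ) = 0 := by rw [h1]; rfl
      rw [res1_apply, e] at this
      simp [mT_apply, hτ, this]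
  · have : τ - Pi.single 0 1 + Pi.single 0 1 = τ := by
      refine tsub_add_cancel_of_le fun k => ?_
      rcases eq_or_ne k 0 with rfl | h
      · simp; omega
      · simp [h]
    simp [mT_apply, mS_apply, hτ, this]

theorem InL.Ty (y : Fin N → R) {z : Cx N R} (hz : InL m b z) : InL (m + 1) (b + 1) (Ty y z) := by
  unfold PfaffExt.Ty
  rw [LinearMap.sum_apply]
  refine InL.sum fun j _ => ?_
  rw [LinearMap.smul_apply]
  exact (hz.mT j).smul _

theorem commute_Ty_dif (X : Fin N → Fin N → R) (y : Fin N → R) : Commute (Ty y) (dif X) :=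
  Commute.sum_left _ _ _ fun j _ => (commute_mT_dif X j).smul_left _

/-- Exactness of the `m`-th complex away from degree `m - 1`. -/
def Ex (X : Fin N → Fin N → R) (m : ℤ) : Prop :=
  ∀ b z, InL m b z → dif X z = 0 → b ≠ m - 1 → ∃ w, InL m (b - 1) w ∧ dif X w = z

/-- The form `∑ y_j T_j` is a nonzerodivisor on the cohomology in degree `m - 1`. -/
def NzTy (X : Fin N → Fin N → R) (y : Fin N → R) (m : ℤ) : Prop :=
  ∀ z w, InL m (m - 1) z → dif X z = 0 → InL (m + 1) (m - 1) w → Ty y z = dif X w →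
    ∃ v, InL m (m - 2) v ∧ dif X v = z

/-- `T_0` is a nonzerodivisor on the cohomology in degree `m - 1`. -/
def NzT (X : Fin (N + 1) → Fin (N + 1) → R) (m : ℤ) : Prop :=
  ∀ z w, InL m (m - 1) z → dif X z = 0 → InL (m + 1) (m - 1) w → lft (mT 0) z = dif X w →
    ∃ v, InL m (m - 2) v ∧ dif X v = z

theorem exists_sub_dif_eq_mT {X : Fin (N + 1) → Fin (N + 1) → R}
    (hE : ∀ m, 1 ≤ m → Ex (rem0 X) m) (hT : ∀ m, 1 ≤ m → NzTy (rem0 X) (fun j => X 0 j.succ) m)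
    (hm : 2 ≤ m) (hb : b ≠ m - 1) {w : Cx (N + 1) R} (hw : InL m b w) (h0 : res0 (dif X w) = 0)
    (h1 : res1 (dif X w) = 0) :
    ∃ v w', InL m (b - 1) v ∧ InL (m - 1) (b - 1) w' ∧ w - dif X v = lft (mT 0) w' := by
  rw [res0_dif] at h0
  rw [res1_dif, neg_eq_zero] at h1
  obtain ⟨w1, hw1, e1⟩ : ∃ w1, InL (m - 1) (b - 1) w1 ∧ dif (rem0 X) w1 = res1 w := by
    by_cases hbm : b = m - 2
    · obtain ⟨v, hv, e⟩ := hT (m - 1) (by omega) (res1 w) (-res0 w)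
        (by convert hw.res1 using 1; omega) h1
        (by convert hw.res0.neg using 1 <;> omega)
        (by rw [map_neg]; exact eq_neg_of_add_eq_zero_right h0)
      exact ⟨v, by convert hv using 1; omega, e⟩
    · exact hE (m - 1) (by omega) b _ hw.res1 h1 (by omega)
  have hy : InL m b (Ty (fun j => X 0 j.succ) w1) := by
    convert hw1.Ty _ using 1 <;> omega
  obtain ⟨w0, hw0, e0⟩ := hE m (by omega) b (res0 w + Ty (fun j => X 0 j.succ) w1)
    (hw.res0.add hy)
    (by rw [map_add, ← Module.End.mul_apply (dif _), ← (commute_Ty_dif _ _).eq,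
          Module.End.mul_apply, e1, h0]) hb
  have hv : InL m (b - 1) (glue w0 (-w1)) := hw0.glue hw1.neg
  refine ⟨glue w0 (-w1), lft (mS 0) (w - dif X (glue w0 (-w1))), hv, ?_, ?_⟩
  · exact (hw.sub (by convert hv.dif X using 1; omega)).mS 0
  · apply eq_mT_mS
    · rw [map_sub, res0_dif, res0_glue, res1_glue, e0, map_neg]
      abel
    · rw [map_sub, res1_dif, res1_glue, map_neg, e1]
      abel

theorem InL.eq_zero_of_neg {z : Cx N R} (hz : InL m b z) (hb : b < 0) : z = 0 := by
  ext I τ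
  by_contra h
  have := (hz I τ h).1
  omega

theorem ex_one [Algebra ℚ R] {X : Fin N → Fin N → R} (hX : ∀ i j, X i j = - X j i) : Ex X 1 := by
  intro b z hz h hb
  by_cases hb0 : b < 0
  · exact ⟨0, InL.zero, by rw [hz.eq_zero_of_neg hb0, map_zero]⟩
  · exact ⟨hom X z, hz.hom X (by omega), dif_hom hX hz (by omega) (by omega) h⟩

theorem ex_succ [Algebra ℚ R] {X : Fin (N + 1) → Fin (N + 1) → R} (hX : ∀ i j, X i j = - X j i)
    (hE : ∀ m, 1 ≤ m → Ex (rem0 X) m) (hT : ∀ m, 1 ≤ m → NzTy (rem0 X) (fun j => X 0 j.succ) m)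
    (m : ℤ) (hm : 1 ≤ m) : Ex X m := by
  induction m, hm using Int.leInduction with
  | base => exact ex_one hX
  | succ m hm ih =>
    intro b z hz h hb
    obtain ⟨v, z', hv, hz', e⟩ := exists_sub_dif_eq_mT hE hT (by omega) hb hz (by rw [h, map_zero])
      (by rw [h, map_zero])
    have hc : dif X z' = 0 := by
      apply mT_injective 0
      rw [← Module.End.mul_apply, (commute_mT_dif X 0).eq, Module.End.mul_apply, ← e, map_sub, h,
        ← Module.End.mul_apply, dif_mul_dif hX]
      simp
    obtain ⟨w', hw', e'⟩ := ih (b - 1) z' (by convert hz' using 1; omega) hc (by omega)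
    refine ⟨v + lft (mT 0) w', hv.add (by convert hw'.mT 0 using 1; omega), ?_⟩
    rw [map_add, ← Module.End.mul_apply (dif X), ← (commute_mT_dif X 0).eq, Module.End.mul_apply,
      e', ← e]
    abel

theorem nzT_succ {X : Fin (N + 1) → Fin (N + 1) → R}
    (hE : ∀ m, 1 ≤ m → Ex (rem0 X) m) (hT : ∀ m, 1 ≤ m → NzTy (rem0 X) (fun j => X 0 j.succ) m)
    (hd : dif X * dif X = 0) (m : ℤ) (hm : 1 ≤ m) : NzT X m := by
  intro z w _ _ hw e
  obtain ⟨v, w', hv, hw', e'⟩ := exists_sub_dif_eq_mT hE hT (m := m + 1) (by omega) (by omega) hw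
    (by rw [← e, res0_mT_zero]) (by rw [← e, res1_mT_zero])
  refine ⟨w', by convert hw' using 1 <;> omega, ?_⟩
  apply mT_injective 0
  rw [e, ← Module.End.mul_apply, (commute_mT_dif X 0).eq, Module.End.mul_apply, ← e', map_sub,
    ← Module.End.mul_apply (dif X) (dif X), hd]
  simp

end Split

section MapF

variable {N : ℕ} {R R' : Type*} [CommRing R] [CommRing R']

/-- Apply an additive map to all coefficients. -/
def mapF (φ : R →+ R') : Cx N R →+ Cx N R' where
  toFun z I τ := φ (z I τ)
  map_zero' := by ext; simp
  map_add' z w := Fock.ext fun I => Mon.ext fun τ => map_add φ (z I τ) (w I τ)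

theorem mapF_apply (φ : R →+ R') (z : Cx N R) (I τ) : mapF φ z I τ = φ (z I τ) := rfl

theorem mapF_mT (φ : R →+ R') (z : Cx N R) (j : Fin N) :
    mapF φ (lft (mT j) z) = lft (mT j) (mapF φ z) := by
  ext I τ
  by_cases h : τ j = 0 <;> simp [mapF_apply, mT_apply, h]

theorem mapF_cr (φ : R →+ R') (z : Cx N R) (j : Fin N) :
    mapF φ (cr R j z) = cr R' j (mapF φ z) := by
  ext I τ
  by_cases h : j ∈ I <;> simp [mapF_apply, cr_apply, h, ← zsmul_eq_mul]

theorem mapF_an (φ : R →+ R') (z : Cx N R) (j : Fin N) :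
    mapF φ (an R j z) = an R' j (mapF φ z) := by
  ext I τ
  by_cases h : j ∈ I <;> simp [mapF_apply, an_apply, h, ← zsmul_eq_mul]

theorem mapF_smul {φ : R →+ R'} {x : R} {x' : R'} (h : ∀ r, φ (x * r) = x' * φ r) (z : Cx N R) :
    mapF φ (x • z) = x' • mapF φ z := by
  ext I τ
  simp [mapF_apply, h]

theorem mapF_dif {φ : R →+ R'} {X : Fin N → Fin N → R} {X' : Fin N → Fin N → R'}
    (h : ∀ i j r, φ (X i j * r) = X' i j * φ r) (z : Cx N R) :
    mapF φ (dif X z) = dif X' (mapF φ z) := by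
  rw [dif, LinearMap.sum_apply, map_sum, dif, LinearMap.sum_apply]
  refine Finset.sum_congr rfl fun j _ => ?_
  rw [Module.End.mul_apply, mapF_mT, Module.End.mul_apply, theta, theta, LinearMap.add_apply,
    LinearMap.add_apply, map_add, mapF_cr, LinearMap.sum_apply, LinearMap.sum_apply, map_sum]
  simp only [LinearMap.smul_apply, mapF_smul (h _ _), mapF_an]

variable {m b : ℤ}

theorem InL.mapF {z : Cx N R} (hz : InL m b z) (φ : R →+ R') : InL m b (mapF φ z) := by
  intro I τ h
  exact hz I τ fun h' => h (by rw [mapF_apply, h', map_zero])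

theorem InL.exists_bound {z : Cx N R} (hz : InL m b z) (f : R → ℕ) :
    ∃ D, ∀ I τ, z I τ ≠ 0 → f (z I τ) < D := by
  refine ⟨(Finset.univ.sup fun I => (Fintype.piFinset fun _ : Fin N =>
    Finset.range (b.toNat + 1)).sup fun τ => f (z I τ)) + 1, fun I τ h => ?_⟩
  have hτ : τ ∈ Fintype.piFinset fun _ : Fin N => Finset.range (b.toNat + 1) := by
    rw [Fintype.mem_piFinset]
    intro i
    have h1 := (hz I τ h).1
    have h2 := Finset.single_le_sum (f := τ) (fun _ _ => Nat.zero_le _) (Finset.mem_univ i)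
    rw [Finset.mem_range]; omega
  exact Nat.lt_succ_of_le ((Finset.le_sup (f := fun τ => f (z I τ)) hτ).trans
    (Finset.le_sup (f := fun I => (Fintype.piFinset fun _ : Fin N =>
    Finset.range (b.toNat + 1)).sup fun τ => f (z I τ)) (Finset.mem_univ I)))

end MapF

section Generic

variable {N : ℕ} {R R' : Type*} [CommRing R] [CommRing R']

theorem nzTy_of_polynomial {X : Fin (N + 1) → Fin (N + 1) → R} {y : Fin (N + 1) → R}
    {X' : Fin (N + 1) → Fin (N + 1) → R'} {y' : Fin N → R'} (e : R ≃+* Polynomial R')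
    (hX : ∀ i j, e (X i j) = Polynomial.C (X' i j)) (h0 : e (y 0) = Polynomial.X)
    (hy : ∀ j, e (y (Fin.succ j)) = Polynomial.C (y' j)) (hd : dif X * dif X = 0) {m : ℤ}
    (hT : NzT X' m) : NzTy X y m := by
  let φ : ℕ → R →+ R' := fun D =>
    (Polynomial.lcoeff R' D).toAddMonoidHom.comp e.toRingHom.toAddMonoidHom
  have φa : ∀ D r, φ D r = (e r).coeff D := fun _ _ => rfl
  let ψ : ℕ → R' →+ R := fun D =>
    e.symm.toRingHom.toAddMonoidHom.comp (Polynomial.monomial D).toAddMonoidHom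
  have ψa : ∀ D r, ψ D r = e.symm (Polynomial.monomial D r) := fun _ _ => rfl
  have hφ : ∀ D i j r, φ D (X i j * r) = X' i j * φ D r := by
    intro D i j r
    simp [φa, hX]
  have hψ : ∀ D i j r, ψ D (X' i j * r) = X i j * ψ D r := by
    intro D i j r
    rw [ψa, ψa, RingEquiv.symm_apply_eq, e.map_mul, hX, RingEquiv.apply_symm_apply,
      Polynomial.C_mul_monomial]
  suffices H : ∀ D z w, (∀ I τ k, D ≤ k → (e (z I τ)).coeff k = 0) →
      InL m (m - 1) z → dif X z = 0 → InL (m + 1) (m - 1) w → Ty y z = dif X w →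
      ∃ v, InL m (m - 2) v ∧ dif X v = z by
    intro z w hz
    obtain ⟨D, hD⟩ := hz.exists_bound fun r => (e r).natDegree
    refine H D z w (fun I τ k hk => ?_) hz
    by_cases h : z I τ = 0
    · simp [h]
    · exact Polynomial.coeff_eq_zero_of_natDegree_lt ((hD I τ h).trans_le hk)
  intro D
  induction D with
  | zero =>
    intro z w hD _ _ _ _
    refine ⟨0, InL.zero, ?_⟩
    rw [map_zero]
    ext I τ
    refine (e.map_eq_zero_iff.1 ?_).symm
    ext k
    simp [hD I τ k (Nat.zero_le _)]
  | succ D ih =>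
    intro z w hD hz hc hw hzw
    have e1 : lft (mT 0) (mapF (φ D) z) = dif X' (mapF (φ (D + 1)) w) := by
      rw [← mapF_dif (hφ _), ← hzw, Ty, LinearMap.sum_apply, map_sum, Fin.sum_univ_succ,
        Finset.sum_eq_zero, add_zero]
      · ext I τ
        by_cases h : τ 0 = 0 <;> simp [mapF_apply, mT_apply, φa, h, h0]
      · intro j _
        ext I τ
        by_cases h : τ j.succ = 0 <;> simp [mapF_apply, mT_apply, φa, h, hy, hD]
    obtain ⟨v, hv, ev⟩ := hT _ _ (hz.mapF (φ D)) (by rw [← mapF_dif (hφ _), hc, map_zero])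
      (hw.mapF _) e1
    have hv' := hv.mapF (ψ D)
    have hdd : ∀ v, dif X (dif X v) = 0 := fun v => by
      rw [← Module.End.mul_apply, hd, LinearMap.zero_apply]
    have hdeg : ∀ I τ k, D ≤ k → (e ((z - dif X (mapF (ψ D) v)) I τ)).coeff k = 0 := by
      intro I τ k hk
      rw [← mapF_dif (hψ D), ev, Fock.sub_apply, Mon.sub_apply, mapF_apply, mapF_apply, φa, ψa,
        map_sub, e.apply_symm_apply, Polynomial.coeff_sub, Polynomial.coeff_monomial]
      split_ifs with h
      · rw [h, sub_self]
      · rw [hD I τ k (by omega), sub_zero]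
    obtain ⟨v2, hv2, ev2⟩ := ih (z - dif X (mapF (ψ D) v)) (w - Ty y (mapF (ψ D) v)) hdeg
      (hz.sub (by convert hv'.dif X using 1; omega)) (by rw [map_sub, hc, hdd, sub_zero])
      (hw.sub (by convert hv'.Ty y using 1; omega))
      (by rw [map_sub, map_sub, hzw, ← Module.End.mul_apply (Ty y), (commute_Ty_dif X y).eq,
        Module.End.mul_apply])
    refine ⟨v2 + mapF (ψ D) v, hv2.add hv', ?_⟩
    rw [map_add, ev2, sub_add_cancel]

theorem ex_zero (X : Fin 0 → Fin 0 → R) (m : ℤ) (hm : 1 ≤ m) : Ex X m := by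
  intro b z hz _ _
  refine ⟨0, InL.zero, ?_⟩
  rw [map_zero]
  ext I τ
  by_contra h
  have h1 := hz I τ (Ne.symm h)
  have : I.card = 0 := by simp [Finset.eq_empty_of_isEmpty I]
  simp at h1
  omega

theorem nzTy_zero (X : Fin 0 → Fin 0 → R) (y : Fin 0 → R) (m : ℤ) : NzTy X y m := by
  intro z _ hz _ _ _
  refine ⟨0, InL.zero, ?_⟩
  rw [map_zero]
  ext I τ
  by_contra h
  have h1 := hz I τ (Ne.symm h)
  have : I.card = 0 := by simp [Finset.eq_empty_of_isEmpty I]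
  rw [this] at h1
  simp at h1

/-- The entries of `X` above the diagonal are distinct variables. -/
def IsGen {σ K : Type*} [CommRing K] (X : Fin N → Fin N → MvPolynomial σ K) : Prop :=
  (∀ i j, X i j = - X j i) ∧ (∀ i, X i i = 0) ∧
    ∃ w : {p : Fin N × Fin N // p.1 < p.2} → σ, Function.Injective w ∧
      ∀ p, X p.1.1 p.1.2 = MvPolynomial.X (w p)

theorem IsGen.rem0 {σ K : Type*} [CommRing K] {X : Fin (N + 1) → Fin (N + 1) → MvPolynomial σ K}
    (h : IsGen X) : IsGen (rem0 X) := by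
  obtain ⟨h1, h2, w, h3, h4⟩ := h
  refine ⟨fun i j => h1 _ _, fun i => h2 _,
    fun p => w ⟨(p.1.1.succ, p.1.2.succ), Fin.succ_lt_succ_iff.2 p.2⟩, fun p q hpq => ?_,
    fun p => h4 ⟨(p.1.1.succ, p.1.2.succ), Fin.succ_lt_succ_iff.2 p.2⟩⟩
  have := h3 hpq
  simp only [Subtype.mk.injEq, Prod.mk.injEq, Fin.succ_inj] at this
  exact Subtype.ext (Prod.ext this.1 this.2)

/-- Single out one variable of a polynomial ring. -/
theorem exists_split_var {σ : Type*} (K : Type*) [CommRing K] (a : σ) :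
    ∃ S : MvPolynomial σ K ≃+* Polynomial (MvPolynomial {s : σ // s ≠ a} K),
      S (MvPolynomial.X a) = Polynomial.X ∧
      ∀ s (h : s ≠ a), S (MvPolynomial.X s) = Polynomial.C (MvPolynomial.X ⟨s, h⟩) := by
  classical
  refine ⟨((MvPolynomial.renameEquiv K (Equiv.optionSubtypeNe a).symm).trans
    (MvPolynomial.optionEquivLeft K _)).toRingEquiv, ?_, fun s h => ?_⟩
  · simp
  · simp [h]

theorem ex_and_nzTy_generic (K : Type*) [CommRing K] [Algebra ℚ K] (N : ℕ) :
    (∀ (σ : Type) (X : Fin N → Fin N → MvPolynomial σ K), IsGen X → ∀ m, 1 ≤ m → Ex X m) ∧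
    (∀ (σ : Type) (X : Fin (N + 1) → Fin (N + 1) → MvPolynomial σ K), IsGen X → ∀ m, 1 ≤ m →
      NzTy (rem0 X) (fun j => X 0 j.succ) m) := by
  induction N with
  | zero => exact ⟨fun _ _ _ => ex_zero _, fun _ _ _ _ _ => nzTy_zero _ _ _⟩
  | succ N ih =>
    refine ⟨fun σ X h => ex_succ h.1 (ih.1 _ _ h.rem0) (ih.2 _ _ h), fun σ X h m hm => ?_⟩
    obtain ⟨h1, h2, w, h3, h4⟩ := id h
    obtain ⟨S, hS0, hS⟩ := exists_split_var K (w ⟨(0, 1), Fin.zero_lt_one⟩)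
    let P := {p : Fin (N + 1 + 1) × Fin (N + 1 + 1) // p.1 < p.2}
    let p0 : P := ⟨(0, 1), Fin.zero_lt_one⟩
    have hne : ∀ p : P, p ≠ p0 → w p ≠ w p0 := fun p hp hw => hp (h3 hw)
    have hC : ∀ p : P, p ≠ p0 → S (X p.1.1 p.1.2) =
        Polynomial.C ((S (X p.1.1 p.1.2)).coeff 0) := by
      intro p hp
      rw [h4, hS _ (hne p hp), Polynomial.coeff_C_zero]
    have hs : ∀ (i j : Fin (N + 1)) (h : i < j),
        (⟨(i.succ, j.succ), Fin.succ_lt_succ_iff.2 h⟩ : P) ≠ p0 := by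
      intro i j hij h
      have := congrArg (fun p : P => p.1.1) h
      exact Fin.succ_ne_zero i this
    let X' : Fin (N + 1) → Fin (N + 1) → MvPolynomial {s : σ // s ≠ w p0} K :=
      fun i j => (S (X i.succ j.succ)).coeff 0
    have hX' : ∀ i j, S (PfaffExt.rem0 X i j) = Polynomial.C (X' i j) := by
      intro i j
      rcases lt_trichotomy i j with hij | rfl | hij
      · exact hC _ (hs i j hij)
      · simp [PfaffExt.rem0, X', h2]
      · have := hC _ (hs j i hij)
        simp only [PfaffExt.rem0, X']
        rw [h1, map_neg, Polynomial.coeff_neg, map_neg]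
        exact congrArg _ this
    have hG : IsGen X' := by
      refine ⟨fun i j => ?_, fun i => ?_, fun p => ⟨w ⟨(p.1.1.succ, p.1.2.succ), ?_⟩, ?_⟩, ?_, ?_⟩
      · simp only [X']
        rw [h1, map_neg, Polynomial.coeff_neg]
      · simp [X', h2]
      · exact Fin.succ_lt_succ_iff.2 p.2
      · exact hne _ (hs _ _ p.2)
      · intro p q hpq
        have := h3 (congrArg Subtype.val hpq)
        simp only [Subtype.mk.injEq, Prod.mk.injEq, Fin.succ_inj] at this
        exact Subtype.ext (Prod.ext this.1 this.2)
      · intro p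
        have := h4 ⟨(p.1.1.succ, p.1.2.succ), Fin.succ_lt_succ_iff.2 p.2⟩
        simp only [X'] at this ⊢
        rw [this, hS _ (hne _ (hs _ _ p.2)), Polynomial.coeff_C_zero]
    refine nzTy_of_polynomial S hX'
      (y' := fun j => (S (X 0 j.succ.succ)).coeff 0) ?_ ?_
      (dif_mul_dif h.rem0.1)
      (nzT_succ (ih.1 _ _ hG.rem0) (ih.2 _ _ hG) (dif_mul_dif hG.1) m hm)
    · have := h4 p0
      change S (X 0 1) = _
      change X 0 1 = _ at this
      rw [this, hS0]
    · intro j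
      refine hC ⟨(0, j.succ.succ), Fin.succ_pos _⟩ fun h => ?_
      have := congrArg (fun p : P => p.1.2) h
      exact Fin.succ_ne_zero j (Fin.succ_injective _ this)

theorem IsGen.ex {σ : Type} {K : Type*} [CommRing K] [Algebra ℚ K]
    {X : Fin N → Fin N → MvPolynomial σ K} (h : IsGen X) {m : ℤ} (hm : 1 ≤ m) : Ex X m :=
  (ex_and_nzTy_generic K N).1 σ X h m hm

theorem IsGen.nzT {σ : Type} {K : Type*} [CommRing K] [Algebra ℚ K]
    {X : Fin (N + 1) → Fin (N + 1) → MvPolynomial σ K} (h : IsGen X) {m : ℤ} (hm : 1 ≤ m) :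
    NzT X m :=
  nzT_succ ((ex_and_nzTy_generic K N).1 σ _ h.rem0) ((ex_and_nzTy_generic K N).2 σ X h)
    (dif_mul_dif h.1) m hm

end Generic

section Pfaffian

variable {n : ℕ} {R : Type*} [CommRing R]

theorem two_mul_add_one_lt {a m : ℕ} (h : a < m) : 2 * a + 1 < 2 * m := by omega

/-- The first element of the `i`-th pair. -/
def pa (i : Fin n) : Fin (2 * n) := ⟨2 * i, (Nat.lt_succ_self _).trans (two_mul_add_one_lt i.2)⟩
/-- The second element of the `i`-th pair. -/
def pb (i : Fin n) : Fin (2 * n) := ⟨2 * i + 1, two_mul_add_one_lt i.2⟩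

/-- The Pfaffian, without the normalising factor. -/
def pfu (A : Fin (2 * n) → Fin (2 * n) → R) : R :=
  ∑ σ : Equiv.Perm (Fin (2 * n)), (Equiv.Perm.sign σ : ℤ) • ∏ i : Fin n, A (σ (pa i)) (σ (pb i))

theorem map_pfu {R' : Type*} [CommRing R'] (f : R →+* R') (A : Fin (2 * n) → Fin (2 * n) → R) :
    f (pfu A) = pfu fun i j => f (A i j) := by
  simp only [pfu, map_sum, map_zsmul, map_prod]

/-- The signed submaximal Pfaffians. -/
def subpf (X : Fin (2 * n + 1) → Fin (2 * n + 1) → R) (k : Fin (2 * n + 1)) : R :=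
  (-1) ^ (k : ℕ) * pfu fun i j => X (k.succAbove i) (k.succAbove j)

/-- Build a permutation from the image of `0` and a permutation of the rest. -/
def glueperm (x : Fin (2 * n + 1) × Equiv.Perm (Fin (2 * n))) : Equiv.Perm (Fin (2 * n + 1)) :=
  x.1.cycleRange.symm * Equiv.Perm.decomposeFin.symm (0, x.2)

theorem glueperm_zero (x : Fin (2 * n + 1) × Equiv.Perm (Fin (2 * n))) : glueperm x 0 = x.1 := by
  simp [glueperm]

theorem glueperm_succ (x : Fin (2 * n + 1) × Equiv.Perm (Fin (2 * n))) (i : Fin (2 * n)) :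
    glueperm x i.succ = x.1.succAbove (x.2 i) := by
  simp [glueperm]

theorem sign_glueperm (x : Fin (2 * n + 1) × Equiv.Perm (Fin (2 * n))) :
    (Equiv.Perm.sign (glueperm x) : ℤ) = (-1) ^ (x.1 : ℕ) * Equiv.Perm.sign x.2 := by
  rw [glueperm, Equiv.Perm.sign_mul, Equiv.Perm.sign_symm, Fin.sign_cycleRange,
    Equiv.Perm.decomposeFin.symm_sign]
  simp

theorem glueperm_bijective : Function.Bijective (glueperm (n := n)) := by
  rw [Fintype.bijective_iff_injective_and_card]
  constructor
  · intro x y h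
    have h0 : x.1 = y.1 := by rw [← glueperm_zero x, h, glueperm_zero]
    refine Prod.ext h0 (Equiv.ext fun i => ?_)
    have := congrArg (fun f => f i.succ) h
    simp only [glueperm_succ, h0] at this
    exact Fin.succAbove_right_injective this
  · simp [Fintype.card_prod, Fintype.card_perm, Nat.factorial_succ]

theorem sum_mul_subpf_eq (X : Fin (2 * n + 1) → Fin (2 * n + 1) → R) (j : Fin (2 * n + 1)) :
    ∑ k, X j k * subpf X k = ∑ ρ : Equiv.Perm (Fin (2 * n + 1)), (Equiv.Perm.sign ρ : ℤ) •
      (X j (ρ 0) * ∏ i : Fin n, X (ρ (pa i).succ) (ρ (pb i).succ)) := by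
  rw [← glueperm_bijective.sum_comp, Fintype.sum_prod_type]
  refine Finset.sum_congr rfl fun k _ => ?_
  rw [subpf, pfu, Finset.mul_sum, Finset.mul_sum]
  refine Finset.sum_congr rfl fun σ _ => ?_
  rw [sign_glueperm]
  simp only [glueperm_zero, glueperm_succ, zsmul_eq_mul]
  push_cast
  ring

theorem pa_ne_pb (i k : Fin n) : pa i ≠ pb k := by
  intro h; have := congrArg Fin.val h; simp only [pa, pb] at this; omega

theorem pa_injective : Function.Injective (pa (n := n)) := by
  intro i k h; have := congrArg Fin.val h; simp only [pa] at this; ext; omega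

theorem pb_injective : Function.Injective (pb (n := n)) := by
  intro i k h; have := congrArg Fin.val h; simp only [pb] at this; ext; omega

theorem eq_pa_or_pb (c : Fin (2 * n)) : ∃ i : Fin n, c = pa i ∨ c = pb i := by
  refine ⟨⟨c / 2, by omega⟩, ?_⟩
  rcases Nat.mod_two_eq_zero_or_one c with h | h
  · left; ext; simp only [pa]; omega
  · right; ext; simp only [pb]; omega

theorem sum_mul_subpf {X : Fin (2 * n + 1) → Fin (2 * n + 1) → R}
    (hX : ∀ i j, X i j = - X j i) (h0 : ∀ i, X i i = 0) (j : Fin (2 * n + 1)) :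
    ∑ k, X j k * subpf X k = 0 := by
  rw [sum_mul_subpf_eq]
  let F : Equiv.Perm (Fin (2 * n + 1)) → R := fun ρ =>
    X j (ρ 0) * ∏ i : Fin n, X (ρ (pa i).succ) (ρ (pb i).succ)
  have key : ∀ c : Fin (2 * n + 1), c ≠ 0 → ∃ c', c' ≠ 0 ∧ c' ≠ c ∧ ∀ ρ : Equiv.Perm _, ρ c = j →
      F (ρ * Equiv.swap 0 c') = F ρ := by
    intro c hc
    obtain ⟨c, rfl⟩ := Fin.exists_succ_eq.2 hc
    obtain ⟨i, rfl | rfl⟩ := eq_pa_or_pb c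
    · refine ⟨(pb i).succ, Fin.succ_ne_zero _, fun h => pa_ne_pb i i (Fin.succ_injective _ h.symm),
        fun ρ hρ => ?_⟩
      have e1 : ∀ k, Equiv.swap 0 (pb i).succ (pa k).succ = (pa k).succ := fun k =>
        Equiv.swap_apply_of_ne_of_ne (Fin.succ_ne_zero _)
          fun h => pa_ne_pb k i (Fin.succ_injective _ h)
      have e2 : ∀ k ≠ i, Equiv.swap 0 (pb i).succ (pb k).succ = (pb k).succ := fun k hk =>
        Equiv.swap_apply_of_ne_of_ne (Fin.succ_ne_zero _)
          fun h => hk (pb_injective (Fin.succ_injective _ h))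
      simp only [F, Equiv.Perm.mul_apply, e1, Equiv.swap_apply_left]
      rw [← Finset.mul_prod_erase _ _ (Finset.mem_univ i), ← Finset.mul_prod_erase _ _
        (Finset.mem_univ i), Equiv.swap_apply_right, hρ, ← mul_assoc, ← mul_assoc, mul_comm (X j _)]
      congr 1
      refine Finset.prod_congr rfl fun k hk => ?_
      rw [e2 k (Finset.ne_of_mem_erase hk)]
    · refine ⟨(pa i).succ, Fin.succ_ne_zero _, fun h => pa_ne_pb i i (Fin.succ_injective _ h),
        fun ρ hρ => ?_⟩
      have e1 : ∀ k, Equiv.swap 0 (pa i).succ (pb k).succ = (pb k).succ := fun k =>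
        Equiv.swap_apply_of_ne_of_ne (Fin.succ_ne_zero _)
          fun h => pa_ne_pb i k (Fin.succ_injective _ h.symm)
      have e2 : ∀ k ≠ i, Equiv.swap 0 (pa i).succ (pa k).succ = (pa k).succ := fun k hk =>
        Equiv.swap_apply_of_ne_of_ne (Fin.succ_ne_zero _)
          fun h => hk (pa_injective (Fin.succ_injective _ h))
      simp only [F, Equiv.Perm.mul_apply, e1, Equiv.swap_apply_left]
      rw [← Finset.mul_prod_erase _ _ (Finset.mem_univ i), ← Finset.mul_prod_erase _ _
        (Finset.mem_univ i), Equiv.swap_apply_right, hρ, ← mul_assoc, ← mul_assoc, hX (ρ 0) j,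
        hX (ρ (pa i).succ) j, mul_neg, mul_neg, mul_comm (X j _)]
      congr 1
      refine Finset.prod_congr rfl fun k hk => ?_
      rw [e2 k (Finset.ne_of_mem_erase hk)]
  choose! g hg0 hgc hgF using key
  let G : Equiv.Perm (Fin (2 * n + 1)) → Equiv.Perm (Fin (2 * n + 1)) := fun ρ =>
    ρ * Equiv.swap 0 (g (ρ.symm j))
  have hG : ∀ ρ : Equiv.Perm (Fin (2 * n + 1)), ρ.symm j ≠ 0 → (G ρ).symm j = ρ.symm j := by
    intro ρ h
    rw [Equiv.symm_apply_eq]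
    simp only [G, Equiv.Perm.mul_apply]
    rw [Equiv.swap_apply_of_ne_of_ne h (hgc _ h).symm, Equiv.apply_symm_apply]
  have hF0 : ∀ ρ : Equiv.Perm (Fin (2 * n + 1)), ρ.symm j = 0 → F ρ = 0 := by
    intro ρ h
    rw [Equiv.symm_apply_eq] at h
    simp only [F, ← h, h0, zero_mul]
  refine (Finset.sum_subset (Finset.subset_univ
    (Finset.univ.filter fun ρ : Equiv.Perm (Fin (2 * n + 1)) => ρ.symm j ≠ 0)) ?_).symm.trans ?_
  · intro ρ _ hρ
    rw [show X j (ρ 0) * _ = F ρ from rfl, hF0 ρ (by simpa using hρ), smul_zero]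
  refine Finset.sum_involution (fun ρ _ => G ρ) ?_ ?_ ?_ ?_
  · intro ρ hρ
    replace hρ : ρ.symm j ≠ 0 := by simpa using hρ
    change (_ : ℤ) • F ρ + (_ : ℤ) • F (G ρ) = 0
    rw [hgF _ hρ ρ (by simp), Equiv.Perm.sign_mul, Equiv.Perm.sign_swap (hg0 _ hρ).symm]
    simp
  · intro ρ hρ _ h
    replace hρ : ρ.symm j ≠ 0 := by simpa using hρ
    have : Equiv.swap 0 (g (ρ.symm j)) = 1 := mul_eq_left.1 h
    exact hg0 _ hρ (Equiv.swap_eq_one_iff.1 this).symm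
  · intro ρ hρ
    replace hρ : ρ.symm j ≠ 0 := by simpa using hρ
    simp [hG ρ hρ, hρ]
  · intro ρ hρ
    replace hρ : ρ.symm j ≠ 0 := by simpa using hρ
    change G ρ * _ = ρ
    rw [hG ρ hρ, mul_assoc, Equiv.swap_mul_self, mul_one]

end Pfaffian

section Standard

variable {n : ℕ}

/-- The standard skew form on a two-element set. -/
def skw (s t : Fin 2) : ℤ := if s = 0 ∧ t = 1 then 1 else if s = 1 ∧ t = 0 then -1 else 0

/-- Pairs of consecutive elements. -/
noncomputable def pairEquiv (n : ℕ) : Fin n × Fin 2 ≃ Fin (2 * n) :=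
  Equiv.ofBijective (fun x => if x.2 = 0 then pa x.1 else pb x.1) <| by
    refine ⟨fun x y h => ?_, fun c => ?_⟩
    · rcases x with ⟨i, s⟩
      rcases y with ⟨j, t⟩
      fin_cases s <;> fin_cases t <;> simp at h
      · rw [pa_injective h]
      · exact (pa_ne_pb _ _ h).elim
      · exact (pa_ne_pb _ _ h.symm).elim
      · rw [pb_injective h]
    · obtain ⟨i, rfl | rfl⟩ := eq_pa_or_pb c
      · exact ⟨(i, 0), by simp⟩
      · exact ⟨(i, 1), by simp⟩

theorem pairEquiv_zero (i : Fin n) : pairEquiv n (i, 0) = pa i := rfl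
theorem pairEquiv_one (i : Fin n) : pairEquiv n (i, 1) = pb i := rfl

/-- The standard skew form on pairs. -/
def stdPair (x y : Fin n × Fin 2) : ℤ := if x.1 = y.1 then skw x.2 y.2 else 0

theorem skw_eq_sign : ∀ f : Equiv.Perm (Fin 2), skw (f 0) (f 1) = Equiv.Perm.sign f := by decide

theorem stdPair_term_nonneg (σ : Equiv.Perm (Fin n × Fin 2)) :
    0 ≤ (Equiv.Perm.sign σ : ℤ) * ∏ i, stdPair (σ (i, 0)) (σ (i, 1)) := by
  by_cases h0 : ∏ i, stdPair (σ (i, 0)) (σ (i, 1)) = 0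
  · rw [h0, mul_zero]
  have h1 : ∀ i, stdPair (σ (i, 0)) (σ (i, 1)) ≠ 0 := fun i =>
    Finset.prod_ne_zero_iff.1 h0 i (Finset.mem_univ i)
  have h2 : ∀ i, (σ (i, 0)).1 = (σ (i, 1)).1 := fun i => by
    by_contra h
    exact h1 i (by simp [stdPair, h])
  have h3 : ∀ i, (σ (i, 0)).2 ≠ (σ (i, 1)).2 := fun i h => by
    have := h2 i
    exact (Fin.zero_ne_one (n := 0)) (congrArg Prod.snd (σ.injective (Prod.ext this h)))
  have h4 : ∀ i s, (σ (i, s)).1 = (σ (i, 0)).1 := by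
    intro i s
    fin_cases s
    · rfl
    · exact (h2 i).symm
  have hinj : ∀ i, Function.Injective fun s => (σ (i, s)).2 := by
    intro i s t hst
    have := σ.injective (Prod.ext ((h4 i s).trans (h4 i t).symm) hst)
    exact congrArg Prod.snd this
  let f : Fin n → Equiv.Perm (Fin 2) := fun i => Equiv.ofBijective _
    (Finite.injective_iff_bijective.1 (hinj i))
  have hπ : Function.Injective fun i => (σ (i, 0)).1 := by
    intro i k h
    obtain ⟨s, hs⟩ := (f i).surjective (σ (k, 0)).2
    have : σ (i, s) = σ (k, 0) := Prod.ext ((h4 i s).trans h) hs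
    exact congrArg Prod.fst (σ.injective this)
  let π : Equiv.Perm (Fin n) := Equiv.ofBijective _ (Finite.injective_iff_bijective.1 hπ)
  have hσ : σ = Equiv.prodCongrLeft (fun _ => π) * Equiv.prodCongrRight f := by
    ext1 ⟨i, s⟩
    exact Prod.ext (h4 i s) rfl
  have hs : (Equiv.Perm.sign σ : ℤ) = ∏ i, (Equiv.Perm.sign (f i) : ℤ) := by
    rw [hσ, Equiv.Perm.sign_mul, Equiv.Perm.sign_prodCongrLeft, Equiv.Perm.sign_prodCongrRight]
    simp
  rw [hs, ← Finset.prod_mul_distrib]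
  refine Finset.prod_nonneg fun i _ => ?_
  have : stdPair (σ (i, 0)) (σ (i, 1)) = Equiv.Perm.sign (f i) := by
    rw [stdPair, if_pos (h2 i), ← skw_eq_sign]
    rfl
  rw [this]
  exact mul_self_nonneg _

/-- The standard skew matrix. -/
noncomputable def stdSkew (n : ℕ) (a b : Fin (2 * n)) : ℤ :=
  stdPair ((pairEquiv n).symm a) ((pairEquiv n).symm b)

theorem pfu_stdSkew_pos : 0 < pfu (stdSkew n) := by
  have h : pfu (stdSkew n) = ∑ σ : Equiv.Perm (Fin n × Fin 2),
      (Equiv.Perm.sign σ : ℤ) * ∏ i, stdPair (σ (i, 0)) (σ (i, 1)) := by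
    rw [pfu, ← (pairEquiv n).permCongr.sum_comp]
    refine Finset.sum_congr rfl fun σ _ => ?_
    rw [Equiv.Perm.sign_permCongr, smul_eq_mul]
    congr 1
    refine Finset.prod_congr rfl fun i _ => ?_
    simp [stdSkew, ← pairEquiv_zero, ← pairEquiv_one]
  rw [h]
  refine lt_of_lt_of_le zero_lt_one (le_trans ?_ (Finset.single_le_sum
    (fun σ _ => stdPair_term_nonneg σ) (Finset.mem_univ 1)))
  simp [stdPair, skw]

theorem stdPair_skew (x y : Fin n × Fin 2) : stdPair x y = - stdPair y x := by
  have : ∀ s t, skw s t = - skw t s := by decide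
  simp only [stdPair, eq_comm (a := y.1)]
  split_ifs
  · exact this _ _
  · simp

theorem stdPair_self (x : Fin n × Fin 2) : stdPair x x = 0 := by
  have : ∀ s, skw s s = 0 := by decide
  simp [stdPair, this]

theorem stdSkew_skew (a b : Fin (2 * n)) : stdSkew n a b = - stdSkew n b a := stdPair_skew _ _

theorem stdSkew_mul_self :
    (Matrix.of (stdSkew n)) * (Matrix.of (stdSkew n)) = -1 := by
  have hs : ∀ s t : Fin 2, ∑ u, skw s u * skw u t = if s = t then -1 else 0 := by decide
  ext a b
  rw [Matrix.mul_apply, ← (pairEquiv n).sum_comp]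
  simp only [Matrix.of_apply, stdSkew, Equiv.symm_apply_apply]
  obtain ⟨⟨i, s⟩, rfl⟩ := (pairEquiv n).surjective a
  obtain ⟨⟨j, t⟩, rfl⟩ := (pairEquiv n).surjective b
  simp only [Equiv.symm_apply_apply, stdPair, Fintype.sum_prod_type, Matrix.neg_apply,
    Matrix.one_apply, EmbeddingLike.apply_eq_iff_eq, Prod.mk.injEq]
  by_cases hij : i = j
  · subst hij
    rw [Finset.sum_eq_single i]
    · simp only [if_true, hs, true_and]
      split_ifs <;> simp
    · intro k _ hk
      simp [hk]
    · simp
  · rw [Finset.sum_eq_zero]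
    · simp [hij]
    · intro k _
      refine Finset.sum_eq_zero fun u _ => ?_
      by_cases hik : i = k
      · subst hik; simp [hij]
      · simp [hik]

theorem det_stdSkew_ne_zero : (Matrix.of (stdSkew n)).det ≠ 0 := by
  intro h
  have := congrArg Matrix.det (stdSkew_mul_self (n := n))
  rw [Matrix.det_mul, h, zero_mul, Matrix.det_neg] at this
  simp at this

end Standard

section GenericPf

variable {n : ℕ} {K : Type*} [Field K] [CharZero K]

/-- Index type of the variables of the generic skew matrix. -/
abbrev Prs (N : ℕ) := {p : Fin N × Fin N // p.1 < p.2}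

/-- The generic skew matrix. -/
noncomputable def gX (N : ℕ) (K : Type*) [CommRing K] (i j : Fin N) : MvPolynomial (Prs N) K :=
  if h : i < j then MvPolynomial.X ⟨(i, j), h⟩ else
    if h : j < i then - MvPolynomial.X ⟨(j, i), h⟩ else 0

theorem gX_of_lt {N : ℕ} {K : Type*} [CommRing K] {i j : Fin N} (h : i < j) :
    gX N K i j = MvPolynomial.X ⟨(i, j), h⟩ := by simp [gX, h]

theorem gX_self {N : ℕ} {K : Type*} [CommRing K] (i : Fin N) : gX N K i i = 0 := by simp [gX]

theorem gX_skew {N : ℕ} {K : Type*} [CommRing K] (i j : Fin N) : gX N K i j = - gX N K j i := by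
  rcases lt_trichotomy i j with h | rfl | h
  · simp [gX, h, h.not_gt]
  · simp [gX]
  · simp [gX, h, h.not_gt]

theorem isGen_gX (N : ℕ) (K : Type*) [CommRing K] : IsGen (gX N K) :=
  ⟨gX_skew, gX_self, id, Function.injective_id, fun p => gX_of_lt p.2⟩

/-- Specialize the generic skew matrix. -/
theorem aeval_gX {N : ℕ} {K A : Type*} [CommRing K] [CommRing A] [Algebra K A]
    {B : Fin N → Fin N → A} (h : ∀ i j, B i j = - B j i) (h0 : ∀ i, B i i = 0) (i j : Fin N) :
    MvPolynomial.aeval (fun p : Prs N => B p.1.1 p.1.2) (gX N K i j) = B i j := by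
  rcases lt_trichotomy i j with hij | rfl | hij
  · simp [gX, hij]
  · simp [gX, h0]
  · simp [gX, hij, hij.not_gt, ← h]

/-- Pad the standard skew matrix by a zero row and column at `k`. -/
noncomputable def padSkew (k : Fin (2 * n + 1)) : Fin (2 * n + 1) → Fin (2 * n + 1) → ℤ :=
  k.insertNth (α := fun _ => Fin (2 * n + 1) → ℤ) 0
    fun i => k.insertNth (α := fun _ => ℤ) 0 (stdSkew n i)

theorem padSkew_succAbove (k : Fin (2 * n + 1)) (i j : Fin (2 * n)) :
    padSkew k (k.succAbove i) (k.succAbove j) = stdSkew n i j := by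
  simp [padSkew]

theorem padSkew_self_left (k j : Fin (2 * n + 1)) : padSkew k k j = 0 := by
  simp [padSkew]

theorem padSkew_self_right (k i : Fin (2 * n + 1)) : padSkew k i k = 0 := by
  rcases Fin.eq_self_or_eq_succAbove k i with rfl | ⟨i, rfl⟩ <;> simp [padSkew]

theorem padSkew_skew (k i j : Fin (2 * n + 1)) : padSkew k i j = - padSkew k j i := by
  rcases Fin.eq_self_or_eq_succAbove k i with rfl | ⟨i, rfl⟩
  · rw [padSkew_self_left, padSkew_self_right, neg_zero]
  rcases Fin.eq_self_or_eq_succAbove k j with rfl | ⟨j, rfl⟩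
  · rw [padSkew_self_left, padSkew_self_right, neg_zero]
  rw [padSkew_succAbove, padSkew_succAbove, stdSkew_skew]

theorem padSkew_diag (k i : Fin (2 * n + 1)) : padSkew k i i = 0 := by
  have := padSkew_skew k i i
  omega

theorem eval_padSkew (k i j : Fin (2 * n + 1)) :
    MvPolynomial.aeval (fun p : Prs (2 * n + 1) => ((padSkew k p.1.1 p.1.2 : ℤ) : K))
      (gX (2 * n + 1) K i j) = padSkew k i j :=
  aeval_gX (B := fun i j => ((padSkew k i j : ℤ) : K))
    (fun i j => by rw [padSkew_skew]; push_cast; rfl) (fun i => by simp [padSkew_diag]) i j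

theorem subpf_gX_ne_zero (k : Fin (2 * n + 1)) : subpf (gX (2 * n + 1) K) k ≠ 0 := by
  intro h
  have := congrArg (MvPolynomial.aeval
    (fun p : Prs (2 * n + 1) => ((padSkew k p.1.1 p.1.2 : ℤ) : K))).toRingHom h
  rw [subpf, map_mul, map_pfu, map_zero] at this
  simp only [AlgHom.toRingHom_eq_coe, RingHom.coe_coe, eval_padSkew, padSkew_succAbove] at this
  have h2 := (pfu_stdSkew_pos (n := n)).ne'
  have h3 : pfu (fun i j => ((stdSkew n i j : ℤ) : K)) = (pfu (stdSkew n) : ℤ) :=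
    (map_pfu (Int.castRingHom K) _).symm
  rw [h3] at this
  simp [h2] at this

theorem det_gX_ne_zero :
    (Matrix.of fun i j : Fin (2 * n) => gX (2 * n + 1) K i.succ j.succ).det ≠ 0 := by
  intro h
  have := congrArg (MvPolynomial.aeval
    (fun p : Prs (2 * n + 1) => ((padSkew 0 p.1.1 p.1.2 : ℤ) : K))).toRingHom h
  rw [RingHom.map_det, map_zero] at this
  have e : (MvPolynomial.aeval
    (fun p : Prs (2 * n + 1) => ((padSkew 0 p.1.1 p.1.2 : ℤ) : K))).toRingHom.mapMatrix
      (Matrix.of fun i j : Fin (2 * n) => gX (2 * n + 1) K i.succ j.succ)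
      = (Int.castRingHom K).mapMatrix (Matrix.of (stdSkew n)) := by
    ext i j
    have h1 := padSkew_succAbove (n := n) 0 i j
    simp only [Fin.succAbove_zero] at h1
    have h2 := eval_padSkew (K := K) 0 i.succ j.succ
    rw [h1] at h2
    exact h2
  rw [e, ← RingHom.map_det] at this
  exact det_stdSkew_ne_zero (n := n) (by simpa using this)

end GenericPf

section Evaluation

variable {N : ℕ} {R : Type*} [CommRing R]

/-- `a` is homogeneous of degree `d` in the variables `T`. -/
def Hmg (d : ℕ) (a : Mon N R) : Prop := ∀ τ, a τ ≠ 0 → ∑ i, τ i = d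

theorem Hmg.zero (d : ℕ) : Hmg d (0 : Mon N R) := fun _ h => absurd rfl h

theorem Hmg.add {d : ℕ} {a b : Mon N R} (ha : Hmg d a) (hb : Hmg d b) : Hmg d (a + b) := by
  intro τ h
  by_cases h1 : a τ = 0
  · exact hb τ fun h2 => h (by simp [h1, h2])
  · exact ha τ h1

theorem Hmg.smul {d : ℕ} {a : Mon N R} (ha : Hmg d a) (r : R) : Hmg d (r • a) :=
  fun τ h => ha τ fun h2 => h (by simp [h2])

theorem Hmg.sum {d : ℕ} {α : Type*} {s : Finset α} {f : α → Mon N R} (h : ∀ a ∈ s, Hmg d (f a)) :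
    Hmg d (∑ a ∈ s, f a) := by
  classical
  induction s using Finset.induction_on with
  | empty => exact Hmg.zero d
  | insert a s ha ih =>
    rw [Finset.sum_insert ha]
    exact (h a (by simp)).add (ih fun c hc => h c (by simp [hc]))

theorem Hmg.mT {d : ℕ} {a : Mon N R} (ha : Hmg d a) (j : Fin N) : Hmg (d + 1) (mT j a) := by
  intro τ h
  by_cases hτ : τ j = 0
  · simp [mT_apply, hτ] at h
  · rw [← sum_sub_single hτ, ha _ (by simpa [mT_apply, hτ] using h)]

/-- Evaluation of the degree `d` part at `T = p`. -/
def ev (p : Fin N → R) (d : ℕ) : Mon N R →ₗ[R] R where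
  toFun a := ∑ τ ∈ Finset.piAntidiag Finset.univ d, a τ * ∏ i, p i ^ τ i
  map_add' a b := by simp [add_mul, Finset.sum_add_distrib]
  map_smul' r a := by simp [mul_assoc, Finset.mul_sum]

theorem ev_apply (p : Fin N → R) (d : ℕ) (a : Mon N R) :
    ev p d a = ∑ τ ∈ Finset.piAntidiag Finset.univ d, a τ * ∏ i, p i ^ τ i := rfl

theorem mem_antidiag {d : ℕ} {τ : Fin N → ℕ} :
    τ ∈ Finset.piAntidiag Finset.univ d ↔ ∑ i, τ i = d := by
  simp [Finset.mem_piAntidiag]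

theorem sub_add_single {τ : Fin N → ℕ} {j : Fin N} (h : τ j ≠ 0) :
    τ - Pi.single j 1 + Pi.single j 1 = τ := by
  refine tsub_add_cancel_of_le fun k => ?_
  rcases eq_or_ne k j with rfl | h'
  · simp; omega
  · simp [h']

theorem ev_mT (p : Fin N → R) (d : ℕ) (j : Fin N) (a : Mon N R) :
    ev p (d + 1) (mT j a) = p j * ev p d a := by
  rw [ev_apply, ev_apply, Finset.mul_sum]
  symm
  refine Finset.sum_of_injOn (fun τ => τ + Pi.single j 1) (fun _ _ _ _ h => add_right_cancel h)
    ?_ ?_ ?_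
  · intro τ hτ
    rw [Finset.mem_coe, mem_antidiag] at *
    rw [sum_add_single, hτ]
  · intro τ hτ h
    by_cases h0 : τ j = 0
    · simp [mT_apply, h0]
    · refine absurd ⟨τ - Pi.single j 1, ?_, sub_add_single h0⟩ h
      rw [Finset.mem_coe, mem_antidiag] at *
      have := sum_sub_single h0
      omega
  · intro τ _
    have e : τ + Pi.single j 1 - Pi.single j 1 = τ := add_tsub_cancel_right _ _
    have : ∏ i, p i ^ (τ + Pi.single j 1 : Fin N → ℕ) i = (∏ i, p i ^ τ i) * p j := by
      simp only [Pi.add_apply, pow_add, Finset.prod_mul_distrib]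
      congr 1
      rw [Finset.prod_eq_single j] <;> simp +contextual
    rw [this, mT_apply, e]
    simp; ring

theorem ev_mT_pow (p : Fin N → R) (d M : ℕ) (j : Fin N) (a : Mon N R) :
    ev p (d + M) ((mT j ^ M) a) = p j ^ M * ev p d a := by
  induction M with
  | zero => simp
  | succ M ih => rw [pow_succ', Module.End.mul_apply, ← add_assoc, ev_mT, ih, pow_succ']; ring

/-- Place `a` in exterior degree zero. -/
def vac (a : Mon N R) : Cx N R := fun I => if I = ∅ then a else 0

@[simp] theorem vac_empty (a : Mon N R) : vac a ∅ = a := by simp [vac]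

theorem Hmg.vac {d : ℕ} {a : Mon N R} (ha : Hmg d a) : InL d d (vac a) := by
  intro I τ h
  by_cases hI : I = ∅
  · subst hI
    have := ha τ (by simpa using h)
    simp [this]
  · simp [PfaffExt.vac, hI] at h

theorem InL.hmg {m : ℤ} {d : ℕ} {z : Cx N R} (hz : InL m d z) (I : Finset (Fin N)) :
    Hmg d (z I) := fun τ h => by exact_mod_cast (hz I τ h).1

theorem dif_apply_empty (X : Fin N → Fin N → R) (y : Cx N R) :
    dif X y ∅ = ∑ k, ∑ j, X k j • mT j (y {k}) := by
  rw [Finset.sum_comm, dif, LinearMap.sum_apply, Fock.sum_apply]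
  refine Finset.sum_congr rfl fun j _ => ?_
  simp only [Module.End.mul_apply, lft_apply, theta, LinearMap.add_apply, LinearMap.sum_apply,
    LinearMap.smul_apply, Fock.add_apply, Fock.sum_apply, Fock.smul_apply, map_add, map_sum,
    map_smul]
  simp [cr_apply, an_apply, fsgn]

/-- `a` lies in the ideal generated by the entries of `X T`, in degree `d`. -/
def InF (X : Fin N → Fin N → R) (d : ℕ) (a : Mon N R) : Prop :=
  ∃ y, InL (d : ℤ) ((d : ℤ) - 1) y ∧ dif X y ∅ = a

variable {X : Fin N → Fin N → R} {d : ℕ}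

theorem InF.add {a b : Mon N R} (ha : InF X d a) (hb : InF X d b) : InF X d (a + b) := by
  obtain ⟨y, hy, rfl⟩ := ha
  obtain ⟨w, hw, rfl⟩ := hb
  exact ⟨y + w, hy.add hw, by simp⟩

theorem InF.smul {a : Mon N R} (ha : InF X d a) (r : R) : InF X d (r • a) := by
  obtain ⟨y, hy, rfl⟩ := ha
  exact ⟨r • y, hy.smul r, by simp⟩

theorem InF.zero : InF X d 0 := ⟨0, InL.zero, by simp⟩

theorem InF.mT {a : Mon N R} (ha : InF X d a) (j : Fin N) : InF X (d + 1) (mT j a) := by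
  obtain ⟨y, hy, rfl⟩ := ha
  refine ⟨lft (PfaffExt.mT j) y, by convert hy.mT j using 1 <;> (push_cast; ring), ?_⟩
  rw [← Module.End.mul_apply, ← (commute_mT_dif X j).eq, Module.End.mul_apply, lft_apply]

theorem InF.mT_pow {a : Mon N R} (ha : InF X d a) (j : Fin N) (M : ℕ) :
    InF X (d + M) ((PfaffExt.mT j ^ M) a) := by
  induction M with
  | zero => simpa using ha
  | succ M ih => rw [pow_succ', Module.End.mul_apply, ← add_assoc]; exact ih.mT j

theorem Hmg.mT_pow {a : Mon N R} (ha : Hmg d a) (j : Fin N) (M : ℕ) :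
    Hmg (d + M) ((PfaffExt.mT j ^ M) a) := by
  induction M with
  | zero => simpa using ha
  | succ M ih => rw [pow_succ', Module.End.mul_apply, ← add_assoc]; exact ih.mT j

theorem Hmg.inF_row {a : Mon N R} (ha : Hmg d a) (k : Fin N) :
    InF X (d + 1) (∑ j, X k j • PfaffExt.mT j a) := by
  refine ⟨cr R k (PfaffExt.vac a), ?_, ?_⟩
  · intro I τ h
    by_cases hk : k ∈ I
    · have h' : PfaffExt.vac a (I.erase k) τ ≠ 0 := by
        intro h'; simp [cr_apply, hk, h'] at h
      obtain ⟨h1, h2, h3⟩ := ha.vac _ _ h'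
      have := Finset.card_erase_add_one hk
      rw [Int.even_iff] at *
      push_cast at *
      refine ⟨by omega, by omega, by omega⟩
    · simp [cr_apply, hk] at h
  · rw [dif_apply_empty, Finset.sum_eq_single k]
    · simp [cr_apply, PfaffExt.vac, fsgn]
    · intro b _ hb
      simp [cr_apply, hb.symm]
    · simp

theorem ev_inF {p : Fin N → R} (hp : ∀ k, ∑ j, X k j * p j = 0) {a : Mon N R}
    (ha : InF X (d + 1) a) : ev p (d + 1) a = 0 := by
  obtain ⟨y, hy, rfl⟩ := ha
  rw [dif_apply_empty, map_sum]
  refine Finset.sum_eq_zero fun k _ => ?_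
  simp only [map_sum, map_smul, ev_mT, smul_eq_mul, ← mul_assoc]
  rw [← Finset.sum_mul, hp, zero_mul]

theorem InL.raise {m b : ℤ} {z : Cx N R} (hz : InL m b z)
    (h : ∀ I, (I.card : ℤ) + b = m → z I = 0) : InL (m + 2) b z := by
  intro I τ hI
  obtain ⟨h1, h2, h3⟩ := hz I τ hI
  have : (I.card : ℤ) + b ≠ m := fun h' => hI (by rw [h I h']; rfl)
  rw [Int.even_iff] at *
  refine ⟨h1, by omega, by omega⟩

end Evaluation

section LinearType

variable {N : ℕ} {R : Type*} [CommRing R] {X : Fin (N + 1) → Fin (N + 1) → R} {d : ℕ}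

theorem inF_of_mT_zero (hE : Ex X d) (hT : NzT X (d + 2))
    (hdd : ∀ z, dif X (dif X z) = 0) {a : Mon (N + 1) R} (ha : Hmg d a)
    (h : InF X (d + 1) (mT 0 a)) : InF X d a := by
  obtain ⟨y, hy, e⟩ := h
  push_cast at hy
  have h1 : InL ((d : ℤ) + 2) (d + 2 - 1) (dif X (vac a)) := by
    convert (ha.vac.dif X).raise ?_ using 1
    · ring
    · intro I hI
      omega
  have hv : lft (mT 0) (vac a) ∅ = mT 0 a := by rw [lft_apply, vac_empty]
  have h2 : InL ((d : ℤ) + 2 + 1) (d + 2 - 1) (lft (mT 0) (vac a) - dif X y) := by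
    have h3 := hy.dif X
    have h4 : InL ((d : ℤ) + 1) (d + 2 - 1) (lft (mT 0) (vac a) - dif X y) := by
      refine InL.sub ?_ ?_
      · convert ha.vac.mT 0 using 1; ring
      · convert h3 using 1; ring
    convert h4.raise ?_ using 1
    · ring
    · intro I hI
      have : I = ∅ := Finset.card_eq_zero.1 (by omega)
      rw [this, Fock.sub_apply, hv, e, sub_self]
  obtain ⟨v, hv1, hv2⟩ := hT _ _ h1 (hdd _) h2 (by
    rw [map_sub, hdd, sub_zero, ← Module.End.mul_apply, (commute_mT_dif X 0).eq,
      Module.End.mul_apply])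
  have h5 : InL (d : ℤ) d v := by
    intro I τ hI
    obtain ⟨h1, h2, h3⟩ := hv1 I τ hI
    rw [Int.even_iff] at *
    refine ⟨by omega, by omega, by omega⟩
  have h6 : v ∅ = 0 := by
    ext τ
    by_contra hI
    obtain ⟨h1, h2, h3⟩ := hv1 ∅ τ hI
    simp at h2
  obtain ⟨w, hw1, hw2⟩ := hE d (vac a - v) (ha.vac.sub h5) (by rw [map_sub, hv2, sub_self])
    (by omega)
  exact ⟨w, hw1, by rw [hw2, Fock.sub_apply, vac_empty, h6, sub_zero]⟩

theorem inF_of_mT_zero_pow (hE : ∀ m : ℤ, 1 ≤ m → Ex X m) (hT : ∀ m : ℤ, 1 ≤ m → NzT X m)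
    (hdd : ∀ z, dif X (dif X z) = 0) (hd : 1 ≤ d) {a : Mon (N + 1) R} (ha : Hmg d a) (M : ℕ)
    (h : InF X (d + M) ((mT 0 ^ M) a)) : InF X d a := by
  induction M with
  | zero => simpa using h
  | succ M ih =>
    refine ih (inF_of_mT_zero (hE _ (by omega)) (hT _ (by omega)) hdd
      (ha.mT_pow 0 M) ?_)
    rwa [pow_succ', Module.End.mul_apply, ← add_assoc] at h

/-- After multiplication by a power of `T_0`, `a` is congruent to an element with coefficients
satisfying `P`. -/
def Elim (X : Fin (N + 1) → Fin (N + 1) → R) (P : Subring R) (d : ℕ) (a : Mon (N + 1) R) : Prop :=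
  ∃ M g, Hmg (d + M) g ∧ (∀ τ, g τ ∈ P) ∧ InF X (d + M) ((mT 0 ^ M) a - g)

variable {P : Subring R}

theorem mT_pow_mem {g : Mon (N + 1) R} (hg : ∀ τ, g τ ∈ P) (j) (M : ℕ) (τ) :
    (mT j ^ M) g τ ∈ P := by
  induction M generalizing τ with
  | zero => exact hg τ
  | succ M ih =>
    rw [pow_succ', Module.End.mul_apply, mT_apply]
    split_ifs
    · exact P.zero_mem
    · exact ih _

theorem Elim.add {a b : Mon (N + 1) R} (ha : Elim X P d a) (hb : Elim X P d b) :
    Elim X P d (a + b) := by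
  obtain ⟨M, g, h1, h2, h3⟩ := ha
  obtain ⟨M', g', h1', h2', h3'⟩ := hb
  refine ⟨M + M', (mT 0 ^ M') g + (mT 0 ^ M) g', ?_, fun τ => ?_, ?_⟩
  · refine Hmg.add ?_ ?_
    · rw [← add_assoc]; exact h1.mT_pow 0 M'
    · rw [add_comm M, ← add_assoc]; exact h1'.mT_pow 0 M
  · exact P.add_mem (mT_pow_mem h2 _ _ _) (mT_pow_mem h2' _ _ _)
  · have e1 := h3.mT_pow 0 M'
    have e2 := h3'.mT_pow 0 M
    rw [add_assoc] at e1
    rw [add_assoc, add_comm M' M] at e2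
    convert e1.add e2 using 1
    rw [map_sub, map_sub, map_add, ← Module.End.mul_apply (mT 0 ^ M'),
      ← Module.End.mul_apply (mT 0 ^ M), ← pow_add, ← pow_add, add_comm M' M]
    abel

theorem Elim.zero : Elim X P d 0 :=
  ⟨0, 0, Hmg.zero _, fun _ => P.zero_mem, by simpa using InF.zero⟩

theorem Elim.sum {α : Type*} {s : Finset α} {f : α → Mon (N + 1) R}
    (h : ∀ a ∈ s, Elim X P d (f a)) : Elim X P d (∑ a ∈ s, f a) := by
  classical
  induction s using Finset.induction_on with
  | empty => exact Elim.zero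
  | insert a s ha ih =>
    rw [Finset.sum_insert ha]
    exact (h a (by simp)).add (ih fun c hc => h c (by simp [hc]))

theorem Elim.smul_mem {a : Mon (N + 1) R} (ha : Elim X P d a) {r : R} (hr : r ∈ P) :
    Elim X P d (r • a) := by
  obtain ⟨M, g, h1, h2, h3⟩ := ha
  refine ⟨M, r • g, h1.smul r, fun τ => P.mul_mem hr (h2 τ), ?_⟩
  rw [map_smul, ← smul_sub]
  exact h3.smul r

theorem Elim.smul_col (hX : ∀ i j, X i j = - X j i)
    (hP : ∀ i j : Fin N, X i.succ j.succ ∈ P) {a : Mon (N + 1) R}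
    (ha : Elim X P d a) (j : Fin N) : Elim X P d (X 0 j.succ • a) := by
  obtain ⟨M, g, h1, h2, h3⟩ := ha
  refine ⟨M + 1, ∑ l : Fin N, X j.succ l.succ • mT l.succ g, ?_, fun τ => ?_, ?_⟩
  · exact Hmg.sum fun l _ => (h1.mT l.succ).smul _
  · rw [Mon.sum_apply]
    refine P.sum_mem fun l _ => P.mul_mem (hP _ _) ?_
    have := mT_pow_mem h2 l.succ 1 τ
    rwa [pow_one] at this
  · have e1 := ((h3.mT 0).smul (X 0 j.succ)).add ((h1.inF_row (X := X) j.succ).smul (-1))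
    rw [add_assoc] at e1
    convert e1 using 1
    rw [Fin.sum_univ_succ, hX j.succ 0, pow_succ', Module.End.mul_apply, map_smul, map_smul,
      map_sub, smul_sub]
    simp only [neg_smul, one_smul, neg_add, neg_neg]
    abel

/-- The monomial function. -/
def mono (τ : Fin N → ℕ) : Mon N R := fun σ => if σ = τ then 1 else 0

theorem mono_apply (τ σ : Fin N → ℕ) : (mono τ : Mon N R) σ = if σ = τ then 1 else 0 := rfl

theorem Hmg.eq_sum {a : Mon N R} (ha : Hmg d a) :
    a = ∑ τ ∈ Finset.piAntidiag Finset.univ d, a τ • mono τ := by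
  ext τ
  rw [Mon.sum_apply]
  simp only [Mon.smul_apply, mono_apply, mul_ite, mul_one, mul_zero]
  rw [Finset.sum_eq_single τ, if_pos rfl]
  · exact fun σ _ h => if_neg h.symm
  · intro h
    rw [if_pos rfl]
    by_contra h'
    exact h (mem_antidiag.2 (ha τ h'))

theorem hmg_mono {τ : Fin N → ℕ} (h : ∑ i, τ i = d) : Hmg d (mono τ : Mon N R) := by
  intro σ hσ
  by_cases e : σ = τ
  · rw [e, h]
  · exact absurd (by rw [mono_apply, if_neg e]) hσ

end LinearType

section GenericLinearType

variable {n : ℕ} {K : Type} [Field K] [CharZero K]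

/-- The substitution `x_{j0} = -∑ x_{jl} s_l`. -/
noncomputable def subst (N : ℕ) (K : Type) [Field K] :
    MvPolynomial (Prs (N + 1)) K →ₐ[K] MvPolynomial (Fin N) (MvPolynomial (Prs (N + 1)) K) :=
  MvPolynomial.aeval fun q => if q.1.1 = 0 then
    ∑ l : Fin N, MvPolynomial.C (gX (N + 1) K q.1.2 l.succ) * MvPolynomial.X l
    else MvPolynomial.C (MvPolynomial.X q)

theorem subst_zero_succ (N : ℕ) (j : Fin N) : subst N K (gX (N + 1) K 0 j.succ) =
    ∑ l : Fin N, MvPolynomial.C (gX (N + 1) K j.succ l.succ) * MvPolynomial.X l := by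
  rw [gX_of_lt (Fin.succ_pos j), subst, MvPolynomial.aeval_X, if_pos rfl]

theorem subst_succ_succ (N : ℕ) (i j : Fin N) :
    subst N K (gX (N + 1) K i.succ j.succ) = MvPolynomial.C (gX (N + 1) K i.succ j.succ) := by
  have key : ∀ i j : Fin N, i < j →
    subst N K (gX (N + 1) K i.succ j.succ) = MvPolynomial.C (gX (N + 1) K i.succ j.succ) := by
    intro i j h
    rw [gX_of_lt (Fin.succ_lt_succ_iff.2 h), subst, MvPolynomial.aeval_X,
      if_neg (Fin.succ_ne_zero i)]
  rcases lt_trichotomy i j with h | rfl | h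
  · exact key i j h
  · simp [gX_self]
  · rw [gX_skew, map_neg, map_neg, key j i h]

/-- The subring of elements fixed by the substitution. -/
noncomputable def fixedSubring (N : ℕ) (K : Type) [Field K] :
    Subring (MvPolynomial (Prs (N + 1)) K) :=
  RingHom.eqLocus (subst N K).toRingHom MvPolynomial.C

theorem elim_generic {N d : ℕ} (s : MvPolynomial (Prs (N + 1)) K)
    {a : Mon (N + 1) (MvPolynomial (Prs (N + 1)) K)} (ha : Elim (gX (N + 1) K)
      (fixedSubring N K) d a) : Elim (gX (N + 1) K) (fixedSubring N K) d (s • a) := by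
  have hP : ∀ i j : Fin N, gX (N + 1) K i.succ j.succ ∈ fixedSubring N K :=
    fun i j => subst_succ_succ N i j
  induction s using MvPolynomial.induction_on generalizing a with
  | C c =>
    refine ha.smul_mem ?_
    change subst N K _ = _
    rw [← MvPolynomial.algebraMap_eq, AlgHom.commutes]
    rfl
  | add p q hp hq => rw [add_smul]; exact (hp ha).add (hq ha)
  | mul_X p q hp =>
    rw [mul_smul]
    refine hp ?_
    obtain ⟨⟨i, j⟩, hij⟩ := q
    rw [← gX_of_lt hij]
    obtain ⟨j, rfl⟩ := Fin.exists_succ_eq.2 (Fin.ne_zero_of_lt hij)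
    induction i using Fin.cases with
    | zero => exact ha.smul_col gX_skew hP j
    | succ i => exact ha.smul_mem (hP i j)

theorem subst_subpf_zero : subst (2 * n) K (subpf (gX (2 * n + 1) K) 0)
    = MvPolynomial.C (subpf (gX (2 * n + 1) K) 0) := by
  have h1 := map_pfu (subst (2 * n) K).toRingHom
    fun i j => gX (2 * n + 1) K i.succ j.succ
  have h2 := map_pfu (MvPolynomial.C (σ := Fin (2 * n)))
    fun i j => gX (2 * n + 1) K i.succ j.succ
  simp only [subpf, Fin.val_zero, pow_zero, one_mul, Fin.succAbove_zero]
  rw [h2]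
  refine h1.trans ?_
  congr 1
  funext i j
  exact subst_succ_succ _ _ _

theorem neg_mul_add_eq_zero {R : Type*} [CommRing R] {a b c : R} (h : -a * c + b = 0) :
    b = a * c := by linear_combination h

theorem subst_subpf_succ (j : Fin (2 * n)) : subst (2 * n) K (subpf (gX (2 * n + 1) K) j.succ)
    = MvPolynomial.C (subpf (gX (2 * n + 1) K) 0) * MvPolynomial.X j := by
  let v : Fin (2 * n) → MvPolynomial (Fin (2 * n)) (MvPolynomial (Prs (2 * n + 1)) K) := fun j =>
    subst (2 * n) K (subpf (gX (2 * n + 1) K) j.succ)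
      - MvPolynomial.C (subpf (gX (2 * n + 1) K) 0) * MvPolynomial.X j
  suffices h : v = 0 from sub_eq_zero.1 (congrFun h j)
  have hd : (MvPolynomial.C.mapMatrix (Matrix.of fun i j : Fin (2 * n) =>
      gX (2 * n + 1) K i.succ j.succ) : Matrix _ _
        (MvPolynomial (Fin (2 * n)) (MvPolynomial (Prs (2 * n + 1)) K))).det ≠ 0 := by
    rw [← RingHom.map_det, Ne, MvPolynomial.C_eq_zero]
    exact det_gX_ne_zero
  refine Matrix.eq_zero_of_mulVec_eq_zero hd (funext fun i => ?_)
  have h := congrArg (subst (2 * n) K)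
    (sum_mul_subpf (X := gX (2 * n + 1) K) gX_skew gX_self i.succ)
  rw [Fin.sum_univ_succ, map_add, map_mul, gX_skew, map_neg, subst_zero_succ, subst_subpf_zero,
    map_sum, map_zero] at h
  simp only [map_mul, subst_succ_succ] at h
  simp only [Matrix.mulVec, dotProduct, RingHom.mapMatrix_apply, Matrix.map_apply, Matrix.of_apply,
    v, mul_sub, Finset.sum_sub_distrib, Pi.zero_apply]
  have h' := neg_mul_add_eq_zero h
  rw [h', sub_eq_zero, Finset.sum_mul]
  refine Finset.sum_congr rfl fun l _ => ?_
  ring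

theorem eq_zero_of_ev_eq_zero {D : ℕ} {g : Mon (2 * n + 1) (MvPolynomial (Prs (2 * n + 1)) K)}
    (hg : Hmg D g) (hP : ∀ τ, g τ ∈ fixedSubring (2 * n) K)
    (h : ev (subpf (gX (2 * n + 1) K)) D g = 0) : g = 0 := by
  have hp0 := subpf_gX_ne_zero (n := n) (K := K) 0
  set p0 := subpf (gX (2 * n + 1) K) 0 with hp
  have h1 := congrArg (subst (2 * n) K) h
  rw [ev_apply, map_sum, map_zero] at h1
  have h2 : ∀ τ ∈ Finset.piAntidiag Finset.univ D,
      subst (2 * n) K (g τ * ∏ i, subpf (gX (2 * n + 1) K) i ^ τ i)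
      = MvPolynomial.C (p0 ^ D) *
        MvPolynomial.monomial (Finsupp.equivFunOnFinite.symm (Fin.tail τ)) (g τ) := by
    intro τ hτ
    have hτ' : subst (2 * n) K (g τ) = MvPolynomial.C (g τ) := hP τ
    rw [mem_antidiag, Fin.sum_univ_succ] at hτ
    rw [map_mul, hτ', map_prod, Fin.prod_univ_succ, map_pow, subst_subpf_zero, MvPolynomial.monomial_eq,
      Finsupp.prod_fintype _ _ (by simp), ← hτ]
    simp only [map_pow, subst_subpf_succ, mul_pow, Finset.prod_mul_distrib, ← hp, pow_add,
      Finset.prod_pow_eq_pow_sum, map_mul, Finsupp.equivFunOnFinite_symm_apply_apply, Fin.tail]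
    ring
  rw [Finset.sum_congr rfl h2, ← Finset.mul_sum] at h1
  have h3 := (mul_eq_zero.1 h1).resolve_left (by
    rw [map_pow]; exact pow_ne_zero _ fun h' => hp0 (MvPolynomial.C_eq_zero.1 h'))
  ext1 τ
  by_contra hτ
  have hs := hg τ hτ
  have h4 := congrArg (MvPolynomial.coeff (Finsupp.equivFunOnFinite.symm (Fin.tail τ))) h3
  rw [MvPolynomial.coeff_sum, Finset.sum_eq_single τ] at h4
  · simp at h4
    exact hτ h4
  · intro σ hσ hne
    rw [MvPolynomial.coeff_monomial, if_neg]
    intro e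
    have e' := Finsupp.equivFunOnFinite.symm.injective e
    rw [mem_antidiag, Fin.sum_univ_succ] at hσ
    rw [Fin.sum_univ_succ] at hs
    have e2 : ∀ i : Fin (2 * n), σ i.succ = τ i.succ := fun i => congrFun e' i
    refine hne (funext fun i => ?_)
    induction i using Fin.cases with
    | zero => simp only [e2] at hσ; omega
    | succ i => exact e2 i
  · intro h'
    exact absurd (mem_antidiag.2 hs) h'

/-- The ideal of submaximal Pfaffians is of linear type. -/
theorem inF_of_ev_eq_zero {d : ℕ} (hd : 1 ≤ d)
    {a : Mon (2 * n + 1) (MvPolynomial (Prs (2 * n + 1)) K)} (ha : Hmg d a)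
    (h : ev (subpf (gX (2 * n + 1) K)) d a = 0) : InF (gX (2 * n + 1) K) d a := by
  have hG := isGen_gX (2 * n + 1) K
  have hel : Elim (gX (2 * n + 1) K) (fixedSubring (2 * n) K) d a := by
    rw [ha.eq_sum]
    refine Elim.sum fun τ hτ => elim_generic _ ⟨0, mono τ, hmg_mono (mem_antidiag.1 hτ), ?_, ?_⟩
    · intro σ
      by_cases e : σ = τ
      · rw [mono_apply, if_pos e]; exact Subring.one_mem _
      · rw [mono_apply, if_neg e]; exact Subring.zero_mem _
    · simpa using InF.zero
  obtain ⟨M, g, h1, h2, h3⟩ := hel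
  have hp := sum_mul_subpf (X := gX (2 * n + 1) K) gX_skew gX_self
  obtain ⟨d, rfl⟩ : ∃ d', d = d' + 1 := ⟨d - 1, by omega⟩
  have h4 : ev (subpf (gX (2 * n + 1) K)) (d + 1 + M) g = 0 := by
    have e : d + 1 + M = d + M + 1 := by ring
    have := h3
    rw [e] at this
    have := ev_inF hp this
    rw [← e, map_sub, ev_mT_pow, h, mul_zero, zero_sub, neg_eq_zero] at this
    exact this
  rw [eq_zero_of_ev_eq_zero h1 h2 h4, sub_zero] at h3
  refine inF_of_mT_zero_pow (fun m hm => hG.ex hm) (fun m hm => hG.nzT hm) (fun z => ?_) hd ha M h3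
  rw [← Module.End.mul_apply, dif_mul_dif gX_skew, LinearMap.zero_apply]

end GenericLinearType

section CliffordAlgebra

variable {N : ℕ} {A : Type*} [Ring A]

/-- The canonical anticommutation relations. -/
structure CAR (ψ ι : Fin N → A) : Prop where
  cc : ∀ i j, ψ i * ψ j = - (ψ j * ψ i)
  aa : ∀ i j, ι i * ι j = - (ι j * ι i)
  ac : ∀ i j, ι i * ψ j = (if i = j then 1 else 0) - ψ j * ι i

variable {ψ ι : Fin N → A}

theorem sum_mul_self_eq_zero [Algebra ℚ A] {a b : Fin N → A} (ha : ∀ i j, a i * a j = - (a j * a i))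
    (hb : ∀ i j, b i * b j = b j * b i) (hab : ∀ i j, Commute (a i) (b j)) :
    (∑ k, a k * b k) * (∑ k, a k * b k) = 0 := by
  have h : (∑ k, a k * b k) * (∑ k, a k * b k) = - ((∑ k, a k * b k) * (∑ k, a k * b k)) := by
    conv_lhs => rw [Finset.sum_mul_sum, Finset.sum_comm]
    conv_rhs => rw [Finset.sum_mul_sum]
    rw [← Finset.sum_neg_distrib]
    refine Finset.sum_congr rfl fun i _ => ?_
    rw [← Finset.sum_neg_distrib]
    refine Finset.sum_congr rfl fun j _ => ?_
    rw [(hab _ _).symm.mul_mul_mul_comm, (hab _ _).symm.mul_mul_mul_comm, ha, hb, neg_mul]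
  have : IsAddTorsionFree A := .of_module_rat A
  exact self_eq_neg.1 h

theorem CAR.anticomm_sum (h : CAR ψ ι) {b c : Fin N → A} (hb : ∀ i j, Commute (b i) (ι j))
    (hc : ∀ i j, Commute (c i) (ψ j)) :
    (∑ l, ι l * c l) * (∑ k, ψ k * b k) + (∑ k, ψ k * b k) * (∑ l, ι l * c l)
      = ∑ k, c k * b k + ∑ k, ∑ l, ψ k * ι l * (b k * c l - c l * b k) := by
  have h1 : (∑ l, ι l * c l) * (∑ k, ψ k * b k)
      = ∑ k, c k * b k - ∑ k, ∑ l, ψ k * ι l * (c l * b k) := by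
    rw [Finset.sum_mul_sum, Finset.sum_comm, ← Finset.sum_sub_distrib]
    refine Finset.sum_congr rfl fun k _ => ?_
    have : ∀ l, ι l * c l * (ψ k * b k) = (if l = k then c l * b k else 0)
        - ψ k * ι l * (c l * b k) := by
      intro l
      rw [(hc l k).mul_mul_mul_comm, h.ac, sub_mul]
      split_ifs <;> simp
    simp only [this, Finset.sum_sub_distrib]
    simp
  have h2 : (∑ k, ψ k * b k) * (∑ l, ι l * c l) = ∑ k, ∑ l, ψ k * ι l * (b k * c l) := by
    rw [Finset.sum_mul_sum]
    refine Finset.sum_congr rfl fun k _ => Finset.sum_congr rfl fun l _ => ?_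
    rw [(hb k l).mul_mul_mul_comm]
  rw [h1, h2]
  simp only [mul_sub, Finset.sum_sub_distrib]
  abel

theorem CAR.numop_cr (h : CAR ψ ι) (i j k : Fin N) :
    ψ j * ι i * ψ k - ψ k * (ψ j * ι i) = if i = k then ψ j else 0 := by
  rw [mul_assoc, h.ac, mul_sub, ← mul_assoc, ← mul_assoc, h.cc j k]
  split_ifs <;> simp

theorem CAR.numop_an (h : CAR ψ ι) (i j k : Fin N) :
    ψ j * ι i * ι k - ι k * (ψ j * ι i) = - if j = k then ι i else 0 := by
  rw [mul_assoc, h.aa, ← mul_assoc (ι k), h.ac, sub_mul, mul_neg, mul_assoc]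
  simp only [eq_comm (a := k)]
  split_ifs <;> noncomm_ring

theorem CAR.commute_cr (h : CAR ψ ι) {e : A} {b : Fin N → A} {i j : Fin N}
    (he : ∀ k, Commute e (ψ k)) (hb : ∀ k l, Commute (b k) (ψ l)) (hb' : ∀ k l, Commute (b k) (ι l))
    (heb : ∀ k, e * b k - b k * e = if j = k then b i else 0) :
    Commute (e - ψ j * ι i) (∑ k, ψ k * b k) := by
  rw [commute_iff_lie_eq, Ring.lie_def, Finset.mul_sum, Finset.sum_mul, ← Finset.sum_sub_distrib]
  have : ∀ k, (e - ψ j * ι i) * (ψ k * b k) - ψ k * b k * (e - ψ j * ι i)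
      = (if j = k then ψ k * b i else 0) - (if i = k then ψ j * b k else 0) := by
    intro k
    have h1 := h.numop_cr i j k
    have h2 := heb k
    have e1 : e * (ψ k * b k) = ψ k * (e * b k) := by rw [← mul_assoc, (he k).eq, mul_assoc]
    have e2 : b k * (ψ j * ι i) = ψ j * ι i * b k := by
      rw [← mul_assoc, (hb k j).eq, mul_assoc, (hb' k i).eq, mul_assoc]
    have : (e - ψ j * ι i) * (ψ k * b k) - ψ k * b k * (e - ψ j * ι i)
        = ψ k * (e * b k - b k * e) - (ψ j * ι i * ψ k - ψ k * (ψ j * ι i)) * b k := by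
      rw [sub_mul, mul_sub, e1, mul_assoc (ψ k) (b k) (ψ j * ι i), e2]
      noncomm_ring
    rw [this, h1, h2]
    split_ifs <;> simp
  simp only [this, Finset.sum_sub_distrib]
  simp

theorem CAR.commute_an (h : CAR ψ ι) {e : A} {c : Fin N → A} {i j : Fin N}
    (he : ∀ k, Commute e (ι k)) (hb : ∀ k l, Commute (c k) (ψ l)) (hb' : ∀ k l, Commute (c k) (ι l))
    (heb : ∀ k, e * c k - c k * e = - if i = k then c j else 0) :
    Commute (e - ψ j * ι i) (∑ k, ι k * c k) := by
  rw [commute_iff_lie_eq, Ring.lie_def, Finset.mul_sum, Finset.sum_mul, ← Finset.sum_sub_distrib]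
  have : ∀ k, (e - ψ j * ι i) * (ι k * c k) - ι k * c k * (e - ψ j * ι i)
      = (if j = k then ι i * c k else 0) - (if i = k then ι k * c j else 0) := by
    intro k
    have h1 := h.numop_an i j k
    have h2 := heb k
    have e1 : e * (ι k * c k) = ι k * (e * c k) := by rw [← mul_assoc, (he k).eq, mul_assoc]
    have e2 : c k * (ψ j * ι i) = ψ j * ι i * c k := by
      rw [← mul_assoc, (hb k j).eq, mul_assoc, (hb' k i).eq, mul_assoc]
    have : (e - ψ j * ι i) * (ι k * c k) - ι k * c k * (e - ψ j * ι i)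
        = ι k * (e * c k - c k * e) - (ψ j * ι i * ι k - ι k * (ψ j * ι i)) * c k := by
      rw [sub_mul, mul_sub, e1, mul_assoc (ι k) (c k) (ψ j * ι i), e2]
      noncomm_ring
    rw [this, h1, h2]
    split_ifs <;> simp [sub_eq_add_neg, add_comm]
  simp only [this, Finset.sum_sub_distrib]
  simp

theorem CAR.numop_numop (h : CAR ψ ι) (i j k l : Fin N) :
    ψ j * ι i * (ψ l * ι k) - ψ l * ι k * (ψ j * ι i)
      = (if l = i then ψ j * ι k else 0) - if j = k then ψ l * ι i else 0 := by
  have h1 := h.numop_cr i j l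
  have h2 := h.numop_an i j k
  have : ψ j * ι i * (ψ l * ι k) - ψ l * ι k * (ψ j * ι i)
      = (ψ j * ι i * ψ l - ψ l * (ψ j * ι i)) * ι k + ψ l * (ψ j * ι i * ι k - ι k * (ψ j * ι i)) := by
    noncomm_ring
  rw [this, h1, h2]
  simp only [eq_comm (a := l)]
  split_ifs <;> simp [sub_eq_add_neg]

end CliffordAlgebra

/-- A unitary representation of the general linear Lie algebra on `N + 1` letters together with the
structure present on polynomials in the entries of a skew matrix. -/
structure PRep (N : ℕ) (M : Type) [AddCommGroup M] [Module ℚ M] where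
  ip : M →ₗ[ℚ] M →ₗ[ℚ] ℚ
  ip_comm : ∀ p q, ip p q = ip q p
  ip_pos : ∀ p, p ≠ 0 → 0 < ip p p
  E : Fin (N + 1) → Fin (N + 1) → Module.End ℚ M
  E_comm : ∀ A B C D, E A B * E C D - E C D * E A B
    = (if B = C then E A D else 0) - (if D = A then E C B else 0)
  adj : ∀ A B p q, ip (E A B p) q = ip p (E B A q)
  Fil : ℕ → Submodule ℚ M
  fil_mono : Monotone Fil
  fil_exists : ∀ p, ∃ D, p ∈ Fil D
  fil_fd : ∀ D, FiniteDimensional ℚ (Fil D)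
  fil_E : ∀ D A B p, p ∈ Fil D → E A B p ∈ Fil D
  B : Type
  co : B → M →ₗ[ℚ] ℚ
  co_ext : ∀ p, (∀ β, co β p = 0) → p = 0
  co_fin : ∀ p, {β | co β p ≠ 0}.Finite
  wt : B → Fin (N + 1) → ℚ
  co_E : ∀ β A p, co β (E A A p) = wt β A * co β p
  T : Fin N → Module.End ℚ M
  tm : Fin N → Module.End ℚ M
  T_comm : ∀ i j, T i * T j = T j * T i
  E_T_zero : ∀ k j : Fin N, E k.succ 0 * T j - T j * E k.succ 0 = 0
  sum_T_E : ∑ k : Fin N, T k * E k.succ 0 = 0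
  E_T_succ : ∀ i j k : Fin N, E i.succ j.succ * T k - T k * E i.succ j.succ = - if i = k then T j else 0
  E_zero_T : ∀ j, E 0 0 * T j - T j * E 0 0 = - T j
  E_zero_tm : ∀ j, E 0 0 * tm j - tm j * E 0 0 = tm j
  T_tm : ∀ j l, T j * tm l - tm l * T j = if j = l then 1 else 0
  sum_tm_T : ∑ j, tm j * T j = E 0 0
  tm_adj : ∀ j p q, ip (tm j p) q = ip p (T j q)
  pairing : ∀ (e : Equiv.Perm (Fin (N + 1))) (v : M) (lam : Fin (N + 1) → ℚ), v ≠ 0 →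
    (∀ p q, p < q → E (e p) (e q) v = 0) → (∀ p, E (e p) (e p) v = lam p • v) →
    ∀ p q : Fin (N + 1), Even p.val → q.val = p.val + 1 → lam p = lam q

namespace PRep

variable {N : ℕ} {M : Type} [AddCommGroup M] [Module ℚ M]

theorem car : CAR (fun j => (cr ℚ j : Module.End ℚ (Fock (Fin N) M))) (fun j => an ℚ j) :=
  ⟨cr_mul_cr, an_mul_an, an_mul_cr⟩

variable (ρ : PRep N M)

/-- The inner product on the Fock space. -/
def vip : Fock (Fin N) M →ₗ[ℚ] Fock (Fin N) M →ₗ[ℚ] ℚ :=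
  LinearMap.mk₂ ℚ (fun f g => ∑ I, ρ.ip (f I) (g I)) (by simp [Finset.sum_add_distrib])
    (by simp [Finset.mul_sum]) (by simp [Finset.sum_add_distrib]) (by simp [Finset.mul_sum])

theorem vip_apply (f g : Fock (Fin N) M) : ρ.vip f g = ∑ I, ρ.ip (f I) (g I) := rfl

theorem vip_comm (f g : Fock (Fin N) M) : ρ.vip f g = ρ.vip g f := by
  simp only [vip_apply, ρ.ip_comm (f _)]

theorem ip_nonneg (p : M) : 0 ≤ ρ.ip p p := by
  by_cases h : p = 0
  · simp [h]
  · exact (ρ.ip_pos p h).le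

theorem vip_nonneg (f : Fock (Fin N) M) : 0 ≤ ρ.vip f f :=
  Finset.sum_nonneg fun _ _ => ρ.ip_nonneg _

theorem ip_self_eq_zero {p : M} (h : ρ.ip p p = 0) : p = 0 := by
  by_contra h'
  exact (ρ.ip_pos p h').ne' h

theorem vip_self_eq_zero {f : Fock (Fin N) M} (h : ρ.vip f f = 0) : f = 0 := by
  have h' := (Finset.sum_eq_zero_iff_of_nonneg (s := Finset.univ)
    (f := fun I => ρ.ip (f I) (f I))
    fun I _ => ρ.ip_nonneg _).1 h
  exact Fock.ext fun I => ρ.ip_self_eq_zero (h' I (Finset.mem_univ I))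

theorem vip_cr (j : Fin N) (f g : Fock (Fin N) M) : ρ.vip (cr ℚ j f) g = ρ.vip f (an ℚ j g) :=
  sum_cr_eq_sum_an (LinearMap.toAddMonoidHom'.comp ρ.ip.toAddMonoidHom) j f g

theorem vip_an (j : Fin N) (f g : Fock (Fin N) M) : ρ.vip (an ℚ j f) g = ρ.vip f (cr ℚ j g) := by
  rw [vip_comm, ← vip_cr, vip_comm]

theorem vip_lft (A B : Fin (N + 1)) (f g : Fock (Fin N) M) :
    ρ.vip (lft (ρ.E A B) f) g = ρ.vip f (lft (ρ.E B A) g) := by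
  simp [vip_apply, ρ.adj]

/-- The part of the differential raising the exterior degree. -/
def d : Module.End ℚ (Fock (Fin N) M) := ∑ k : Fin N, cr ℚ k * lft (ρ.E k.succ 0)

/-- The adjoint of `d`. -/
def ds : Module.End ℚ (Fock (Fin N) M) := ∑ k : Fin N, an ℚ k * lft (ρ.E 0 k.succ)

/-- The part of the differential lowering the exterior degree. -/
def kap : Module.End ℚ (Fock (Fin N) M) := ∑ k : Fin N, an ℚ k * lft (ρ.T k)

/-- The adjoint of `kap`. -/
def kaps : Module.End ℚ (Fock (Fin N) M) := ∑ k : Fin N, cr ℚ k * lft (ρ.tm k)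

/-- The total differential. -/
def D : Module.End ℚ (Fock (Fin N) M) := ρ.d + ρ.kap

/-- The action of the general linear Lie algebra on `N` letters on the Fock space. -/
def EE (i j : Fin N) : Module.End ℚ (Fock (Fin N) M) :=
  lft (ρ.E i.succ j.succ) - cr ℚ j * an ℚ i

theorem vip_d (f g : Fock (Fin N) M) : ρ.vip (ρ.d f) g = ρ.vip f (ρ.ds g) := by
  simp only [d, ds, LinearMap.sum_apply, map_sum, Module.End.mul_apply]
  refine Finset.sum_congr rfl fun k _ => ?_
  rw [vip_cr, vip_lft, ← Module.End.mul_apply (lft _), (commute_lft_an _ _).eq,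
    Module.End.mul_apply]

theorem vip_EE (i j : Fin N) (f g : Fock (Fin N) M) :
    ρ.vip (ρ.EE i j f) g = ρ.vip f (ρ.EE j i g) := by
  simp only [EE, LinearMap.sub_apply, map_sub, Module.End.mul_apply, vip_lft, vip_cr, vip_an]

theorem commute_lft_of {P Q : Module.End ℚ M} (h : P * Q - Q * P = 0) :
    Commute (lft P : Module.End ℚ (Fock (Fin N) M)) (lft Q) := by
  rw [Commute, SemiconjBy, ← map_mul, ← map_mul, sub_eq_zero.1 h]

theorem d_mul_d : ρ.d * ρ.d = 0 := by
  refine sum_mul_self_eq_zero cr_mul_cr (fun i j => ?_) fun i j => (commute_lft_cr _ _).symm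
  refine (commute_lft_of (P := ρ.E i.succ 0) (Q := ρ.E j.succ 0) ?_).eq
  rw [ρ.E_comm, if_neg (Fin.succ_ne_zero j).symm, if_neg (Fin.succ_ne_zero i).symm, sub_zero]

theorem kap_mul_kap : ρ.kap * ρ.kap = 0 :=
  sum_mul_self_eq_zero an_mul_an
    (fun i j => (commute_lft_of (sub_eq_zero.2 (ρ.T_comm i j))).eq)
    fun _ _ => (commute_lft_an _ _).symm

theorem kap_d : ρ.kap * ρ.d + ρ.d * ρ.kap = 0 := by
  refine (car.anticomm_sum (fun i j => commute_lft_an _ _) fun i j => commute_lft_cr _ _).trans ?_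
  simp only [← map_mul, ← map_sub, ρ.E_T_zero, map_zero, mul_zero, Finset.sum_const_zero, add_zero,
    ← map_sum, ρ.sum_T_E]

theorem D_mul_D : ρ.D * ρ.D = 0 := by
  rw [D, add_mul, mul_add, mul_add, d_mul_d, kap_mul_kap, zero_add, add_zero, add_comm, kap_d]

theorem ds_d : ρ.ds * ρ.d + ρ.d * ρ.ds = ∑ k : Fin N, lft (ρ.E 0 k.succ) * lft (ρ.E k.succ 0)
    + ∑ k : Fin N, ∑ l : Fin N, cr ℚ k * an ℚ l *
      (lft (ρ.E k.succ l.succ) - if k = l then lft (ρ.E 0 0) else 0) := by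
  refine (car.anticomm_sum (fun i j => commute_lft_an _ _) fun i j => commute_lft_cr _ _).trans ?_
  congr 1
  refine Finset.sum_congr rfl fun k _ => Finset.sum_congr rfl fun l _ => ?_
  rw [← map_mul, ← map_mul, ← map_sub, ρ.E_comm]
  simp only [if_true, Fin.succ_inj, map_sub, eq_comm (a := l)]
  split_ifs <;> simp

theorem kap_kaps : ρ.kap * ρ.kaps + ρ.kaps * ρ.kap
    = lft (ρ.E 0 0) + (N : ℚ) • 1 - ∑ k : Fin N, cr ℚ k * an ℚ k := by
  refine (car.anticomm_sum (fun i j => commute_lft_an _ _) fun i j => commute_lft_cr _ _).trans ?_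
  have h1 : ∑ k, lft (ρ.T k) * lft (ρ.tm k) = (lft (ρ.E 0 0) + (N : ℚ) • 1 :
      Module.End ℚ (Fock (Fin N) M)) := by
    have h : ∀ k, ρ.T k * ρ.tm k = ρ.tm k * ρ.T k + 1 := by
      intro k
      have := ρ.T_tm k k
      rw [if_pos rfl] at this
      rw [← this]; abel
    simp only [← map_mul, h, ← map_sum]
    rw [Finset.sum_add_distrib, ρ.sum_tm_T]
    simp [Nat.cast_smul_eq_nsmul]
  rw [h1, sub_eq_add_neg, ← Finset.sum_neg_distrib]
  congr 1
  refine Finset.sum_congr rfl fun k _ => ?_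
  rw [Finset.sum_eq_single k]
  · rw [← map_mul, ← map_mul, ← map_sub, ← neg_sub, ρ.T_tm, if_pos rfl]
    simp
  · intro l _ h
    rw [← map_mul, ← map_mul, ← map_sub, ← neg_sub, ρ.T_tm, if_neg h]
    simp
  · simp

theorem EE_commute_d (i j : Fin N) : Commute (ρ.EE i j) ρ.d := by
  refine car.commute_cr (fun k => commute_lft_cr _ _) (fun k l => commute_lft_cr _ _)
    (fun k l => commute_lft_an _ _) fun k => ?_
  rw [← map_mul, ← map_mul, ← map_sub, ρ.E_comm]
  simp only [Fin.succ_inj, (Fin.succ_ne_zero i).symm, if_false, sub_zero]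
  split_ifs <;> simp

theorem EE_commute_ds (i j : Fin N) : Commute (ρ.EE i j) ρ.ds := by
  refine car.commute_an (fun k => commute_lft_an _ _) (fun k l => commute_lft_cr _ _)
    (fun k l => commute_lft_an _ _) fun k => ?_
  rw [← map_mul, ← map_mul, ← map_sub, ρ.E_comm]
  simp only [Fin.succ_inj, Fin.succ_ne_zero j, if_false, zero_sub, eq_comm (a := k)]
  split_ifs <;> simp

theorem EE_commute_kap (i j : Fin N) : Commute (ρ.EE i j) ρ.kap := by
  refine car.commute_an (fun k => commute_lft_an _ _) (fun k l => commute_lft_cr _ _)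
    (fun k l => commute_lft_an _ _) fun k => ?_
  rw [← map_mul, ← map_mul, ← map_sub, ρ.E_T_succ]
  split_ifs <;> simp

theorem EE_commute_D (i j : Fin N) : Commute (ρ.EE i j) ρ.D :=
  (ρ.EE_commute_d i j).add_right (ρ.EE_commute_kap i j)

theorem EE_EE (i j k l : Fin N) : ρ.EE i j * ρ.EE k l - ρ.EE k l * ρ.EE i j
    = (if j = k then ρ.EE i l else 0) - if l = i then ρ.EE k j else 0 := by
  have h1 := (car (N := N) (M := M)).numop_numop i j k l
  have h2 : (lft (ρ.E i.succ j.succ) * lft (ρ.E k.succ l.succ)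
      - lft (ρ.E k.succ l.succ) * lft (ρ.E i.succ j.succ) : Module.End ℚ (Fock (Fin N) M))
      = (if j = k then lft (ρ.E i.succ l.succ) else 0)
        - if l = i then lft (ρ.E k.succ j.succ) else 0 := by
    rw [← map_mul, ← map_mul, ← map_sub, ρ.E_comm]
    simp only [Fin.succ_inj, map_sub]
    split_ifs <;> simp
  have hc : ∀ i j k l : Fin N, Commute (lft (ρ.E i.succ j.succ) : Module.End ℚ (Fock (Fin N) M))
      (cr ℚ k * an ℚ l) := fun i j k l => (commute_lft_cr _ _).mul_right (commute_lft_an _ _)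
  have e : ρ.EE i j * ρ.EE k l - ρ.EE k l * ρ.EE i j
      = (lft (ρ.E i.succ j.succ) * lft (ρ.E k.succ l.succ)
      - lft (ρ.E k.succ l.succ) * lft (ρ.E i.succ j.succ))
      + (cr ℚ j * an ℚ i * (cr ℚ l * an ℚ k) - cr ℚ l * an ℚ k * (cr ℚ j * an ℚ i)) := by
    rw [EE, EE, sub_mul, mul_sub, mul_sub, sub_mul, mul_sub, mul_sub, (hc i j l k).eq,
      (hc k l j i).eq]
    abel
  rw [e, h1, h2]
  simp only [EE]
  split_ifs <;> abel

theorem EE_commute_E_zero (i j : Fin N) : Commute (ρ.EE i j) (lft (ρ.E 0 0)) := by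
  refine Commute.sub_left (commute_lft_of ?_)
    (Commute.mul_left (commute_lft_cr _ _).symm (commute_lft_an _ _).symm)
  rw [ρ.E_comm]
  simp [(Fin.succ_ne_zero i).symm]

end PRep

section Support

variable {N : ℕ} {M : Type*} [AddCommGroup M] [Module ℚ M] {P Q : ℕ → Prop}

/-- `f` is supported in exterior degrees satisfying `P`. -/
def Sup (P : ℕ → Prop) (f : Fock (Fin N) M) : Prop := ∀ I, f I ≠ 0 → P I.card

theorem Sup.mono {f : Fock (Fin N) M} (hf : Sup P f) (h : ∀ a, P a → Q a) : Sup Q f :=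
  fun I hI => h _ (hf I hI)

theorem Sup.apply_eq_zero {f : Fock (Fin N) M} (hf : Sup P f) {I} (h : ¬ P I.card) : f I = 0 := by
  by_contra h'
  exact h (hf I h')

theorem Sup.zero : Sup P (0 : Fock (Fin N) M) := fun _ h => absurd rfl h

theorem Sup.add {f g : Fock (Fin N) M} (hf : Sup P f) (hg : Sup P g) : Sup P (f + g) := by
  intro I h
  by_cases h1 : f I = 0
  · refine hg I fun h2 => h ?_
    simp [h1, h2]
  · exact hf I h1

theorem Sup.smul {f : Fock (Fin N) M} (r : ℚ) (hf : Sup P f) : Sup P (r • f) := by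
  intro I h
  refine hf I fun h2 => h ?_
  simp [h2]

theorem Sup.sub {f g : Fock (Fin N) M} (hf : Sup P f) (hg : Sup P g) : Sup P (f - g) := by
  simpa [sub_eq_add_neg] using hf.add (hg.smul (-1))

theorem Sup.sum {α : Type*} {s : Finset α} {f : α → Fock (Fin N) M}
    (h : ∀ a ∈ s, Sup P (f a)) : Sup P (∑ a ∈ s, f a) := by
  classical
  induction s using Finset.induction_on with
  | empty => exact Sup.zero
  | insert a s ha ih =>
    rw [Finset.sum_insert ha]
    exact (h a (by simp)).add (ih fun c hc => h c (by simp [hc]))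

theorem Sup.lft {f : Fock (Fin N) M} (hf : Sup P f) (A : Module.End ℚ M) :
    Sup P (PfaffExt.lft A f) := fun I h => hf I fun h' => h (by simp [h'])

theorem Sup.cr {f : Fock (Fin N) M} (hf : Sup P f) (h : ∀ a, P a → Q (a + 1)) (j : Fin N) :
    Sup Q (cr ℚ j f) := by
  intro I hI
  by_cases hj : j ∈ I
  · rw [← Finset.card_erase_add_one hj]
    exact h _ (hf _ fun h' => hI (by simp [cr_apply, h']))
  · simp [cr_apply, hj] at hI

theorem Sup.an {f : Fock (Fin N) M} (hf : Sup P f) (h : ∀ a, P (a + 1) → Q a) (j : Fin N) :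
    Sup Q (an ℚ j f) := by
  intro I hI
  by_cases hj : j ∈ I
  · simp [an_apply, hj] at hI
  · refine h _ ?_
    rw [← Finset.card_insert_of_notMem hj]
    exact (hf _ fun h' => hI (by simp [an_apply, h']))

end Support

namespace PRep

variable {N : ℕ} {M : Type} [AddCommGroup M] [Module ℚ M] (ρ : PRep N M) {P Q : ℕ → Prop}

theorem sup_d {f : Fock (Fin N) M} (hf : Sup P f) (h : ∀ a, P a → Q (a + 1)) :
    Sup Q (ρ.d f) := by
  rw [d, LinearMap.sum_apply]
  exact Sup.sum fun k _ => (hf.lft _).cr h k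

theorem sup_kaps {f : Fock (Fin N) M} (hf : Sup P f) (h : ∀ a, P a → Q (a + 1)) :
    Sup Q (ρ.kaps f) := by
  rw [kaps, LinearMap.sum_apply]
  exact Sup.sum fun k _ => (hf.lft _).cr h k

theorem sup_ds {f : Fock (Fin N) M} (hf : Sup P f) (h : ∀ a, P (a + 1) → Q a) :
    Sup Q (ρ.ds f) := by
  rw [ds, LinearMap.sum_apply]
  exact Sup.sum fun k _ => (hf.lft _).an h k

theorem sup_kap {f : Fock (Fin N) M} (hf : Sup P f) (h : ∀ a, P (a + 1) → Q a) :
    Sup Q (ρ.kap f) := by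
  rw [kap, LinearMap.sum_apply]
  exact Sup.sum fun k _ => (hf.lft _).an h k

theorem sup_EE {f : Fock (Fin N) M} (hf : Sup P f) (i j : Fin N) : Sup P (ρ.EE i j f) :=
  (hf.lft _).sub ((hf.an (Q := fun a => P (a + 1)) (fun _ h => h) i).cr (fun _ h => h) j)

/-- Highest weight vectors of weight `μ` and degree `b` supported in exterior degrees `P`. -/
def W (P : ℕ → Prop) (b : ℚ) (μ : Fin N → ℚ) : Submodule ℚ (Fock (Fin N) M) where
  carrier := {f | (∀ i j, i < j → ρ.EE i j f = 0) ∧ (∀ i, ρ.EE i i f = μ i • f) ∧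
    lft (ρ.E 0 0) f = b • f ∧ Sup P f}
  add_mem' := fun ⟨h1, h2, h3, h4⟩ ⟨h1', h2', h3', h4'⟩ =>
    ⟨fun i j h => by rw [map_add, h1 i j h, h1' i j h, add_zero],
      fun i => by rw [map_add, h2, h2', smul_add], by rw [map_add, h3, h3', smul_add], h4.add h4'⟩
  zero_mem' := ⟨fun _ _ _ => map_zero _, fun _ => by simp, by simp, Sup.zero⟩
  smul_mem' := fun r f ⟨h1, h2, h3, h4⟩ =>
    ⟨fun i j h => by rw [map_smul, h1 i j h, smul_zero],
      fun i => by rw [map_smul, h2, smul_comm], by rw [map_smul, h3, smul_comm], h4.smul r⟩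

variable {b : ℚ} {μ : Fin N → ℚ}

theorem E_zero_d (f : Fock (Fin N) M) :
    lft (ρ.E 0 0) (ρ.d f) = ρ.d (lft (ρ.E 0 0) f) - ρ.d f := by
  simp only [d, LinearMap.sum_apply, map_sum, Module.End.mul_apply, ← Finset.sum_sub_distrib]
  refine Finset.sum_congr rfl fun k _ => ?_
  rw [← Module.End.mul_apply (lft _) (cr _ _), (commute_lft_cr _ _).eq, Module.End.mul_apply,
    ← map_sub]
  congr 1
  have h := ρ.E_comm 0 0 k.succ 0
  rw [if_neg (Fin.succ_ne_zero k).symm, if_pos rfl, zero_sub] at h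
  refine Fock.ext fun I => ?_
  have h' := LinearMap.congr_fun h (f I)
  simp only [LinearMap.sub_apply, Module.End.mul_apply, LinearMap.neg_apply] at h'
  simp only [lft_apply, Fock.sub_apply]
  rw [sub_eq_iff_eq_add.1 h']; abel

theorem E_zero_ds (f : Fock (Fin N) M) :
    lft (ρ.E 0 0) (ρ.ds f) = ρ.ds (lft (ρ.E 0 0) f) + ρ.ds f := by
  simp only [ds, LinearMap.sum_apply, map_sum, Module.End.mul_apply, ← Finset.sum_add_distrib]
  refine Finset.sum_congr rfl fun k _ => ?_
  rw [← Module.End.mul_apply (lft _) (an _ _), (commute_lft_an _ _).eq, Module.End.mul_apply,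
    ← map_add]
  congr 1
  have h := ρ.E_comm 0 0 0 k.succ
  rw [if_neg (Fin.succ_ne_zero k), if_pos rfl, sub_zero] at h
  refine Fock.ext fun I => ?_
  have h' := LinearMap.congr_fun h (f I)
  simp only [LinearMap.sub_apply, Module.End.mul_apply] at h'
  simp only [lft_apply, Fock.add_apply]
  rw [sub_eq_iff_eq_add.1 h']; abel

theorem E_zero_kap (f : Fock (Fin N) M) :
    lft (ρ.E 0 0) (ρ.kap f) = ρ.kap (lft (ρ.E 0 0) f) - ρ.kap f := by
  simp only [kap, LinearMap.sum_apply, map_sum, Module.End.mul_apply, ← Finset.sum_sub_distrib]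
  refine Finset.sum_congr rfl fun k _ => ?_
  rw [← Module.End.mul_apply (lft _) (an _ _), (commute_lft_an _ _).eq, Module.End.mul_apply,
    ← map_sub]
  congr 1
  refine Fock.ext fun I => ?_
  have h' := LinearMap.congr_fun (ρ.E_zero_T k) (f I)
  simp only [LinearMap.sub_apply, Module.End.mul_apply, LinearMap.neg_apply] at h'
  simp only [lft_apply, Fock.sub_apply]
  rw [sub_eq_iff_eq_add.1 h']; abel

theorem E_zero_kaps (f : Fock (Fin N) M) :
    lft (ρ.E 0 0) (ρ.kaps f) = ρ.kaps (lft (ρ.E 0 0) f) + ρ.kaps f := by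
  simp only [kaps, LinearMap.sum_apply, map_sum, Module.End.mul_apply, ← Finset.sum_add_distrib]
  refine Finset.sum_congr rfl fun k _ => ?_
  rw [← Module.End.mul_apply (lft _) (cr _ _), (commute_lft_cr _ _).eq, Module.End.mul_apply,
    ← map_add]
  congr 1
  refine Fock.ext fun I => ?_
  have h' := LinearMap.congr_fun (ρ.E_zero_tm k) (f I)
  simp only [LinearMap.sub_apply, Module.End.mul_apply] at h'
  simp only [lft_apply, Fock.add_apply]
  rw [sub_eq_iff_eq_add.1 h']; abel

theorem W_of_commute {A : Module.End ℚ (Fock (Fin N) M)} (hA : ∀ i j, Commute (ρ.EE i j) A)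
    {f : Fock (Fin N) M} (hf : f ∈ ρ.W P b μ) {c : ℚ}
    (hc : lft (ρ.E 0 0) (A f) = c • A f) (hs : Sup Q (A f)) : A f ∈ ρ.W Q c μ := by
  obtain ⟨h1, h2, h3, h4⟩ := hf
  have h : ∀ i j, ρ.EE i j (A f) = A (ρ.EE i j f) := fun i j => by
    rw [← Module.End.mul_apply, (hA i j).eq, Module.End.mul_apply]
  exact ⟨fun i j hij => by rw [h, h1 i j hij, map_zero], fun i => by rw [h, h2, map_smul], hc, hs⟩

theorem d_mem_W {f : Fock (Fin N) M} (hf : f ∈ ρ.W P b μ) (h : ∀ a, P a → Q (a + 1)) :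
    ρ.d f ∈ ρ.W Q (b - 1) μ := by
  refine ρ.W_of_commute ρ.EE_commute_d hf ?_ (ρ.sup_d hf.2.2.2 h)
  rw [E_zero_d, hf.2.2.1, map_smul, sub_smul, one_smul]

theorem kap_mem_W {f : Fock (Fin N) M} (hf : f ∈ ρ.W P b μ) (h : ∀ a, P (a + 1) → Q a) :
    ρ.kap f ∈ ρ.W Q (b - 1) μ := by
  refine ρ.W_of_commute ρ.EE_commute_kap hf ?_ (ρ.sup_kap hf.2.2.2 h)
  rw [E_zero_kap, hf.2.2.1, map_smul, sub_smul, one_smul]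

theorem ds_mem_W {f : Fock (Fin N) M} (hf : f ∈ ρ.W P b μ) (h : ∀ a, P (a + 1) → Q a) :
    ρ.ds f ∈ ρ.W Q (b + 1) μ := by
  refine ρ.W_of_commute ρ.EE_commute_ds hf ?_ (ρ.sup_ds hf.2.2.2 h)
  rw [E_zero_ds, hf.2.2.1, map_smul, add_smul, one_smul]

end PRep

namespace PRep

variable {N : ℕ} {M : Type} [AddCommGroup M] [Module ℚ M] (ρ : PRep N M) {P Q : ℕ → Prop}
  {b : ℚ} {μ : Fin N → ℚ}

theorem vip_of_diag {f g : Fock (Fin N) M} (c : Finset (Fin N) → ℚ) (h : ∀ I, g I = c I • f I) :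
    ρ.vip g f = ∑ I, c I * ρ.ip (f I) (f I) := by
  rw [vip_apply]
  refine Finset.sum_congr rfl fun I _ => ?_
  rw [h, map_smul, LinearMap.smul_apply, smul_eq_mul]

theorem antitone_of_mem_W {f : Fock (Fin N) M} (hf : f ∈ ρ.W P b μ) (h0 : f ≠ 0) : Antitone μ := by
  refine antitone_iff_forall_lt.2 fun i j hij => ?_
  obtain ⟨h1, h2, -, -⟩ := hf
  have hpos : 0 < ρ.vip f f :=
    lt_of_le_of_ne (ρ.vip_nonneg f) fun h => h0 (ρ.vip_self_eq_zero h.symm)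
  have h := LinearMap.congr_fun (ρ.EE_EE i j j i) f
  simp only [if_true, LinearMap.sub_apply, Module.End.mul_apply, h1 i j hij, map_zero, sub_zero,
    h2] at h
  have h3 : ρ.vip (ρ.EE j i f) (ρ.EE j i f) = (μ i - μ j) * ρ.vip f f := by
    rw [← vip_EE, h, ← sub_smul, map_smul, LinearMap.smul_apply, smul_eq_mul]
  have h4 := ρ.vip_nonneg (ρ.EE j i f)
  rw [h3] at h4
  have := nonneg_of_mul_nonneg_left h4 hpos
  linarith

theorem lft_E_succ {f : Fock (Fin N) M} (i j : Fin N) :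
    lft (ρ.E i.succ j.succ) f = ρ.EE i j f + cr ℚ j (an ℚ i f) := by
  rw [EE, LinearMap.sub_apply, Module.End.mul_apply, sub_add_cancel]

theorem lft_E_diag {f : Fock (Fin N) M} (hf : f ∈ ρ.W P b μ) (k : Fin N) (I : Finset (Fin N)) :
    ρ.E k.succ k.succ (f I) = (μ k + if k ∈ I then 1 else 0 : ℚ) • f I := by
  have h := congrArg (fun g : Fock (Fin N) M => g I) (ρ.lft_E_succ (f := f) k k)
  simp only [lft_apply, Fock.add_apply, hf.2.1 k, Fock.smul_apply, cr_mul_an_apply_self] at h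
  rw [h, add_smul]
  split_ifs <;> simp

theorem vip_E_comm {f : Fock (Fin N) M} (hf : f ∈ ρ.W P b μ) (k : Fin N) :
    ρ.vip (lft (ρ.E k.succ 0) f) (lft (ρ.E k.succ 0) f)
      = ρ.vip (lft (ρ.E 0 k.succ) f) (lft (ρ.E 0 k.succ) f)
        + ∑ I, (b - μ k - if k ∈ I then 1 else 0) * ρ.ip (f I) (f I) := by
  rw [← ρ.vip_lft 0 k.succ, ← ρ.vip_lft k.succ 0 (lft _ f), ← sub_eq_iff_eq_add',
    ← LinearMap.sub_apply, ← map_sub]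
  refine ρ.vip_of_diag _ fun I => ?_
  have h := LinearMap.congr_fun (ρ.E_comm 0 k.succ k.succ 0) (f I)
  simp only [if_true, LinearMap.sub_apply, Module.End.mul_apply] at h
  simp only [Fock.sub_apply, lft_apply]
  rw [h, ρ.lft_E_diag hf, ← lft_apply, hf.2.2.1, Fock.smul_apply, ← sub_smul, sub_sub]

theorem vip_off_diag {f : Fock (Fin N) M} (hf : f ∈ ρ.W P b μ) {k l : Fin N} (h : k ≠ l) :
    0 ≤ ρ.vip (cr ℚ k (an ℚ l (lft (ρ.E k.succ l.succ) f))) f := by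
  rcases lt_or_gt_of_ne h with h | h
  · rw [vip_cr, vip_an, lft_E_succ, hf.1 k l h, zero_add]
    exact ρ.vip_nonneg _
  · rw [← Module.End.mul_apply (an ℚ l), ← (commute_lft_an _ _).eq, Module.End.mul_apply,
      ← Module.End.mul_apply (cr ℚ k), ← (commute_lft_cr _ _).eq, Module.End.mul_apply, vip_lft,
      lft_E_succ, hf.1 l k h, zero_add]
    exact ρ.vip_nonneg _

theorem vip_diag {f : Fock (Fin N) M} (hf : f ∈ ρ.W P b μ) (k : Fin N) :
    ρ.vip (cr ℚ k (an ℚ k (lft (ρ.E k.succ k.succ) f - b • f))) f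
      = ∑ I, (if k ∈ I then μ k + 1 - b else 0) * ρ.ip (f I) (f I) := by
  refine ρ.vip_of_diag _ fun I => ?_
  rw [cr_mul_an_apply_self]
  simp only [Fock.sub_apply, lft_apply, ρ.lft_E_diag hf, Fock.smul_apply, ← sub_smul]
  split_ifs <;> simp

/-- The vanishing of the Laplacian on a harmonic highest weight vector. -/
theorem laplacian_eq_zero {f : Fock (Fin N) M} (hf : f ∈ ρ.W P b μ)
    (hd : ρ.d f = 0) (hds : ρ.ds f = 0) (L : Finset (Fin N)) :
    ∑ k : Fin N, (if k ∈ L then ρ.vip (lft (ρ.E 0 k.succ) f) (lft (ρ.E 0 k.succ) f)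
        else ρ.vip (lft (ρ.E k.succ 0) f) (lft (ρ.E k.succ 0) f))
      + ∑ k : Fin N, ∑ l : Fin N,
        (if k = l then 0 else ρ.vip (cr ℚ k (an ℚ l (lft (ρ.E k.succ l.succ) f))) f)
      + ∑ I : Finset (Fin N), (∑ k : Fin N, ((if k ∈ I then μ k + 1 - b else 0)
        + if k ∈ L then b - μ k - (if k ∈ I then 1 else 0) else 0)) * ρ.ip (f I) (f I) = 0 := by
  have h := congrArg (fun g => ρ.vip g f) (LinearMap.congr_fun ρ.ds_d f)
  simp only [LinearMap.add_apply, Module.End.mul_apply, hd, hds, map_zero, LinearMap.zero_apply,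
    add_zero, LinearMap.sum_apply, map_add, map_sum] at h
  have hA : ∀ k : Fin N, ρ.vip (lft (ρ.E 0 k.succ) (lft (ρ.E k.succ 0) f)) f
      = (if k ∈ L then ρ.vip (lft (ρ.E 0 k.succ) f) (lft (ρ.E 0 k.succ) f)
        else ρ.vip (lft (ρ.E k.succ 0) f) (lft (ρ.E k.succ 0) f))
        + ∑ I, (if k ∈ L then b - μ k - (if k ∈ I then 1 else 0) else 0) * ρ.ip (f I) (f I) := by
    intro k
    rw [vip_lft]
    split_ifs
    · exact ρ.vip_E_comm hf k
    · simp
  have hB : ∀ k : Fin N, ∑ l : Fin N, ρ.vip (cr ℚ k (an ℚ l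
        ((lft (ρ.E k.succ l.succ) - if k = l then lft (ρ.E 0 0) else 0 :
          Module.End ℚ (Fock (Fin N) M)) f))) f
      = ∑ l : Fin N, (if k = l then 0 else
          ρ.vip (cr ℚ k (an ℚ l (lft (ρ.E k.succ l.succ) f))) f)
        + ∑ I, (if k ∈ I then μ k + 1 - b else 0) * ρ.ip (f I) (f I) := by
    intro k
    rw [← ρ.vip_diag hf k, ← Finset.sum_erase_add Finset.univ _ (Finset.mem_univ k),
      ← Finset.sum_erase_add Finset.univ (fun l => if k = l then (0 : ℚ) else _)
        (Finset.mem_univ k), if_pos rfl, if_pos rfl, LinearMap.sub_apply, hf.2.2.1, add_zero]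
    congr 1
    refine Finset.sum_congr rfl fun l hl => ?_
    have : k ≠ l := (Finset.ne_of_mem_erase hl).symm
    rw [if_neg this, if_neg this, sub_zero]
  have hC : ∀ F : Fin N → Finset (Fin N) → ℚ, ∑ k, ∑ I, F k I = ∑ I, ∑ k, F k I :=
    fun F => Finset.sum_comm
  rw [Finset.sum_congr rfl fun k _ => hA k, Finset.sum_congr rfl fun k _ => hB k,
    Finset.sum_add_distrib, Finset.sum_add_distrib, hC, hC] at h
  refine Eq.trans ?_ h.symm
  simp only [Finset.sum_mul, add_mul, Finset.sum_add_distrib]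
  abel

theorem exists_threshold (hμ : Antitone μ) (i0 : Fin (N + 1)) :
    ∃ θ : ℚ, (∀ k : Fin N, i0 ≤ k.castSucc → μ k ≤ θ) ∧
      ∀ k : Fin N, ¬ i0 ≤ k.castSucc → θ ≤ μ k := by
  by_cases h : i0.val < N
  · refine ⟨μ ⟨i0.val, h⟩, fun k hk => hμ ?_, fun k hk => hμ ?_⟩
    · exact hk
    · exact (not_le.1 hk).le
  · obtain ⟨θ, hθ⟩ := (Set.finite_range μ).bddBelow
    refine ⟨θ, fun k hk => absurd (lt_of_le_of_lt (Fin.le_def.1 hk) k.2) h,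
      fun k _ => hθ ⟨k, rfl⟩⟩

/-- The index set of the last letters, those placed after the letter inserted at `i0`. -/
def lastSet (i0 : Fin (N + 1)) : Finset (Fin N) := Finset.univ.filter fun k => i0 ≤ k.castSucc

theorem mem_lastSet {i0 : Fin (N + 1)} {k : Fin N} : k ∈ lastSet i0 ↔ i0 ≤ k.castSucc := by
  simp [lastSet]

theorem card_lastSet (i0 : Fin (N + 1)) : (lastSet i0).card = N - i0.val := by
  have h : (lastSet i0).map Fin.castSuccEmb = (Finset.Ici i0).erase (Fin.last N) := by
    ext k
    simp only [Finset.mem_map, mem_lastSet, Finset.mem_erase, Finset.mem_Ici, Fin.coe_castSuccEmb]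
    constructor
    · rintro ⟨a, h, rfl⟩
      exact ⟨(Fin.castSucc_lt_last a).ne, h⟩
    · rintro ⟨h1, h2⟩
      obtain ⟨a, rfl⟩ := Fin.exists_castSucc_eq.2 h1
      exact ⟨a, h2, rfl⟩
  rw [← Finset.card_map Fin.castSuccEmb, h, Finset.card_erase_of_mem (by simp [Fin.le_last]),
    Fin.card_Ici]
  omega

theorem coeff_nonneg {i0 : Fin (N + 1)} {θ : ℚ} (h1 : ∀ k : Fin N, i0 ≤ k.castSucc → μ k ≤ θ)
    (h2 : ∀ k : Fin N, ¬ i0 ≤ k.castSucc → θ ≤ μ k) {I : Finset (Fin N)}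
    (hI : I.card = (lastSet i0).card) :
    ((I \ lastSet i0).card : ℚ) ≤ ∑ k : Fin N, ((if k ∈ I then μ k + 1 - b else 0)
        + if k ∈ lastSet i0 then b - μ k - (if k ∈ I then 1 else 0) else 0) := by
  have e : ∑ k : Fin N, (θ - b) * ((if k ∈ I then 1 else 0) - if k ∈ lastSet i0 then 1 else 0)
      = 0 := by
    rw [← Finset.mul_sum, Finset.sum_sub_distrib]
    simp [hI]
  have e' : ((I \ lastSet i0).card : ℚ)
      = ∑ k : Fin N, if k ∈ I ∧ k ∉ lastSet i0 then (1 : ℚ) else 0 := by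
    rw [← Finset.sum_filter, Finset.sum_const, nsmul_one]
    congr 2
    ext k
    simp
  rw [← add_zero (Finset.card _ : ℚ), ← e, e', ← Finset.sum_add_distrib]
  refine Finset.sum_le_sum fun k _ => ?_
  have h1' := h1 k
  have h2' := h2 k
  rw [← mem_lastSet] at h1' h2'
  by_cases hk : k ∈ I <;> by_cases hl : k ∈ lastSet i0 <;> simp only [hk, hl, not_true_eq_false,
    not_false_eq_true, and_true, and_false, if_true, if_false, true_implies] at h1' h2' ⊢
    <;> linarith

/-- The weight obtained from `μ` by inserting `b` at position `i0` and raising the later entries. -/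
def insWeight (i0 : Fin (N + 1)) (b : ℚ) (μ : Fin N → ℚ) : Fin (N + 1) → ℚ :=
  i0.insertNth (α := fun _ => ℚ) b fun k => μ k + if i0 ≤ k.castSucc then 1 else 0

theorem insWeight_self (i0 : Fin (N + 1)) : insWeight i0 b μ i0 = b := by
  rw [insWeight, Fin.insertNth_apply_same]

theorem insWeight_succAbove (i0 : Fin (N + 1)) (k : Fin N) :
    insWeight i0 b μ (i0.succAbove k) = μ k + if i0 ≤ k.castSucc then 1 else 0 := by
  rw [insWeight, Fin.insertNth_apply_succAbove]

theorem insWeight_castSucc {i0 : Fin (N + 1)} {k : Fin N} (h : k.castSucc < i0) :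
    insWeight i0 b μ k.castSucc = μ k := by
  have := insWeight_succAbove (b := b) (μ := μ) i0 k
  rwa [Fin.succAbove_of_castSucc_lt _ _ h, if_neg (not_le.2 h), add_zero] at this

theorem insWeight_succ {i0 : Fin (N + 1)} {k : Fin N} (h : i0 ≤ k.castSucc) :
    insWeight i0 b μ k.succ = μ k + 1 := by
  have := insWeight_succAbove (b := b) (μ := μ) i0 k
  rwa [Fin.succAbove_of_le_castSucc _ _ h, if_pos h] at this

/-- The weight obtained by inserting `b` at position `i0` has equal entries in paired positions. -/
def Paired (i0 : Fin (N + 1)) (b : ℚ) (μ : Fin N → ℚ) : Prop :=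
  ∀ p q : Fin (N + 1), Even p.val → q.val = p.val + 1 →
    insWeight i0 b μ p = insWeight i0 b μ q

theorem harmonic_support {f : Fock (Fin N) M} {i0 : Fin (N + 1)}
    (hf : f ∈ ρ.W (fun a => a + i0.val = N) b μ) (h0 : f ≠ 0)
    (hd : ρ.d f = 0) (hds : ρ.ds f = 0) :
    (∀ I, I ≠ lastSet i0 → f I = 0) ∧ (∀ k ∈ lastSet i0, lft (ρ.E 0 k.succ) f = 0) ∧
      ∀ k, k ∉ lastSet i0 → lft (ρ.E k.succ 0) f = 0 := by
  obtain ⟨θ, h1, h2⟩ := exists_threshold (ρ.antitone_of_mem_W hf h0) i0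
  have h := ρ.laplacian_eq_zero hf hd hds (lastSet i0)
  have hA : ∀ k : Fin N, 0 ≤ (if k ∈ lastSet i0 then
      ρ.vip (lft (ρ.E 0 k.succ) f) (lft (ρ.E 0 k.succ) f)
        else ρ.vip (lft (ρ.E k.succ 0) f) (lft (ρ.E k.succ 0) f)) := by
    intro k
    split_ifs <;> exact ρ.vip_nonneg _
  have hB : ∀ k : Fin N, ∀ l : Fin N, 0 ≤
        (if k = l then 0 else ρ.vip (cr ℚ k (an ℚ l (lft (ρ.E k.succ l.succ) f))) f) := by
    intro k l
    split_ifs with hkl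
    · exact le_rfl
    · exact ρ.vip_off_diag hf hkl
  have hc : ∀ I : Finset (Fin N), f I ≠ 0 → ((I \ lastSet i0).card : ℚ) ≤
      ∑ k : Fin N, ((if k ∈ I then μ k + 1 - b else 0)
        + if k ∈ lastSet i0 then b - μ k - (if k ∈ I then 1 else 0) else 0) := by
    intro I hI
    refine coeff_nonneg h1 h2 ?_
    have := hf.2.2.2 I hI
    rw [card_lastSet]; omega
  have hC : ∀ I : Finset (Fin N), 0 ≤ (∑ k : Fin N, ((if k ∈ I then μ k + 1 - b else 0)
        + if k ∈ lastSet i0 then b - μ k - (if k ∈ I then 1 else 0) else 0)) * ρ.ip (f I) (f I) := by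
    intro I
    by_cases hI : f I = 0
    · simp [hI]
    · exact mul_nonneg ((Nat.cast_nonneg _).trans (hc I hI)) (ρ.ip_nonneg _)
  have hA' := Finset.sum_nonneg (s := Finset.univ) fun k _ => hA k
  have hB' := Finset.sum_nonneg (s := Finset.univ) fun k _ =>
    Finset.sum_nonneg (s := Finset.univ) fun l _ => hB k l
  have hC' := Finset.sum_nonneg (s := Finset.univ) fun k _ => hC k
  have eA := (Finset.sum_eq_zero_iff_of_nonneg fun k _ => hA k).1
    (le_antisymm (by linarith) hA')
  have eC := (Finset.sum_eq_zero_iff_of_nonneg fun k _ => hC k).1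
    (le_antisymm (by linarith) hC')
  refine ⟨fun I hI => ?_, fun k hk => ?_, fun k hk => ?_⟩
  · by_contra hI0
    have h3 : (I \ lastSet i0).card ≠ 0 := by
      intro h3
      refine hI (Finset.eq_of_subset_of_card_le
        (Finset.sdiff_eq_empty_iff_subset.1 (Finset.card_eq_zero.1 h3)) ?_)
      have := hf.2.2.2 I hI0
      rw [card_lastSet]; omega
    have h4 : (0 : ℚ) < (I \ lastSet i0).card := by positivity
    exact (mul_pos (h4.trans_le (hc I hI0)) (ρ.ip_pos _ hI0)).ne' (eC I (Finset.mem_univ I))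
  · have := eA k (Finset.mem_univ k)
    rw [if_pos hk] at this
    exact ρ.vip_self_eq_zero this
  · have := eA k (Finset.mem_univ k)
    rw [if_neg hk] at this
    exact ρ.vip_self_eq_zero this

theorem paired_of_harmonic {f : Fock (Fin N) M} {i0 : Fin (N + 1)}
    (hf : f ∈ ρ.W (fun a => a + i0.val = N) b μ) (h0 : f ≠ 0)
    (hd : ρ.d f = 0) (hds : ρ.ds f = 0) : Paired i0 b μ := by
  obtain ⟨h1, h2, h3⟩ := ρ.harmonic_support hf h0 hd hds
  have hv : f (lastSet i0) ≠ 0 := by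
    intro h
    refine h0 (Fock.ext fun I => ?_)
    by_cases hI : I = lastSet i0
    · rw [hI, h]; rfl
    · rw [h1 I hI]; rfl
  have e0 : i0.cycleRange i0 = 0 := by simp
  have es : ∀ k, i0.cycleRange (i0.succAbove k) = k.succ := by simp
  refine ρ.pairing i0.cycleRange (f (lastSet i0)) _ hv ?_ ?_
  · intro p q hpq
    rcases Fin.eq_self_or_eq_succAbove i0 p with hp | ⟨k, rfl⟩ <;>
      rcases Fin.eq_self_or_eq_succAbove i0 q with h | ⟨l, rfl⟩
    · exact absurd (hp.trans h.symm) hpq.ne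
    · rw [hp] at hpq ⊢
      rw [e0, es, ← lft_apply, h2]
      · rfl
      · rw [mem_lastSet]
        exact (Fin.lt_succAbove_iff_le_castSucc _ _).1 hpq
    · rw [h] at hpq ⊢
      rw [e0, es, ← lft_apply, h3]
      · rfl
      · rw [mem_lastSet, not_le]
        exact (Fin.succAbove_lt_iff_castSucc_lt _ _).1 hpq
    · rw [es, es]
      have hkl := Fin.succAbove_lt_succAbove_iff.1 hpq
      rw [← lft_apply, lft_E_succ, hf.1 k l hkl, zero_add, cr_apply]
      split_ifs with hl
      · rw [an_apply]
        split_ifs with hk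
        · rw [smul_zero]
        · rw [h1, smul_zero, smul_zero]
          intro he
          have h4 := Finset.ext_iff.1 he l
          simp [hkl.ne', hl] at h4
      · rfl
  · intro p
    rcases Fin.eq_self_or_eq_succAbove i0 p with rfl | ⟨k, rfl⟩
    · rw [e0, ← lft_apply, hf.2.2.1, insWeight_self]; rfl
    · rw [es, insWeight_succAbove, ρ.lft_E_diag hf]
      simp [mem_lastSet]

theorem not_paired_pair (hN : Odd N) {i0 i1 : Fin (N + 1)} (h0 : Odd i0.val) (h1 : Even i1.val)
    (h01 : i0 < i1) (hp : Paired i0 b μ) (hq : Paired i1 (b - 1) μ) : False := by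
  have hlt : i1.val < N := by
    have := i1.2
    rw [Nat.odd_iff] at hN
    rw [Nat.even_iff] at h1
    omega
  have h01' : i0.val < i1.val := h01
  have key : ∀ t : ℕ, ∀ h : t < N, i0.val ≤ t + 1 → t ≤ i1.val → μ ⟨t, h⟩ = b := by
    intro t
    induction t with
    | zero =>
      intro h h2 h3
      have hi : i0.val = 1 := by
        have := h0.pos
        omega
      have := hp (Fin.castSucc ⟨0, h⟩) i0 (by simp) (by simpa using hi)
      rwa [insWeight_self, insWeight_castSucc (by rw [Fin.lt_def]; simp [hi])] at this
    | succ t ih =>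
      intro h h2 h3
      by_cases ht : i0.val ≤ t + 1
      · rw [← ih (by omega) ht (by omega)]
        by_cases he : Even t
        · have := hq (Fin.castSucc ⟨t, by omega⟩) (Fin.castSucc ⟨t + 1, h⟩) (by simpa using he)
            (by simp)
          have hne : t + 1 ≠ i1.val := fun hh => by
            rw [← hh] at h1
            exact (Nat.not_even_iff_odd.2 he.add_one) h1
          rw [insWeight_castSucc (by rw [Fin.lt_def]; simp; omega),
            insWeight_castSucc (by rw [Fin.lt_def]; simp; omega)] at this
          exact this.symm
        · have hne : i0.val ≠ t + 1 := fun hh => by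
            rw [hh] at h0
            exact he (by simpa [Nat.odd_add_one] using h0)
          have := hp (Fin.succ ⟨t, by omega⟩) (Fin.succ ⟨t + 1, h⟩)
            (by simpa [Nat.even_add_one] using he) (by simp)
          rw [insWeight_succ (by rw [Fin.le_def]; simp; omega),
            insWeight_succ (by rw [Fin.le_def]; simp; omega)] at this
          linarith
      · have hi : i0.val = t + 2 := by omega
        have := hp (Fin.castSucc ⟨t + 1, h⟩) i0 ?_ (by simpa using hi)
        · rwa [insWeight_self, insWeight_castSucc (by rw [Fin.lt_def]; simp [hi])] at this
        · rw [hi, Nat.odd_iff] at h0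
          simp only [Fin.val_castSucc, Nat.even_iff]
          omega
  have h2 := key i1.val hlt (by omega) le_rfl
  have h3 := hq i1 (Fin.succ ⟨i1.val, hlt⟩) h1 (by simp)
  rw [insWeight_self, insWeight_succ (by rw [Fin.le_def]; simp)] at h3
  linarith

end PRep

namespace PRep

variable {N : ℕ} {M : Type} [AddCommGroup M] [Module ℚ M] (ρ : PRep N M) {P Q : ℕ → Prop}
  {b : ℚ} {μ : Fin N → ℚ}

theorem exists_orthogonal (A : Submodule ℚ (Fock (Fin N) M)) [FiniteDimensional ℚ A]
    (f : Fock (Fin N) M) : ∃ a ∈ A, ∀ x ∈ A, ρ.vip (f - a) x = 0 := by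
  let Φ : A →ₗ[ℚ] Module.Dual ℚ A := (ρ.vip.domRestrict₁₂ A A)
  have hinj : Function.Injective Φ := by
    refine (injective_iff_map_eq_zero Φ).2 fun a ha => ?_
    have h := LinearMap.congr_fun ha a
    exact Subtype.ext (ρ.vip_self_eq_zero h)
  have hsurj := (LinearMap.injective_iff_surjective_of_finrank_eq_finrank
    (Subspace.dual_finrank_eq (K := ℚ) (V := A)).symm).1 hinj
  obtain ⟨a, ha⟩ := hsurj ((ρ.vip f).comp A.subtype)
  refine ⟨a, a.2, fun x hx => ?_⟩
  have h : ρ.vip a x = ρ.vip f x := LinearMap.congr_fun ha ⟨x, hx⟩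
  rw [map_sub, LinearMap.sub_apply, h, sub_self]

/-- The filtration on the Fock space. -/
def VF (D : ℕ) : Submodule ℚ (Fock (Fin N) M) where
  carrier := {f | ∀ I, f I ∈ ρ.Fil D}
  add_mem' := fun h h' I => (ρ.Fil D).add_mem (h I) (h' I)
  zero_mem' := fun _ => (ρ.Fil D).zero_mem
  smul_mem' := fun r _ h I => (ρ.Fil D).smul_mem r (h I)

instance finiteDimensional_VF (D : ℕ) : FiniteDimensional ℚ (ρ.VF D) := by
  have := ρ.fil_fd D
  let Φ : ρ.VF D →ₗ[ℚ] (Finset (Fin N) → ρ.Fil D) :=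
    { toFun := fun f I => ⟨f.1 I, f.2 I⟩
      map_add' := fun f g => rfl
      map_smul' := fun r f => rfl }
  refine FiniteDimensional.of_injective Φ fun f g h => ?_
  exact Subtype.ext (Fock.ext fun I => congrArg Subtype.val (congrFun h I))

theorem exists_mem_VF (f : Fock (Fin N) M) : ∃ D, f ∈ ρ.VF D := by
  choose D hD using fun I => ρ.fil_exists (f I)
  exact ⟨Finset.univ.sup D, fun I => ρ.fil_mono (Finset.le_sup (Finset.mem_univ I)) (hD I)⟩

variable {D : ℕ} {f : Fock (Fin N) M}

theorem lft_mem_VF (hf : f ∈ ρ.VF D) (A B : Fin (N + 1)) : lft (ρ.E A B) f ∈ ρ.VF D :=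
  fun I => by rw [lft_apply]; exact ρ.fil_E D A B _ (hf I)

theorem cr_mem_VF (hf : f ∈ ρ.VF D) (j : Fin N) : cr ℚ j f ∈ ρ.VF D := fun I => by
  rw [cr_apply]
  split_ifs
  · exact zsmul_mem (hf _) _
  · exact zero_mem _

theorem an_mem_VF (hf : f ∈ ρ.VF D) (j : Fin N) : an ℚ j f ∈ ρ.VF D := fun I => by
  rw [an_apply]
  split_ifs
  · exact zero_mem _
  · exact zsmul_mem (hf _) _

theorem d_mem_VF (hf : f ∈ ρ.VF D) : ρ.d f ∈ ρ.VF D := by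
  rw [d, LinearMap.sum_apply]
  exact sum_mem fun k _ => ρ.cr_mem_VF (ρ.lft_mem_VF hf _ _) k

theorem ds_mem_VF (hf : f ∈ ρ.VF D) : ρ.ds f ∈ ρ.VF D := by
  rw [ds, LinearMap.sum_apply]
  exact sum_mem fun k _ => ρ.an_mem_VF (ρ.lft_mem_VF hf _ _) k

theorem EE_mem_VF (hf : f ∈ ρ.VF D) (i j : Fin N) : ρ.EE i j f ∈ ρ.VF D :=
  sub_mem (ρ.lft_mem_VF hf _ _) (ρ.cr_mem_VF (ρ.an_mem_VF hf i) j)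

/-- Closed highest weight vectors of unpaired weight are exact. -/
theorem exists_eq_d {i0 : Fin (N + 1)} (hf : f ∈ ρ.W (fun a => a + i0.val = N) b μ)
    (hd : ρ.d f = 0) (hp : ¬ Paired i0 b μ) :
    ∃ z ∈ ρ.W (fun a => a + 1 + i0.val = N) (b + 1) μ, ρ.d z = f := by
  obtain ⟨D, hD⟩ := ρ.exists_mem_VF f
  let A : Submodule ℚ (Fock (Fin N) M) :=
    (ρ.W (fun a => a + 1 + i0.val = N) (b + 1) μ ⊓ ρ.VF D).map ρ.d
  have : FiniteDimensional ℚ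
      (ρ.W (fun a => a + 1 + i0.val = N) (b + 1) μ ⊓ ρ.VF D : Submodule ℚ (Fock (Fin N) M)) :=
    Submodule.finiteDimensional_inf_right _ _
  have : FiniteDimensional ℚ A := inferInstanceAs (FiniteDimensional ℚ (Submodule.map _ _))
  obtain ⟨_, ⟨z, ⟨hz1, hz2⟩, rfl⟩, hz⟩ := ρ.exists_orthogonal A f
  refine ⟨z, hz1, ?_⟩
  have hdz : ρ.d z ∈ ρ.W (fun a => a + i0.val = N) b μ := by
    have := ρ.d_mem_W (Q := fun a => a + i0.val = N) hz1 fun a h => h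
    rwa [add_sub_cancel_right] at this
  have hg := sub_mem hf hdz
  by_contra hne
  refine hp (ρ.paired_of_harmonic hg (sub_ne_zero.2 (Ne.symm hne)) ?_ ?_)
  · rw [map_sub, hd, ← Module.End.mul_apply, d_mul_d]; simp
  · have h1 : ρ.ds (f - ρ.d z) ∈ ρ.W (fun a => a + 1 + i0.val = N) (b + 1) μ :=
      ρ.ds_mem_W hg fun a h => h
    have h2 : ρ.ds (f - ρ.d z) ∈ ρ.VF D := ρ.ds_mem_VF (sub_mem hD (ρ.d_mem_VF hz2))
    have h3 := hz _ ⟨_, ⟨h1, h2⟩, rfl⟩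
    rw [vip_comm, vip_d] at h3
    exact ρ.vip_self_eq_zero h3

end PRep

namespace PRep

variable {N : ℕ} {M : Type} [AddCommGroup M] [Module ℚ M] (ρ : PRep N M) {P Q : ℕ → Prop}
  {b : ℚ} {μ : Fin N → ℚ}

/-- The component of exterior degree `a`. -/
def cut (a : ℕ) (f : Fock (Fin N) M) : Fock (Fin N) M := fun I => if I.card = a then f I else 0

theorem cut_apply (a : ℕ) (f : Fock (Fin N) M) (I : Finset (Fin N)) :
    cut a f I = if I.card = a then f I else 0 := rfl

theorem lft_cut (a : ℕ) (A : Module.End ℚ M) (f : Fock (Fin N) M) :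
    lft A (cut a f) = cut a (lft A f) := by
  refine Fock.ext fun I => ?_
  simp only [lft_apply, cut_apply]
  split_ifs <;> simp

theorem cr_an_cut (a : ℕ) (i j : Fin N) (f : Fock (Fin N) M) :
    cr ℚ j (an ℚ i (cut a f)) = cut a (cr ℚ j (an ℚ i f)) := by
  refine Fock.ext fun I => ?_
  simp only [cr_apply, an_apply, cut_apply]
  by_cases hj : j ∈ I
  · by_cases hi : i ∈ I.erase j
    · simp [hi]
    · have : (insert i (I.erase j)).card = I.card := by
        rw [Finset.card_insert_of_notMem hi, Finset.card_erase_add_one hj]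
      simp only [hj, hi, if_true, if_false, this]
      split_ifs <;> simp
  · simp [hj]

theorem EE_cut (a : ℕ) (i j : Fin N) (f : Fock (Fin N) M) :
    ρ.EE i j (cut a f) = cut a (ρ.EE i j f) := by
  simp only [EE, LinearMap.sub_apply, Module.End.mul_apply, lft_cut, cr_an_cut]
  refine Fock.ext fun I => ?_
  simp only [Fock.sub_apply, cut_apply]
  split_ifs <;> simp

variable {ρ} in
theorem cut_mem_W {f : Fock (Fin N) M} (hf : f ∈ ρ.W P b μ) {a : ℕ} (h : P a → Q a) :
    cut a f ∈ ρ.W Q b μ := by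
  have h0 : cut a (0 : Fock (Fin N) M) = 0 := Fock.ext fun I => by simp [cut_apply]
  have hs : ∀ c : ℚ, cut a (c • f) = c • cut a f := fun c => Fock.ext fun I => by
    simp only [cut_apply, Fock.smul_apply]; split_ifs <;> simp
  obtain ⟨h1, h2, h3, h4⟩ := hf
  refine ⟨fun i j hij => by rw [EE_cut, h1 i j hij, h0], fun i => by rw [EE_cut, h2, hs],
    by rw [lft_cut, h3, hs], fun I hI => ?_⟩
  rw [cut_apply] at hI
  split_ifs at hI with hc
  · rw [hc]; exact h (hc ▸ h4 I hI)
  · exact absurd rfl hI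

variable {ρ} in
theorem W_of_sup {f : Fock (Fin N) M} (hf : f ∈ ρ.W P b μ) (h : Sup Q f) : f ∈ ρ.W Q b μ :=
  ⟨hf.1, hf.2.1, hf.2.2.1, h⟩

variable {ρ} in
theorem W_mono {f : Fock (Fin N) M} (hf : f ∈ ρ.W P b μ) (h : ∀ a, P a → Q a) : f ∈ ρ.W Q b μ :=
  W_of_sup hf (hf.2.2.2.mono h)

theorem D_apply (f : Fock (Fin N) M) : ρ.D f = ρ.d f + ρ.kap f := rfl

theorem D_D (f : Fock (Fin N) M) : ρ.D (ρ.D f) = 0 := by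
  rw [← Module.End.mul_apply, D_mul_D]; rfl

theorem d_cut {a : ℕ} {v : Fock (Fin N) M} (hv : Sup (fun c => c ≤ a) v)
    (h : ∀ I : Finset (Fin N), I.card = a + 1 → ρ.D v I = 0) : ρ.d (cut a v) = 0 := by
  have h1 : Sup (fun c => c = a) (cut a v) := fun I hI => by
    rw [cut_apply] at hI
    by_contra hc
    exact hI (if_neg hc)
  have h2 : Sup (fun c => c < a) (v - cut a v) := fun I hI => by
    rw [Fock.sub_apply, cut_apply] at hI
    by_cases hc : I.card = a
    · simp [hc] at hI
    · refine lt_of_le_of_ne (hv I fun h' => hI ?_) hc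
      simp [h', hc]
  refine Fock.ext fun I => ?_
  by_cases hI : I.card = a + 1
  · have h3 := h I hI
    have h4 : ρ.D v I = ρ.d (cut a v) I + ρ.d (v - cut a v) I + ρ.kap v I := by
      rw [D_apply, map_sub, Fock.add_apply, Fock.sub_apply, add_sub_cancel]
    rw [(ρ.sup_d (Q := fun c => c ≤ a) h2 fun c h => h).apply_eq_zero (by omega),
      (ρ.sup_kap (Q := fun c => c ≤ a) hv fun c h => by omega).apply_eq_zero (by omega),
      add_zero, add_zero, h3] at h4
    exact h4.symm
  · exact (ρ.sup_d (Q := fun c => c = a + 1) h1 fun c h => by omega).apply_eq_zero hI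

theorem D_mem_W {f : Fock (Fin N) M} (hf : f ∈ ρ.W P b μ) (h : ∀ a, P a → Q (a + 1))
    (h' : ∀ a, P (a + 1) → Q a) : ρ.D f ∈ ρ.W Q (b - 1) μ :=
  add_mem (ρ.d_mem_W hf h) (ρ.kap_mem_W hf h')

theorem exists_D_eq (hN : Odd N) (a1 : ℕ) : ∀ v ∈ ρ.W (fun c => Odd c ∧ c ≤ a1) b μ, ρ.D v = 0 →
    (∀ i1 : Fin (N + 1), Even i1.val → N ≤ i1.val + a1 → ¬ Paired i1 b μ) →
    ∃ z ∈ ρ.W (fun c => Even c ∧ c + 1 ≤ a1) (b + 1) μ, ρ.D z = v := by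
  induction a1 with
  | zero =>
    intro v hv _ _
    refine ⟨0, zero_mem _, ?_⟩
    rw [map_zero]
    refine Fock.ext fun I => (hv.2.2.2.apply_eq_zero ?_).symm
    rintro ⟨h1, h2⟩
    exact absurd h1.pos (by omega)
  | succ a1 ih =>
    intro v hv hD hp
    by_cases ha : Odd (a1 + 1) ∧ a1 + 1 ≤ N
    · obtain ⟨i1, hi1⟩ : ∃ i1 : Fin (N + 1), i1.val + (a1 + 1) = N :=
        ⟨⟨N - (a1 + 1), by omega⟩, by simp; omega⟩
      have he : Even i1.val := by
        have := ha.1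
        rw [Nat.odd_iff] at hN this
        rw [Nat.even_iff]
        omega
      obtain ⟨z1, hz1, hdz⟩ := ρ.exists_eq_d (i0 := i1)
        (cut_mem_W hv (a := a1 + 1) fun _ => by omega)
        (ρ.d_cut (hv.2.2.2.mono fun _ h => h.2) fun I _ => by rw [hD]; rfl)
        (hp i1 he (by omega))
      have hv' : v - ρ.D z1 ∈ ρ.W (fun c => Odd c ∧ c ≤ a1) b μ := by
        have h1 : ρ.D z1 ∈ ρ.W (fun c => Odd c ∧ c ≤ a1 + 1) b μ := by
          have := ρ.D_mem_W (Q := fun c => Odd c ∧ c ≤ a1 + 1) hz1 (fun c hc => ?_) fun c hc => ?_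
          · rwa [add_sub_cancel_right] at this
          · have : c = a1 := by omega
            rw [this]; exact ⟨ha.1, le_rfl⟩
          · have : c + 1 = a1 := by omega
            rw [← this]
            rw [← this] at ha
            exact ⟨by simpa [Nat.odd_add_one] using ha.1, by omega⟩
        refine W_of_sup (sub_mem hv h1) fun I hI => ?_
        have h2 := (sub_mem hv h1).2.2.2 I hI
        refine ⟨h2.1, Nat.le_of_lt_succ (lt_of_le_of_ne h2.2 fun hc => hI ?_)⟩
        rw [D_apply, hdz, Fock.sub_apply, Fock.add_apply, cut_apply, if_pos hc,
          (ρ.sup_kap (Q := fun c => c + 2 + i1.val = N) hz1.2.2.2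
            fun c h => by omega).apply_eq_zero (by omega), add_zero, sub_self]
      obtain ⟨z', hz', hDz'⟩ := ih _ hv' (by rw [map_sub, hD, D_D, sub_zero])
        fun i h1 h2 => hp i h1 (by omega)
      refine ⟨z1 + z', add_mem (W_mono hz1 fun c hc => ?_) (W_mono hz' fun c hc => ⟨hc.1, by omega⟩),
        by rw [map_add, hDz']; abel⟩
      refine ⟨?_, by omega⟩
      rw [Nat.odd_iff] at hN
      rw [Nat.even_iff] at he ⊢
      omega
    · have hv' : v ∈ ρ.W (fun c => Odd c ∧ c ≤ a1) b μ := W_of_sup hv fun I hI => by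
        have h2 := hv.2.2.2 I hI
        have h3 : I.card ≤ N := by simpa using I.card_le_univ
        refine ⟨h2.1, Nat.le_of_lt_succ (lt_of_le_of_ne h2.2 fun hc => ha ?_)⟩
        rw [show a1 + 1 = I.card from hc.symm]
        exact ⟨h2.1, h3⟩
      obtain ⟨z, hz, hDz⟩ := ih v hv' hD fun i h1 h2 => hp i h1 (by omega)
      exact ⟨z, W_mono hz fun c hc => ⟨hc.1, by omega⟩, hDz⟩

/-- A highest weight vector of even parity whose top component is closed can be replaced by one of
smaller exterior degree with the same differential. -/
theorem exists_lower (hN : Odd N) {a0 : ℕ} {w : Fock (Fin N) M}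
    (hw : w ∈ ρ.W (fun c => Even c ∧ c ≤ a0) b μ)
    (h : ∀ I : Finset (Fin N), I.card = a0 + 1 → ρ.D w I = 0) :
    ∃ w' ∈ ρ.W (fun c => Even c ∧ c + 1 ≤ a0) b μ, ρ.D w' = ρ.D w := by
  by_cases ha : Even a0 ∧ a0 ≤ N
  swap
  · refine ⟨w, W_of_sup hw fun I hI => ?_, rfl⟩
    have h2 := hw.2.2.2 I hI
    have h3 : I.card ≤ N := by simpa using I.card_le_univ
    refine ⟨h2.1, Nat.succ_le_of_lt (lt_of_le_of_ne h2.2 fun hc => ha ?_)⟩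
    rw [← hc]
    exact ⟨h2.1, h3⟩
  obtain ⟨i0, hi0⟩ : ∃ i0 : Fin (N + 1), i0.val + a0 = N :=
    ⟨⟨N - a0, by omega⟩, by simp; omega⟩
  have ho : Odd i0.val := by
    have := ha.1
    rw [Nat.odd_iff] at hN ⊢
    rw [Nat.even_iff] at this
    omega
  have hdw := ρ.d_cut (hw.2.2.2.mono fun _ h => h.2) h
  by_cases hp : Paired i0 b μ
  · have hv : ρ.D w ∈ ρ.W (fun c => Odd c ∧ c ≤ a0) (b - 1) μ := by
      have h1 := ρ.D_mem_W (Q := fun c => Odd c ∧ c ≤ a0 + 1) hw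
        (fun c hc => ⟨hc.1.add_one, by omega⟩)
        (fun c hc => ⟨by simpa [Nat.even_add_one] using hc.1, by omega⟩)
      refine W_of_sup h1 fun I hI => ?_
      have h2 := h1.2.2.2 I hI
      exact ⟨h2.1, Nat.le_of_lt_succ (lt_of_le_of_ne h2.2 fun hc => hI (h I hc))⟩
    obtain ⟨z, hz, hDz⟩ := ρ.exists_D_eq hN a0 _ hv (ρ.D_D w) fun i1 h1 h2 hq =>
      not_paired_pair hN ho h1 (lt_of_le_of_ne (Fin.le_def.2 (by omega)) fun hh => by
        rw [hh] at ho
        exact (Nat.not_even_iff_odd.2 ho) h1) hp hq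
    rw [sub_add_cancel] at hz
    exact ⟨z, hz, hDz⟩
  · obtain ⟨z, hz, hdz⟩ := ρ.exists_eq_d (i0 := i0)
        (cut_mem_W hw (a := a0) fun _ => by omega) hdw hp
    have h1 : ρ.D z ∈ ρ.W (fun c => Even c ∧ c ≤ a0) b μ := by
      have := ρ.D_mem_W (Q := fun c => Even c ∧ c ≤ a0) hz (fun c hc => ?_) fun c hc => ?_
      · rwa [add_sub_cancel_right] at this
      · have : c + 1 = a0 := by omega
        rw [this]; exact ⟨ha.1, le_rfl⟩
      · have : c + 2 = a0 := by omega
        rw [← this]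
        rw [← this] at ha
        exact ⟨by simpa [Nat.even_add] using ha.1, by omega⟩
    refine ⟨w - ρ.D z, W_of_sup (sub_mem hw h1) fun I hI => ?_, by rw [map_sub, D_D, sub_zero]⟩
    have h2 := (sub_mem hw h1).2.2.2 I hI
    refine ⟨h2.1, Nat.succ_le_of_lt (lt_of_le_of_ne h2.2 fun hc => hI ?_)⟩
    rw [D_apply, hdz, Fock.sub_apply, Fock.add_apply, cut_apply, if_pos hc,
      (ρ.sup_kap (Q := fun c => c + 2 + i0.val = N) hz.2.2.2
        fun c h => by omega).apply_eq_zero (by omega), add_zero, sub_self]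

end PRep

namespace PRep

variable {N : ℕ} {M : Type} [AddCommGroup M] [Module ℚ M] (ρ : PRep N M) {P Q : ℕ → Prop}
  {b : ℚ} {μ : Fin N → ℚ}

theorem eigenvalue_nonneg {f : Fock (Fin N) M} (hb : lft (ρ.E 0 0) f = b • f) (h0 : f ≠ 0) :
    0 ≤ b := by
  have hpos : 0 < ρ.vip f f :=
    lt_of_le_of_ne (ρ.vip_nonneg f) fun h => h0 (ρ.vip_self_eq_zero h.symm)
  have h : ρ.vip (lft (ρ.E 0 0) f) f = ∑ k, ρ.vip (lft (ρ.T k) f) (lft (ρ.T k) f) := by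
    simp only [vip_apply, lft_apply, ← ρ.sum_tm_T, LinearMap.sum_apply, map_sum,
      Module.End.mul_apply, ρ.tm_adj]
  rw [hb, map_smul, LinearMap.smul_apply, smul_eq_mul] at h
  refine nonneg_of_mul_nonneg_left (h ▸ Finset.sum_nonneg fun k _ => ρ.vip_nonneg _) hpos

theorem D_kaps_apply {f : Fock (Fin N) M} (hb : lft (ρ.E 0 0) f = b • f) (hD : ρ.D f = 0) {s : ℕ}
    (hs : Sup (fun c => s ≤ c) f) {I : Finset (Fin N)} (hI : I.card = s) :
    ρ.D (ρ.kaps f) I = (b + N - s) • f I := by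
  have h1 : ρ.D (ρ.kaps f) = (ρ.kap (ρ.kaps f) + ρ.kaps (ρ.kap f))
      + (ρ.d (ρ.kaps f) + ρ.kaps (ρ.d f)) := by
    have : ρ.kaps (ρ.D f) = 0 := by rw [hD, map_zero]
    rw [D_apply, map_add] at this
    rw [D_apply, ← add_zero (_ + _), ← this]
    abel
  have h2 := LinearMap.congr_fun ρ.kap_kaps f
  simp only [LinearMap.add_apply, LinearMap.sub_apply, Module.End.mul_apply, hb,
    LinearMap.smul_apply, Module.End.one_apply, LinearMap.sum_apply] at h2
  have h3 : Sup (fun c => s + 2 ≤ c) (ρ.d (ρ.kaps f) + ρ.kaps (ρ.d f)) :=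
    (ρ.sup_d (ρ.sup_kaps hs (Q := fun c => s + 1 ≤ c) fun c h => by omega) fun c h => by omega).add
      (ρ.sup_kaps (ρ.sup_d hs (Q := fun c => s + 1 ≤ c) fun c h => by omega) fun c h => by omega)
  rw [h1, Fock.add_apply, h3.apply_eq_zero (by omega), add_zero, h2]
  simp only [Fock.sub_apply, Fock.add_apply, Fock.smul_apply, Fock.sum_apply,
    cr_mul_an_apply_self]
  rw [Finset.sum_ite_mem, Finset.univ_inter, Finset.sum_const, hI, sub_smul, add_smul,
    Nat.cast_smul_eq_nsmul, Nat.cast_smul_eq_nsmul]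

/-- Closed vectors of even parity are exact. -/
theorem exists_D_eq_of_even (hN : Odd N) (n : ℕ) : ∀ f : Fock (Fin N) M, lft (ρ.E 0 0) f = b • f →
    ρ.D f = 0 → Sup (fun c => Even c ∧ N + 1 ≤ c + n) f →
    ∃ y, lft (ρ.E 0 0) y = (b + 1) • y ∧ Sup (fun c => Odd c) y ∧ ρ.D y = f := by
  induction n with
  | zero =>
    intro f _ _ hs
    refine ⟨0, by simp, Sup.zero, ?_⟩
    rw [map_zero]
    refine Fock.ext fun I => (hs.apply_eq_zero ?_).symm
    have h3 : I.card ≤ N := by simpa using I.card_le_univ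
    omega
  | succ n ih =>
    intro f hb hD hs
    by_cases h : ∃ I, f I ≠ 0 ∧ I.card + n = N
    · obtain ⟨I, hI, hc⟩ := h
      have hc1 := (hs I hI).1
      have hlt : I.card < N := lt_of_le_of_ne (by omega) fun h => by
        rw [h] at hc1
        exact (Nat.not_even_iff_odd.2 hN) hc1
      have hb0 : 0 ≤ b := ρ.eigenvalue_nonneg hb fun h => hI (by rw [h]; rfl)
      have hpos : 0 < b + N - I.card := by
        have : (I.card : ℚ) < N := by exact_mod_cast hlt
        linarith
      have hkb : lft (ρ.E 0 0) (ρ.kaps f) = (b + 1) • ρ.kaps f := by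
        rw [E_zero_kaps, hb, map_smul, add_smul, one_smul]
      have hks : Sup (fun c => Odd c) (ρ.kaps f) :=
        ρ.sup_kaps hs fun a ha => ha.1.add_one
      have hDs : Sup (fun c => Even c ∧ N + 1 ≤ c + (n + 1)) (ρ.D (ρ.kaps f)) := by
        have hks : Sup (fun c => Odd c ∧ N + 2 ≤ c + (n + 1)) (ρ.kaps f) :=
          ρ.sup_kaps hs fun a ha => ⟨ha.1.add_one, by omega⟩
        exact (ρ.sup_d hks fun c h => ⟨h.1.add_one, by omega⟩).add
          (ρ.sup_kap hks fun c h => ⟨by simpa [Nat.odd_add_one] using h.1, by omega⟩)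
      have e1 : lft (ρ.E 0 0) (f - (b + N - I.card)⁻¹ • ρ.D (ρ.kaps f))
          = b • (f - (b + N - I.card)⁻¹ • ρ.D (ρ.kaps f)) := by
        rw [map_sub, map_smul, hb, D_apply, map_add, E_zero_d, E_zero_kap, hkb, map_smul, map_smul,
          smul_sub]
        congr 1
        rw [smul_comm b]
        congr 1
        module
      have e2 : ρ.D (f - (b + N - I.card)⁻¹ • ρ.D (ρ.kaps f)) = 0 := by
        rw [map_sub, map_smul, D_D, hD, smul_zero, sub_zero]
      obtain ⟨y, hy1, hy2, hy3⟩ := ih (f - (b + N - I.card)⁻¹ • ρ.D (ρ.kaps f)) e1 e2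
        fun J hJ => by
          have h1 := hs.sub (hDs.smul _) J hJ
          refine ⟨h1.1, ?_⟩
          by_contra hlt'
          refine hJ ?_
          have hJI : J.card = I.card := by omega
          rw [Fock.sub_apply, Fock.smul_apply,
            ρ.D_kaps_apply hb hD (hs.mono fun c hc => (by omega : I.card ≤ c)) hJI, smul_smul,
            inv_mul_cancel₀ hpos.ne', one_smul, sub_self]
      refine ⟨y + (b + N - I.card)⁻¹ • ρ.kaps f, ?_, hy2.add (hks.smul _), ?_⟩
      · rw [map_add, map_smul, hy1, hkb, smul_add, smul_comm]
      · rw [map_add, map_smul, hy3, sub_add_cancel]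
    · push Not at h
      refine ih f hb hD fun I hI => ?_
      have h1 := hs I hI
      have h2 := h I hI
      exact ⟨h1.1, by omega⟩

/-- Truncated exactness for a single vector. -/
def TruncExact (t : ℤ) (b : ℚ) (u : Fock (Fin N) M) : Prop :=
  ∃ w, lft (ρ.E 0 0) w = (b + 1) • w ∧ Sup (fun c => Odd c ∧ t ≤ c + 1) w ∧
    ∀ I : Finset (Fin N), t ≤ I.card → ρ.D w I = u I

theorem exists_below (hN : Odd N) (t : ℤ) (a0 : ℕ) : ∀ w ∈ ρ.W (fun c => Even c ∧ c ≤ a0) b μ,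
    (∀ I : Finset (Fin N), t + 1 ≤ I.card → ρ.D w I = 0) →
    ∃ w' ∈ ρ.W (fun c => Even c ∧ (c : ℤ) < t) b μ, ρ.D w' = ρ.D w := by
  induction a0 with
  | zero =>
    intro w hw h
    by_cases ht : t ≤ 0
    · obtain ⟨w', hw', hD⟩ := ρ.exists_lower hN hw fun I hI => h I (by omega)
      exact ⟨w', W_mono hw' fun c hc => by omega, hD⟩
    · exact ⟨w, W_mono hw fun c hc => ⟨hc.1, by omega⟩, rfl⟩
  | succ a0 ih =>
    intro w hw h
    by_cases ht : t ≤ a0 + 1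
    · obtain ⟨w', hw', hD⟩ := ρ.exists_lower hN hw fun I hI => h I (by push_cast [hI]; omega)
      rw [← hD]
      refine ih w' (W_mono hw' fun c hc => ⟨hc.1, by omega⟩) fun I hI => ?_
      rw [hD]; exact h I hI
    · exact ⟨w, W_mono hw fun c hc => ⟨hc.1, by omega⟩, rfl⟩

theorem D_congr {f g : Fock (Fin N) M} {I : Finset (Fin N)}
    (h : ∀ J : Finset (Fin N), J.card + 1 = I.card ∨ J.card = I.card + 1 → f J = g J) :
    ρ.D f I = ρ.D g I := by
  simp only [D, d, kap, LinearMap.add_apply, LinearMap.sum_apply, Module.End.mul_apply,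
    Fock.add_apply, Fock.sum_apply, cr_apply, an_apply, lft_apply]
  congr 1 <;> refine Finset.sum_congr rfl fun k _ => ?_
  · by_cases hk : k ∈ I
    · rw [if_pos hk, if_pos hk, h _ (Or.inl (Finset.card_erase_add_one hk))]
    · rw [if_neg hk, if_neg hk]
  · by_cases hk : k ∈ I
    · rw [if_pos hk, if_pos hk]
    · rw [if_neg hk, if_neg hk, h _ (Or.inr (Finset.card_insert_of_notMem hk))]

theorem truncExact_of_mem_W (hN : Odd N) {t : ℤ} {u : Fock (Fin N) M}
    (hu : u ∈ ρ.W (fun c => Even c ∧ t ≤ c) b μ)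
    (h : ∀ I : Finset (Fin N), t + 1 ≤ I.card → ρ.D u I = 0) : ρ.TruncExact t b u := by
  have hle : ∀ I : Finset (Fin N), I.card ≤ N := fun I => by simpa using I.card_le_univ
  obtain ⟨w', hw', hDw⟩ := ρ.exists_below hN t N u
    (W_of_sup hu fun I hI => ⟨(hu.2.2.2 I hI).1, hle I⟩) h
  obtain ⟨y, hy1, hy2, hy3⟩ := ρ.exists_D_eq_of_even (b := b) hN (N + 1) (u - w')
    (by rw [map_sub, hu.2.2.1, hw'.2.2.1, smul_sub]) (by rw [map_sub, hDw, sub_self])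
    ((hu.2.2.2.mono fun c hc => ⟨hc.1, by omega⟩).sub
      (hw'.2.2.2.mono fun c hc => ⟨hc.1, by omega⟩))
  let w : Fock (Fin N) M := fun I => if t ≤ I.card + 1 then y I else 0
  have hw : ∀ I, w I = if t ≤ I.card + 1 then y I else 0 := fun _ => rfl
  refine ⟨w, Fock.ext fun I => ?_, fun I hI => ?_, fun I hI => ?_⟩
  · have := congrArg (fun f : Fock (Fin N) M => f I) hy1
    simp only [lft_apply, Fock.smul_apply, hw] at this ⊢
    split_ifs
    · exact this
    · simp
  · rw [hw] at hI
    split_ifs at hI with h1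
    · exact ⟨hy2 I hI, h1⟩
    · exact absurd rfl hI
  · rw [ρ.D_congr (g := y), hy3, Fock.sub_apply, hw'.2.2.2.apply_eq_zero, sub_zero]
    · exact fun h => absurd h.2 (not_lt.2 hI)
    · intro J hJ
      rw [hw, if_pos (by omega)]

end PRep

namespace PRep

variable {N : ℕ} {M : Type} [AddCommGroup M] [Module ℚ M] (ρ : PRep N M)

/-- The pairs of an exterior index and a basis index occurring in `f`. -/
def csupp (f : Fock (Fin N) M) : Set (Finset (Fin N) × ρ.B) := {p | ρ.co p.2 (f p.1) ≠ 0}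

theorem finite_csupp (f : Fock (Fin N) M) : (ρ.csupp f).Finite := by
  refine (Set.finite_iUnion fun I : Finset (Fin N) =>
    (ρ.co_fin (f I)).image fun β => (I, β)).subset ?_
  rintro ⟨I, β⟩ h
  exact Set.mem_iUnion.2 ⟨I, β, h, rfl⟩

theorem csupp_nonempty {f : Fock (Fin N) M} (h : f ≠ 0) : (ρ.csupp f).Nonempty := by
  by_contra h'
  refine h (Fock.ext fun I => ρ.co_ext _ fun β => ?_)
  by_contra h2
  exact h' ⟨(I, β), h2⟩

theorem co_EE (f : Fock (Fin N) M) (i : Fin N) (I : Finset (Fin N)) (β : ρ.B) :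
    ρ.co β (ρ.EE i i f I) = (ρ.wt β i.succ - if i ∈ I then 1 else 0) * ρ.co β (f I) := by
  rw [EE, LinearMap.sub_apply, Fock.sub_apply, Module.End.mul_apply, cr_mul_an_apply_self,
    lft_apply, map_sub, ρ.co_E, sub_mul]
  split_ifs <;> simp

theorem exists_weight_vector {Y : Submodule ℚ (Fock (Fin N) M)}
    (hY : ∀ f ∈ Y, ∀ i j, ρ.EE i j f ∈ Y) (hne : ∃ f ∈ Y, f ≠ 0) :
    ∃ f ∈ Y, f ≠ 0 ∧ ∃ μ : Fin N → ℚ, ∀ i, ρ.EE i i f = μ i • f := by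
  classical
  have hex : ∃ n, ∃ f ∈ Y, f ≠ 0 ∧ (ρ.csupp f).ncard = n := by
    obtain ⟨f, h1, h2⟩ := hne
    exact ⟨_, f, h1, h2, rfl⟩
  obtain ⟨f, hf, h0, hn⟩ := Nat.find_spec hex
  obtain ⟨⟨I, β⟩, hp⟩ := ρ.csupp_nonempty h0
  refine ⟨f, hf, h0, fun i => ρ.wt β i.succ - if i ∈ I then 1 else 0, fun i => ?_⟩
  rw [← sub_eq_zero]
  by_contra hne'
  refine Nat.find_min hex ?_ ⟨_, sub_mem (hY f hf i i) (Y.smul_mem _ hf), hne', rfl⟩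
  rw [← hn]
  refine Set.ncard_lt_ncard ⟨?_, fun h => h hp ?_⟩ (ρ.finite_csupp f)
  · rintro ⟨J, γ⟩ h h'
    refine h ?_
    rw [Fock.sub_apply, map_sub, co_EE, Fock.smul_apply, map_smul, h', mul_zero, smul_zero,
      sub_zero]
  · rw [Fock.sub_apply, map_sub, co_EE, Fock.smul_apply, map_smul, smul_eq_mul, sub_self]

theorem exists_highest_weight_vector {Y : Submodule ℚ (Fock (Fin N) M)} [FiniteDimensional ℚ Y]
    (hY : ∀ f ∈ Y, ∀ i j, ρ.EE i j f ∈ Y) (hne : ∃ f ∈ Y, f ≠ 0) :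
    ∃ f ∈ Y, f ≠ 0 ∧ ∃ μ : Fin N → ℚ, (∀ i j, i < j → ρ.EE i j f = 0) ∧
      ∀ i, ρ.EE i i f = μ i • f := by
  let H : Module.End ℚ Y := ∑ i : Fin N, (-(i.val : ℚ)) •
    (ρ.EE i i).restrict fun f hf => hY f hf i i
  let S : Set ℚ := {c | ∃ f ∈ Y, f ≠ 0 ∧ ∃ μ : Fin N → ℚ, (∀ i, ρ.EE i i f = μ i • f) ∧
    c = ∑ i : Fin N, -(i.val : ℚ) * μ i}
  have hfin : S.Finite := by
    refine (Module.End.finite_hasEigenvalue H).subset ?_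
    rintro _ ⟨f, hf, h0, μ, hμ, rfl⟩
    refine Module.End.hasEigenvalue_of_hasEigenvector (x := ⟨f, hf⟩)
      ⟨Module.End.mem_eigenspace_iff.2 ?_, fun h => h0 (congrArg Subtype.val h)⟩
    refine Subtype.ext ?_
    simp only [H, LinearMap.sum_apply, LinearMap.smul_apply, Submodule.coe_sum, Submodule.coe_smul,
      LinearMap.coe_restrict_apply, hμ, Finset.sum_smul, smul_smul]
  obtain ⟨f0, hf0, h00, μ0, hμ0⟩ := ρ.exists_weight_vector hY hne
  obtain ⟨_, ⟨f, hf, h0, μ, hμ, rfl⟩, hmax⟩ :=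
    Set.exists_max_image S id hfin ⟨_, f0, hf0, h00, μ0, hμ0, rfl⟩
  refine ⟨f, hf, h0, μ, fun i j hij => ?_, hμ⟩
  by_contra hne'
  have h1 : ∀ k, ρ.EE k k (ρ.EE i j f)
      = (μ k + ((if k = i then 1 else 0) - if k = j then 1 else 0)) • ρ.EE i j f := by
    intro k
    have h := LinearMap.congr_fun (ρ.EE_EE k k i j) f
    simp only [LinearMap.sub_apply, Module.End.mul_apply, hμ, map_smul] at h
    rw [sub_eq_iff_eq_add.1 h, add_comm, add_smul, sub_smul]
    congr 1
    by_cases hi : k = i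
    · subst hi
      rw [if_pos rfl, if_pos rfl, if_neg hij.ne, if_neg hij.ne', one_smul, zero_smul]
      simp
    · rw [if_neg hi, if_neg hi]
      by_cases hj : k = j
      · subst hj
        simp
      · rw [if_neg hj, if_neg (Ne.symm hj)]
        simp
  have h2 := hmax _ ⟨_, hY f hf i j, hne', _, h1, rfl⟩
  simp only [id, mul_add, Finset.sum_add_distrib, mul_sub, Finset.sum_sub_distrib, mul_ite, mul_one,
    mul_zero, Finset.sum_ite_eq', Finset.mem_univ, if_true] at h2
  have h3 : (i.val : ℚ) < j.val := by exact_mod_cast hij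
  linarith

/-- Vectors of degree `b` with even exterior degree at least `t` which are closed after truncation. -/
def ZZ (t : ℤ) (b : ℚ) : Submodule ℚ (Fock (Fin N) M) where
  carrier := {u | lft (ρ.E 0 0) u = b • u ∧ Sup (fun c => Even c ∧ t ≤ c) u ∧
    ∀ I : Finset (Fin N), t + 1 ≤ I.card → ρ.D u I = 0}
  add_mem' := fun ⟨h1, h2, h3⟩ ⟨h1', h2', h3'⟩ => ⟨by rw [map_add, h1, h1', smul_add], h2.add h2',
    fun I hI => by rw [map_add, Fock.add_apply, h3 I hI, h3' I hI, add_zero]⟩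
  zero_mem' := ⟨by simp, Sup.zero, fun I _ => by rw [map_zero]; rfl⟩
  smul_mem' := fun r _ ⟨h1, h2, h3⟩ => ⟨by rw [map_smul, h1, smul_comm], h2.smul r,
    fun I hI => by rw [map_smul, Fock.smul_apply, h3 I hI, smul_zero]⟩

/-- Vectors exact after truncation. -/
def BB (t : ℤ) (b : ℚ) : Submodule ℚ (Fock (Fin N) M) where
  carrier := {u | ρ.TruncExact t b u}
  add_mem' := fun ⟨w, h1, h2, h3⟩ ⟨w', h1', h2', h3'⟩ => ⟨w + w',
    by rw [map_add, h1, h1', smul_add], h2.add h2',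
    fun I hI => by rw [map_add, Fock.add_apply, h3 I hI, h3' I hI]; rfl⟩
  zero_mem' := ⟨0, by simp, Sup.zero, fun I _ => by rw [map_zero]⟩
  smul_mem' := fun r _ ⟨w, h1, h2, h3⟩ => ⟨r • w, by rw [map_smul, h1, smul_comm], h2.smul r,
    fun I hI => by rw [map_smul, Fock.smul_apply, h3 I hI]; rfl⟩

theorem EE_apply_eq_zero {f : Fock (Fin N) M} {n : ℕ} (h : ∀ I : Finset (Fin N), I.card = n → f I = 0)
    (i j : Fin N) {I : Finset (Fin N)} (hI : I.card = n) : ρ.EE i j f I = 0 := by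
  have h0 : cut n f = 0 := Fock.ext fun J => by
    rw [cut_apply]; split_ifs with hJ
    · exact h J hJ
    · rfl
  have := congrArg (fun g : Fock (Fin N) M => g I) (ρ.EE_cut n i j f)
  rw [h0, map_zero, cut_apply, if_pos hI] at this
  exact this.symm

theorem EE_mem_ZZ {t : ℤ} {b : ℚ} {u : Fock (Fin N) M} (hu : u ∈ ρ.ZZ t b) (i j : Fin N) :
    ρ.EE i j u ∈ ρ.ZZ t b := by
  obtain ⟨h1, h2, h3⟩ := hu
  refine ⟨?_, ρ.sup_EE h2 i j, fun I hI => ?_⟩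
  · rw [← Module.End.mul_apply, ← (ρ.EE_commute_E_zero i j).eq, Module.End.mul_apply, h1, map_smul]
  · rw [← Module.End.mul_apply, ← (ρ.EE_commute_D i j).eq, Module.End.mul_apply]
    exact ρ.EE_apply_eq_zero (fun J hJ => h3 J (hJ ▸ hI)) i j rfl

theorem EE_mem_BB {t : ℤ} {b : ℚ} {u : Fock (Fin N) M} (hu : u ∈ ρ.BB t b) (i j : Fin N) :
    ρ.EE i j u ∈ ρ.BB t b := by
  obtain ⟨w, h1, h2, h3⟩ := hu
  refine ⟨ρ.EE i j w, ?_, ρ.sup_EE h2 i j, fun I hI => ?_⟩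
  · rw [← Module.End.mul_apply, ← (ρ.EE_commute_E_zero i j).eq, Module.End.mul_apply, h1, map_smul]
  · rw [← Module.End.mul_apply, ← (ρ.EE_commute_D i j).eq, Module.End.mul_apply, ← sub_eq_zero,
      ← Fock.sub_apply, ← map_sub]
    exact ρ.EE_apply_eq_zero (n := I.card) (fun J hJ => by
      rw [Fock.sub_apply, h3 J (hJ ▸ hI), sub_self]) i j rfl

theorem truncExact_of_closed (hN : Odd N) {t : ℤ} {b : ℚ} {u : Fock (Fin N) M}
    (hu : u ∈ ρ.ZZ t b) : ρ.TruncExact t b u := by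
  by_contra hnot
  obtain ⟨D, hD⟩ := ρ.exists_mem_VF u
  let A : Submodule ℚ (Fock (Fin N) M) := (ρ.ZZ t b ⊓ ρ.BB t b) ⊓ ρ.VF D
  have : FiniteDimensional ℚ A := Submodule.finiteDimensional_inf_right _ _
  let O : Submodule ℚ (Fock (Fin N) M) := ⨅ x : A, LinearMap.ker (ρ.vip x.1)
  have hO : ∀ f, f ∈ O ↔ ∀ x ∈ A, ρ.vip x f = 0 := fun f => by simp [O]
  let Y : Submodule ℚ (Fock (Fin N) M) := (ρ.ZZ t b ⊓ O) ⊓ ρ.VF D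
  have : FiniteDimensional ℚ Y := Submodule.finiteDimensional_inf_right _ _
  obtain ⟨a, ha, hao⟩ := ρ.exists_orthogonal A u
  have hY : ∀ f ∈ Y, ∀ i j, ρ.EE i j f ∈ Y := by
    rintro f ⟨⟨h1, h2⟩, h3⟩ i j
    refine ⟨⟨ρ.EE_mem_ZZ h1 i j, (hO _).2 fun x hx => ?_⟩, ρ.EE_mem_VF h3 i j⟩
    rw [← vip_EE]
    exact (hO f).1 h2 _
      ⟨⟨ρ.EE_mem_ZZ hx.1.1 j i, ρ.EE_mem_BB hx.1.2 j i⟩, ρ.EE_mem_VF hx.2 j i⟩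
  have hne : ∃ f ∈ Y, f ≠ 0 := by
    refine ⟨u - a, ⟨⟨sub_mem hu ha.1.1, (hO _).2 fun x hx => ?_⟩, sub_mem hD ha.2⟩, fun h => ?_⟩
    · rw [vip_comm]; exact hao x hx
    · rw [sub_eq_zero] at h
      exact hnot (h ▸ ha.1.2)
  obtain ⟨f, hf, h0, μ, h1, h2⟩ := ρ.exists_highest_weight_vector hY hne
  have h3 : ρ.TruncExact t b f :=
    ρ.truncExact_of_mem_W hN ⟨h1, h2, hf.1.1.1, hf.1.1.2.1⟩ hf.1.1.2.2
  exact h0 (ρ.vip_self_eq_zero ((hO f).1 hf.1.2 f ⟨⟨hf.1.1, h3⟩, hf.2⟩))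

end PRep

section Weyl

variable {σ : Type*}

/-- The Fischer inner product on polynomials. -/
noncomputable def fischer : MvPolynomial σ ℚ →ₗ[ℚ] MvPolynomial σ ℚ →ₗ[ℚ] ℚ :=
  (basisMonomials σ ℚ).constr ℚ fun α => ((α.prod fun _ k => (k.factorial : ℚ)) • lcoeff ℚ α)

theorem fischer_monomial (α : σ →₀ ℕ) (q : MvPolynomial σ ℚ) :
    fischer (monomial α 1) q = (α.prod fun _ k => (k.factorial : ℚ)) * coeff α q := by
  have := (basisMonomials σ ℚ).constr_basis ℚ
    (fun α => ((α.prod fun _ k => (k.factorial : ℚ)) • lcoeff ℚ α)) α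
  rw [coe_basisMonomials] at this
  exact LinearMap.congr_fun this q

theorem fischer_eq_sum (p q : MvPolynomial σ ℚ) : fischer p q
    = ∑ α ∈ p.support, coeff α p * ((α.prod fun _ k => (k.factorial : ℚ)) * coeff α q) := by
  conv_lhs => rw [← support_sum_monomial_coeff p]
  rw [map_sum, LinearMap.sum_apply]
  refine Finset.sum_congr rfl fun α _ => ?_
  rw [← mul_one (coeff α p), ← smul_eq_mul, ← smul_monomial, map_smul, LinearMap.smul_apply,
    fischer_monomial, smul_eq_mul, smul_eq_mul, mul_one]

theorem prod_factorial_pos (α : σ →₀ ℕ) : 0 < α.prod fun _ k => (k.factorial : ℚ) :=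
  Finset.prod_pos fun _ _ => by positivity

theorem fischer_pos (p : MvPolynomial σ ℚ) (hp : p ≠ 0) : 0 < fischer p p := by
  rw [fischer_eq_sum]
  refine Finset.sum_pos (fun α hα => ?_) (support_nonempty.2 hp)
  rw [mul_left_comm]
  exact mul_pos (prod_factorial_pos α) (mul_self_pos.2 (mem_support_iff.1 hα))

theorem fischer_comm (p q : MvPolynomial σ ℚ) : fischer p q = fischer q p := by
  have : (fischer : MvPolynomial σ ℚ →ₗ[ℚ] _) = fischer.flip := by
    refine (basisMonomials σ ℚ).ext fun α => (basisMonomials σ ℚ).ext fun β => ?_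
    classical
    rw [LinearMap.flip_apply, coe_basisMonomials, fischer_monomial, fischer_monomial,
      coeff_monomial, coeff_monomial]
    by_cases h : α = β
    · rw [h]
    · rw [if_neg h, if_neg (Ne.symm h), mul_zero, mul_zero]
  exact LinearMap.congr_fun (LinearMap.congr_fun this p) q

theorem prod_factorial_add_single (α : σ →₀ ℕ) (i : σ) :
    ((α + Finsupp.single i 1).prod fun _ k => (k.factorial : ℚ))
      = (α i + 1) * α.prod fun _ k => (k.factorial : ℚ) := by
  classical
  have h1 : ∀ β : σ →₀ ℕ, β.support ⊆ insert i α.support →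
      β.prod (fun _ k => (k.factorial : ℚ))
        = (β i).factorial * ∏ j ∈ (insert i α.support).erase i, ((β j).factorial : ℚ) := by
    intro β hβ
    rw [Finsupp.prod_of_support_subset β hβ _ (by simp),
      ← Finset.mul_prod_erase _ _ (Finset.mem_insert_self i α.support)]
  have h2 : (α + Finsupp.single i 1).support ⊆ insert i α.support := fun j hj => by
    by_contra hji
    rw [Finset.mem_insert, not_or, Finsupp.notMem_support_iff] at hji
    rw [Finsupp.mem_support_iff, Finsupp.add_apply, hji.2, Finsupp.single_apply,
      if_neg (Ne.symm hji.1)] at hj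
    exact hj rfl
  rw [h1 _ h2, h1 _ (Finset.subset_insert _ _), ← mul_assoc]
  congr 1
  · simp [Nat.factorial_succ]
  · refine Finset.prod_congr rfl fun j hj => ?_
    rw [Finsupp.add_apply, Finsupp.single_apply, if_neg (Finset.ne_of_mem_erase hj).symm, add_zero]

theorem fischer_X_mul (i : σ) (p q : MvPolynomial σ ℚ) :
    fischer (X i * p) q = fischer p (pderiv i q) := by
  have : fischer ∘ₗ LinearMap.mulLeft ℚ (X i) = fischer.compl₂ (pderiv (R := ℚ) i).toLinearMap := by
    refine (basisMonomials σ ℚ).ext fun α => LinearMap.ext fun q => ?_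
    rw [coe_basisMonomials]
    have h : X i * monomial α 1 = monomial (α + Finsupp.single i 1) (1 : ℚ) := by
      rw [X, monomial_mul, add_comm, mul_one]
    rw [LinearMap.comp_apply, LinearMap.mulLeft_apply, h, LinearMap.compl₂_apply, fischer_monomial,
      fischer_monomial, prod_factorial_add_single]
    erw [coeff_pderiv]
    ring
  exact LinearMap.congr_fun (LinearMap.congr_fun this p) q

variable {R : Type*} [CommRing R]

theorem coeff_X_mul_pderiv (i j : σ) (v : MvPolynomial σ R) (γ : σ →₀ ℕ) :
    coeff (γ + Finsupp.single i 1) (X i * pderiv j v)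
      = coeff (γ + Finsupp.single j 1) v * (γ j + 1) := by
  rw [add_comm γ (Finsupp.single i 1), coeff_X_mul, coeff_pderiv]

theorem exists_of_coeff_X_mul_pderiv {i j : σ} {v : MvPolynomial σ R} {β : σ →₀ ℕ}
    (h : coeff β (X i * pderiv j v) ≠ 0) :
    ∃ γ : σ →₀ ℕ, β = γ + Finsupp.single i 1 ∧ coeff (γ + Finsupp.single j 1) v ≠ 0 := by
  classical
  rw [coeff_X_mul'] at h
  split_ifs at h with hi
  · refine ⟨β - Finsupp.single i 1, (tsub_add_cancel_of_le ?_).symm, ?_⟩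
    · rw [Finsupp.single_le_iff]
      exact Nat.one_le_iff_ne_zero.2 (Finsupp.mem_support_iff.1 hi)
    · rw [coeff_pderiv] at h
      exact left_ne_zero_of_mul h
  · exact (h rfl).elim

theorem coeff_X_mul_pderiv_self (i : σ) (v : MvPolynomial σ R) (β : σ →₀ ℕ) :
    coeff β (X i * pderiv i v) = β i * coeff β v := by
  by_cases h : β i = 0
  · rw [h, Nat.cast_zero, zero_mul]
    by_contra h'
    obtain ⟨γ, rfl, _⟩ := exists_of_coeff_X_mul_pderiv h'
    simp at h
  · obtain ⟨γ, rfl⟩ : ∃ γ, β = γ + Finsupp.single i 1 :=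
      ⟨β - Finsupp.single i 1, (tsub_add_cancel_of_le (by
        rw [Finsupp.single_le_iff]; exact Nat.one_le_iff_ne_zero.2 h)).symm⟩
    rw [coeff_X_mul_pderiv, mul_comm]
    simp

end Weyl

section Skew

variable {L : ℕ}

/-- The derivation dual to an entry of the generic skew matrix. -/
noncomputable def dx (A B : Fin L) : Derivation ℚ (MvPolynomial (Prs L) ℚ) (MvPolynomial (Prs L) ℚ) :=
  if h : A < B then pderiv ⟨(A, B), h⟩ else if h : B < A then - pderiv ⟨(B, A), h⟩ else 0

/-- The derivation giving the action of an elementary matrix. -/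
noncomputable def glE (A B : Fin L) :
    Derivation ℚ (MvPolynomial (Prs L) ℚ) (MvPolynomial (Prs L) ℚ) := ∑ D, gX L ℚ A D • dx B D

/-- The Kronecker delta. -/
def dlt (A B : Fin L) : ℚ := if A = B then 1 else 0

theorem dlt_comm (A B : Fin L) : dlt A B = dlt B A := by simp only [dlt, eq_comm]

theorem dx_gX (A B C D : Fin L) :
    dx A B (gX L ℚ C D) = MvPolynomial.C (dlt A C * dlt B D - dlt A D * dlt B C) := by
  classical
  unfold dx gX dlt
  split_ifs <;> simp_all [pderiv_X] <;> grind

end Skew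

section Skew

variable {L : ℕ}

theorem dx_self (A : Fin L) : dx A A = 0 := by simp [dx]

theorem derivation_eq_of_gX
    {D₁ D₂ : Derivation ℚ (MvPolynomial (Prs L) ℚ) (MvPolynomial (Prs L) ℚ)}
    (h : ∀ C D, D₁ (gX L ℚ C D) = D₂ (gX L ℚ C D)) : D₁ = D₂ :=
  derivation_ext fun p => by
    have := h p.1.1 p.1.2
    rwa [gX_of_lt p.2] at this

theorem glE_apply (A B : Fin L) (p : MvPolynomial (Prs L) ℚ) :
    glE A B p = ∑ D, gX L ℚ A D * dx B D p := by
  have := congrArg (fun f => f p) (map_sum (Derivation.coeFnAddMonoidHom (R := ℚ)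
    (A := MvPolynomial (Prs L) ℚ) (M := MvPolynomial (Prs L) ℚ))
    (fun D => gX L ℚ A D • dx B D) Finset.univ)
  refine this.trans ?_
  rw [Finset.sum_apply]
  rfl

theorem glE_gX (A B C D : Fin L) : glE A B (gX L ℚ C D)
    = MvPolynomial.C (dlt B C) * gX L ℚ A D - MvPolynomial.C (dlt B D) * gX L ℚ A C := by
  rw [glE_apply]
  simp only [dx_gX, map_sub, map_mul, mul_sub, Finset.sum_sub_distrib]
  congr 1
  · rw [Finset.sum_eq_single D]
    · simp [dlt, mul_comm]
    · intro F _ h; simp [dlt, h]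
    · simp
  · rw [Finset.sum_eq_single C]
    · simp [dlt, mul_comm]
    · intro F _ h; simp [dlt, h]
    · simp

theorem derivation_C_mul (D : Derivation ℚ (MvPolynomial (Prs L) ℚ) (MvPolynomial (Prs L) ℚ))
    (c : ℚ) (p : MvPolynomial (Prs L) ℚ) : D (C c * p) = C c * D p := by
  rw [C_mul', Derivation.map_smul, C_mul']

theorem commutator_glE (A B C D : Fin L) : ⁅glE A B, glE C D⁆
    = dlt B C • glE A D - dlt D A • glE C B := by
  refine derivation_eq_of_gX fun F G => ?_
  rw [Derivation.commutator_apply, Derivation.sub_apply, Derivation.smul_apply,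
    Derivation.smul_apply]
  simp only [glE_gX, map_sub, derivation_C_mul, smul_eq_C_mul]
  rw [dlt_comm D A, gX_skew C A]
  ring

theorem commutator_glE_dx (A B C D : Fin L) : ⁅glE A B, dx C D⁆
    = - (dlt A C • dx B D + dlt A D • dx C B) := by
  refine derivation_eq_of_gX fun F G => ?_
  rw [Derivation.commutator_apply, Derivation.neg_apply, Derivation.add_apply,
    Derivation.smul_apply, Derivation.smul_apply]
  have h : ∀ (D' : Derivation ℚ (MvPolynomial (Prs L) ℚ) (MvPolynomial (Prs L) ℚ)) (c : ℚ),
    D' (MvPolynomial.C c) = 0 := fun D' c => D'.map_algebraMap c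
  rw [dx_gX, h, glE_gX, map_sub, derivation_C_mul, derivation_C_mul, dx_gX, dx_gX, dx_gX, dx_gX,
    smul_eq_C_mul, smul_eq_C_mul, dlt_comm C A, dlt_comm D A]
  simp only [map_sub, map_mul]
  ring

theorem commutator_dx (A B C D : Fin L) : ⁅dx A B, dx C D⁆ = 0 := by
  refine derivation_eq_of_gX fun F G => ?_
  have h : ∀ (D' : Derivation ℚ (MvPolynomial (Prs L) ℚ) (MvPolynomial (Prs L) ℚ)) (c : ℚ),
    D' (MvPolynomial.C c) = 0 := fun D' c => D'.map_algebraMap c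
  rw [Derivation.commutator_apply, dx_gX, dx_gX, h, h, sub_zero, Derivation.zero_apply]

theorem fischer_gX_mul (A B : Fin L) (p q : MvPolynomial (Prs L) ℚ) :
    fischer (gX L ℚ A B * p) q = fischer p (dx A B q) := by
  unfold gX dx
  split_ifs
  · exact fischer_X_mul _ _ _
  · rw [neg_mul, map_neg, LinearMap.neg_apply, fischer_X_mul, Derivation.neg_apply, map_neg]
  · simp

theorem fischer_glE (A B : Fin L) (p q : MvPolynomial (Prs L) ℚ) :
    fischer (glE A B p) q = fischer p (glE B A q) := by
  rw [fischer_comm p, glE_apply, glE_apply, map_sum, map_sum, LinearMap.sum_apply,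
    LinearMap.sum_apply]
  exact Finset.sum_congr rfl fun D _ => by rw [fischer_gX_mul, fischer_gX_mul, fischer_comm]

/-- The unordered pair of two distinct indices. -/
def upr (A B : Fin L) (h : A ≠ B) : Prs L := ⟨(min A B, max A B), min_lt_max.2 h⟩

theorem gX_mul_dx_apply {A B C D : Fin L} (h : A ≠ B) (h' : C ≠ D) : ∃ s : ℚ, s ≠ 0 ∧
    ∀ p, gX L ℚ A B * dx C D p = s • (X (upr A B h) * pderiv (upr C D h') p) := by
  rcases lt_or_gt_of_ne h with h1 | h1 <;> rcases lt_or_gt_of_ne h' with h2 | h2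
  · exact ⟨1, by simp, fun p => by
      simp [gX, dx, upr, h1, h2, h1.le, h2.le]⟩
  · exact ⟨-1, by simp, fun p => by
      simp [gX, dx, upr, h1, h2, h2.not_gt, h1.le, h2.le]⟩
  · exact ⟨-1, by simp, fun p => by
      simp [gX, dx, upr, h1, h2, h1.not_gt, h1.le, h2.le]⟩
  · exact ⟨1, by simp, fun p => by
      simp [gX, dx, upr, h1, h2, h1.not_gt, h2.not_gt, h1.le, h2.le]⟩

theorem gX_mul_dx_self {A B : Fin L} (h : A ≠ B) (p : MvPolynomial (Prs L) ℚ) :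
    gX L ℚ A B * dx A B p = X (upr A B h) * pderiv (upr A B h) p := by
  rcases lt_or_gt_of_ne h with h1 | h1
  · simp [gX, dx, upr, h1, h1.le]
  · simp [gX, dx, upr, h1, h1.not_gt, h1.le]

theorem exists_of_coeff_gX_mul_dx {A B D : Fin L} {v : MvPolynomial (Prs L) ℚ} {β : Prs L →₀ ℕ}
    (h : coeff β (gX L ℚ A D * dx B D v) ≠ 0) :
    ∃ (hA : A ≠ D) (hB : B ≠ D) (γ : Prs L →₀ ℕ), β = γ + Finsupp.single (upr A D hA) 1 ∧
      coeff (γ + Finsupp.single (upr B D hB) 1) v ≠ 0 := by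
  have hA : A ≠ D := by
    rintro rfl
    simp [gX_self] at h
  have hB : B ≠ D := by
    rintro rfl
    simp [dx_self] at h
  obtain ⟨s, hs, hs'⟩ := gX_mul_dx_apply hA hB
  rw [hs', coeff_smul, smul_eq_mul] at h
  obtain ⟨γ, h1, h2⟩ := exists_of_coeff_X_mul_pderiv (right_ne_zero_of_mul h)
  exact ⟨hA, hB, γ, h1, h2⟩

/-- The weight of a monomial. -/
def mwt (β : Prs L →₀ ℕ) (A : Fin L) : ℚ :=
  ∑ D, if h : A ≠ D then (β (upr A D h) : ℚ) else 0

theorem coeff_glE_self (β : Prs L →₀ ℕ) (A : Fin L) (p : MvPolynomial (Prs L) ℚ) :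
    coeff β (glE A A p) = mwt β A * coeff β p := by
  rw [glE_apply, coeff_sum, mwt, Finset.sum_mul]
  refine Finset.sum_congr rfl fun D _ => ?_
  split_ifs with h
  · rw [gX_mul_dx_self h, coeff_X_mul_pderiv_self]
  · rw [not_not.1 h]; simp [gX_self]

theorem upr_comm {A B : Fin L} (h : A ≠ B) : upr A B h = upr B A h.symm := by
  simp [upr, min_comm, max_comm]

end Skew

section Pairing

variable {L : ℕ}

/-- Two indices are partners with respect to an ordering. -/
def Partner (e : Equiv.Perm (Fin L)) (P : Prs L) : Prop :=
  (e.symm P.1.1).val / 2 = (e.symm P.1.2).val / 2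

instance (e : Equiv.Perm (Fin L)) (P : Prs L) : Decidable (Partner e P) := by
  unfold Partner; infer_instance

theorem partner_upr (e : Equiv.Perm (Fin L)) {p q : Fin L} (h : e p ≠ e q) :
    Partner e (upr (e p) (e q) h) ↔ p.val / 2 = q.val / 2 := by
  rcases lt_or_gt_of_ne h with h1 | h1
  · simp [Partner, upr, h1.le]
  · simp [Partner, upr, h1.le, eq_comm]

/-- The total exponent of the variables indexed by partners. -/
def spDeg (e : Equiv.Perm (Fin L)) (α : Prs L →₀ ℕ) : ℕ := ∑ P, if Partner e P then α P else 0

theorem spDeg_add_single (e : Equiv.Perm (Fin L)) (α : Prs L →₀ ℕ) (P : Prs L) :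
    spDeg e (α + Finsupp.single P 1) = spDeg e α + if Partner e P then 1 else 0 := by
  have : ∀ Q, (if Partner e Q then (α + Finsupp.single P 1 : Prs L →₀ ℕ) Q else 0)
      = (if Partner e Q then α Q else 0) + if P = Q then (if Partner e P then 1 else 0) else 0 := by
    intro Q
    rw [Finsupp.add_apply, Finsupp.single_apply]
    by_cases h : P = Q
    · subst h; split_ifs <;> simp
    · rw [if_neg h, if_neg h]; simp
  simp only [spDeg, this, Finset.sum_add_distrib, Finset.sum_ite_eq, Finset.mem_univ, if_true]

theorem eq_zero_of_maximal {e : Equiv.Perm (Fin L)} {v : MvPolynomial (Prs L) ℚ}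
    (hv : ∀ p q, p < q → glE (e p) (e q) v = 0) {α : Prs L →₀ ℕ} (hα : coeff α v ≠ 0)
    (hmax : ∀ α', coeff α' v ≠ 0 → spDeg e α' ≤ spDeg e α) {p q : Fin L} (hpq : p < q)
    (hbad : p.val / 2 ≠ q.val / 2) : α (upr (e p) (e q) (e.injective.ne hpq.ne)) = 0 := by
  by_contra hne
  obtain ⟨p', hp', hp2, hp'q⟩ : ∃ p' : Fin L, p' ≠ p ∧ p'.val / 2 = p.val / 2 ∧ p' < q := by
    rcases Nat.even_or_odd' p.val with ⟨c, hc | hc⟩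
    · refine ⟨⟨p.val + 1, by have := q.2; omega⟩, ?_, ?_, ?_⟩
      · intro h; have := congrArg Fin.val h; simp at this
      · simp; omega
      · rw [Fin.lt_def] at hpq ⊢; simp; omega
    · refine ⟨⟨p.val - 1, by have := p.2; omega⟩, ?_, ?_, ?_⟩
      · intro h; have := congrArg Fin.val h; simp at this; omega
      · simp; omega
      · rw [Fin.lt_def] at hpq ⊢; simp; omega
  have hqp : e q ≠ e p := e.injective.ne hpq.ne'
  have hp'p : e p' ≠ e p := e.injective.ne hp'
  obtain ⟨γ, hγ⟩ : ∃ γ, α = γ + Finsupp.single (upr (e q) (e p) hqp) 1 :=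
    ⟨α - Finsupp.single _ 1, (tsub_add_cancel_of_le (by
      rw [Finsupp.single_le_iff, upr_comm]; exact Nat.one_le_iff_ne_zero.2 hne)).symm⟩
  have h0 := congrArg (coeff (γ + Finsupp.single (upr (e p') (e p) hp'p) 1)) (hv p' q hp'q)
  rw [glE_apply, coeff_sum, coeff_zero, Finset.sum_eq_single (e p)] at h0
  · obtain ⟨s, hs, hs'⟩ := gX_mul_dx_apply hp'p hqp
    rw [hs', coeff_smul, smul_eq_mul, coeff_X_mul_pderiv, ← hγ] at h0
    exact mul_ne_zero hs (mul_ne_zero hα (by positivity)) h0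
  · intro D _ hD
    by_contra hne'
    obtain ⟨r, rfl⟩ := e.surjective D
    obtain ⟨h1, h2, γ', h3, h4⟩ := exists_of_coeff_gX_mul_dx hne'
    have h5 := congrArg (spDeg e) h3
    have h6 := hmax _ h4
    have hr : ¬ p'.val / 2 = r.val / 2 := by
      intro h
      have a1 : r ≠ p := fun h => hD (h ▸ rfl)
      have a2 : p' ≠ r := fun h => h1 (h ▸ rfl)
      rw [ne_eq, Fin.ext_iff] at a1 a2 hp'
      omega
    rw [spDeg_add_single, spDeg_add_single, if_pos ((partner_upr e hp'p).2 hp2),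
      if_neg (mt (partner_upr e h1).1 hr)] at h5
    rw [hγ, spDeg_add_single, spDeg_add_single,
      if_neg (mt (partner_upr e hqp).1 (Ne.symm hbad))] at h6
    omega
  · simp

theorem exists_maximal (e : Equiv.Perm (Fin L)) {v : MvPolynomial (Prs L) ℚ} (hv : v ≠ 0) :
    ∃ α, coeff α v ≠ 0 ∧ ∀ α', coeff α' v ≠ 0 → spDeg e α' ≤ spDeg e α := by
  obtain ⟨α, h1, h2⟩ := Finset.exists_max_image v.support (spDeg e) (support_nonempty.2 hv)
  exact ⟨α, mem_support_iff.1 h1, fun α' h => h2 α' (mem_support_iff.2 h)⟩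

theorem pairing_glE (e : Equiv.Perm (Fin L)) (v : MvPolynomial (Prs L) ℚ) (lam : Fin L → ℚ)
    (hv : v ≠ 0) (h1 : ∀ p q, p < q → glE (e p) (e q) v = 0)
    (h2 : ∀ p, glE (e p) (e p) v = lam p • v) (p q : Fin L) (hp : Even p.val)
    (hq : q.val = p.val + 1) : lam p = lam q := by
  obtain ⟨α, hα, hmax⟩ := exists_maximal e hv
  have hpq : p ≠ q := fun h => by rw [h] at hq; omega
  have key : ∀ r s : Fin L, (hrs : r ≠ s) → r.val / 2 = s.val / 2 →
      lam r = α (upr (e r) (e s) (e.injective.ne hrs)) := by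
    intro r s hrs hd
    have := congrArg (coeff α) (h2 r)
    rw [coeff_glE_self, coeff_smul, smul_eq_mul] at this
    rw [← mul_right_cancel₀ hα this, mwt, Finset.sum_eq_single (e s)]
    · rw [dif_pos]
    · intro D _ hD
      split_ifs with h
      · obtain ⟨t, rfl⟩ := e.surjective D
        have hb : r.val / 2 ≠ t.val / 2 := by
          intro h'
          have a1 : r ≠ t := fun h' => h (h' ▸ rfl)
          have a2 : t ≠ s := fun h' => hD (h' ▸ rfl)
          rw [ne_eq, Fin.ext_iff] at a1 a2 hrs
          omega
        have hrt : r ≠ t := fun h' => h (h' ▸ rfl)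
        rcases lt_or_gt_of_ne hrt with h' | h'
        · rw [eq_zero_of_maximal h1 hα hmax h' hb, Nat.cast_zero]
        · rw [upr_comm, eq_zero_of_maximal h1 hα hmax h' hb.symm, Nat.cast_zero]
      · rfl
    · simp
  obtain ⟨c, hc⟩ := hp
  rw [key p q hpq (by omega), key q p hpq.symm (by omega), upr_comm]

end Pairing

section Instance

variable {N : ℕ}

theorem glE_mem {L : ℕ} (D : ℕ) (A B : Fin L) (p : MvPolynomial (Prs L) ℚ)
    (hp : p ∈ restrictTotalDegree (Prs L) ℚ D) : glE A B p ∈ restrictTotalDegree (Prs L) ℚ D := by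
  have h : ∀ q : MvPolynomial (Prs L) ℚ, q ∈ restrictTotalDegree (Prs L) ℚ D ↔
      ∀ α, coeff α q ≠ 0 → (α.sum fun _ k => k) ≤ D := fun q => by
    rw [restrictTotalDegree, mem_restrictSupport_iff]
    exact ⟨fun h α hα => h (mem_support_iff.2 hα), fun h α hα => h α (mem_support_iff.1 hα)⟩
  rw [h] at hp ⊢
  intro β hβ
  rw [glE_apply, coeff_sum] at hβ
  obtain ⟨F, _, hF⟩ := Finset.exists_ne_zero_of_sum_ne_zero hβ
  obtain ⟨_, _, γ, h1, h2⟩ := exists_of_coeff_gX_mul_dx hF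
  have := hp _ h2
  have e : ∀ (γ : Prs L →₀ ℕ) P, ((γ + Finsupp.single P 1).sum fun _ k => k)
      = (γ.sum fun _ k => k) + 1 := fun γ P => by
    rw [Finsupp.sum_add_index' (fun _ => rfl) (fun _ _ _ => rfl), Finsupp.sum_single_index rfl]
  rw [h1, e]
  rwa [e] at this

theorem toLinearMap_commutator {L : ℕ}
    (D₁ D₂ : Derivation ℚ (MvPolynomial (Prs L) ℚ) (MvPolynomial (Prs L) ℚ)) :
    (D₁.toLinearMap * D₂.toLinearMap - D₂.toLinearMap * D₁.toLinearMap :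
      Module.End ℚ (MvPolynomial (Prs L) ℚ))
      = (⁅D₁, D₂⁆ : Derivation ℚ (MvPolynomial (Prs L) ℚ) (MvPolynomial (Prs L) ℚ)).toLinearMap := by
  refine LinearMap.ext fun x => ?_
  exact (Derivation.commutator_apply (D1 := D₁) (D2 := D₂) (a := x)).symm

theorem sum_dx_glE (p : MvPolynomial (Prs (N + 1)) ℚ) :
    ∑ k : Fin N, dx 0 k.succ (glE k.succ 0 p) = 0 := by
  have h1 : ∀ k : Fin N, dx 0 k.succ (glE k.succ 0 p)
      = ∑ D, gX (N + 1) ℚ k.succ D * dx 0 D (dx 0 k.succ p) := fun k => by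
    have h := congrArg (fun D : Derivation ℚ _ _ => D p) (commutator_glE_dx k.succ 0 0 k.succ)
    simp only [Derivation.commutator_apply] at h
    have h2 : (-(dlt k.succ 0 • dx 0 k.succ + dlt k.succ k.succ • dx 0 0) :
        Derivation ℚ (MvPolynomial (Prs (N + 1)) ℚ) (MvPolynomial (Prs (N + 1)) ℚ)) p = 0 := by
      rw [dx_self, dlt, if_neg (Fin.succ_ne_zero k)]
      simp
    rw [← glE_apply]
    exact (sub_eq_zero.1 (h.trans h2)).symm
  have h2 : ∑ k : Fin N, dx 0 k.succ (glE k.succ 0 p)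
      = ∑ A : Fin (N + 1), ∑ D, gX (N + 1) ℚ A D * dx 0 D (dx 0 A p) := by
    rw [Fin.sum_univ_succ (f := fun A => ∑ D, gX (N + 1) ℚ A D * dx 0 D (dx 0 A p)), dx_self]
    simp [h1]
  have h3 : ∀ A D : Fin (N + 1), dx 0 D (dx 0 A p) = dx 0 A (dx 0 D p) := fun A D => by
    have h := congrArg (fun D : Derivation ℚ _ _ => D p) (commutator_dx 0 D 0 A)
    exact sub_eq_zero.1 ((Derivation.commutator_apply (D1 := dx 0 D) (D2 := dx 0 A) (a := p)).symm.trans h)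
  have h4 : ∑ A : Fin (N + 1), ∑ D, gX (N + 1) ℚ A D * dx 0 D (dx 0 A p)
      = - ∑ A : Fin (N + 1), ∑ D, gX (N + 1) ℚ A D * dx 0 D (dx 0 A p) := by
    conv_lhs => rw [Finset.sum_comm]
    rw [← Finset.sum_neg_distrib]
    refine Finset.sum_congr rfl fun A _ => ?_
    rw [← Finset.sum_neg_distrib]
    exact Finset.sum_congr rfl fun D _ => by rw [gX_skew D A, h3 D A, neg_mul]
  have : IsAddTorsionFree (MvPolynomial (Prs (N + 1)) ℚ) := .of_module_rat _
  rw [h2]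
  exact self_eq_neg.1 h4

/-- Polynomials in the entries of a skew matrix. -/
noncomputable def symRep (N : ℕ) : PRep N (MvPolynomial (Prs (N + 1)) ℚ) where
  ip := fischer
  ip_comm := fischer_comm
  ip_pos := fischer_pos
  E A B := (glE A B).toLinearMap
  E_comm A B C D := by
    rw [toLinearMap_commutator, commutator_glE]
    refine LinearMap.ext fun p => ?_
    simp only [dlt]
    split_ifs <;> simp
  adj := fischer_glE
  Fil D := restrictTotalDegree (Prs (N + 1)) ℚ D
  fil_mono D D' h := restrictSupport_mono ℚ fun α hα => le_trans hα h
  fil_exists p := ⟨p.totalDegree, (mem_restrictTotalDegree _ _ _).2 le_rfl⟩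
  fil_fd D := by
    infer_instance
  fil_E := glE_mem
  B := Prs (N + 1) →₀ ℕ
  co β := lcoeff ℚ β
  co_ext p h := MvPolynomial.ext _ _ fun β => h β
  co_fin p := p.support.finite_toSet.subset fun β h => mem_support_iff.2 h
  wt := mwt
  co_E := coeff_glE_self
  T j := (dx 0 j.succ).toLinearMap
  tm j := LinearMap.mulLeft ℚ (gX (N + 1) ℚ 0 j.succ)
  T_comm i j := by
    rw [← sub_eq_zero, toLinearMap_commutator, commutator_dx]; rfl
  E_T_zero k j := by
    rw [toLinearMap_commutator, commutator_glE_dx, dx_self, dlt, if_neg (Fin.succ_ne_zero k)]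
    refine LinearMap.ext fun p => ?_
    simp
  sum_T_E := LinearMap.ext fun p => by
    rw [LinearMap.sum_apply]
    exact sum_dx_glE p
  E_T_succ i j k := by
    rw [toLinearMap_commutator, commutator_glE_dx, dlt, dlt, if_neg (Fin.succ_ne_zero i)]
    refine LinearMap.ext fun p => ?_
    simp only [Fin.succ_inj]
    split_ifs <;> simp
  E_zero_T j := by
    rw [toLinearMap_commutator, commutator_glE_dx, dlt, dlt, if_neg (Fin.succ_ne_zero j).symm]
    refine LinearMap.ext fun p => ?_
    simp
  E_zero_tm j := LinearMap.ext fun p => by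
    simp [glE_gX, dlt, (Fin.succ_ne_zero j).symm, gX_self, mul_comm]
  T_tm j l := LinearMap.ext fun p => by
    simp [dx_gX, dlt, (Fin.succ_ne_zero j), (Fin.succ_ne_zero l).symm]
    split_ifs <;> simp
  sum_tm_T := LinearMap.ext fun p => by
    simp [glE_apply, Fin.sum_univ_succ (n := N), gX_self]
  tm_adj j p q := fischer_gX_mul _ _ _ _
  pairing e v lam := pairing_glE e v lam

end Instance

section FockMap

variable {ι M M' : Type*} [AddCommGroup M] [AddCommGroup M']

/-- Apply an additive map to all components. -/
def Fock.map (φ : M →+ M') : Fock ι M →+ Fock ι M' where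
  toFun z I := φ (z I)
  map_zero' := Fock.ext fun _ => map_zero φ
  map_add' _ _ := Fock.ext fun _ => map_add φ _ _

theorem Fock.map_apply (φ : M →+ M') (z : Fock ι M) (I) : Fock.map φ z I = φ (z I) := rfl

variable [LinearOrder ι]

theorem Fock.map_cr (R R' : Type*) [CommRing R] [CommRing R'] [Module R M] [Module R' M']
    (φ : M →+ M') (j : ι) (z : Fock ι M) : Fock.map φ (cr R j z) = cr R' j (Fock.map φ z) := by
  ext I
  rw [Fock.map_apply, cr_apply, cr_apply]
  split_ifs
  · exact map_zsmul φ _ _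
  · exact map_zero φ

theorem Fock.map_an (R R' : Type*) [CommRing R] [CommRing R'] [Module R M] [Module R' M']
    (φ : M →+ M') (j : ι) (z : Fock ι M) : Fock.map φ (an R j z) = an R' j (Fock.map φ z) := by
  ext I
  rw [Fock.map_apply, an_apply, an_apply]
  split_ifs
  · exact map_zero φ
  · exact map_zsmul φ _ _

end FockMap

section Transpose

variable {N : ℕ} {R : Type*} [CommRing R]

/-- The transposed differential. -/
def difT (X : Fin N → Fin N → R) : Module.End R (Cx N R) :=
  ∑ j, lft (mS j) * (an R j + ∑ k, X k j • cr R k)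

theorem difT_apply (X : Fin N → Fin N → R) (z : Cx N R) :
    difT X z = ∑ j, (lft (mS j) (an R j z) + ∑ k, X k j • lft (mS j) (cr R k z)) := by
  simp only [difT, LinearMap.sum_apply, Module.End.mul_apply, LinearMap.add_apply, map_add,
    map_sum, LinearMap.smul_apply, map_smul]

end Transpose

section Bridge

variable {N : ℕ}

/-- Split the entries of a skew matrix into those of the first row and the others. -/
noncomputable def prsEquiv (N : ℕ) : Fin N ⊕ Prs N ≃ Prs (N + 1) :=
  Equiv.ofBijective (Sum.elim (fun j => ⟨(0, j.succ), Fin.succ_pos j⟩)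
    fun p => ⟨(p.1.1.succ, p.1.2.succ), Fin.succ_lt_succ_iff.2 p.2⟩) <| by
    constructor
    · rintro (i | ⟨⟨i, j⟩, h⟩) (k | ⟨⟨k, l⟩, h'⟩) e <;> simp at e ⊢
      · exact e
      · exact absurd e.1.symm (Fin.succ_ne_zero _)
      · exact e
    · rintro ⟨⟨a, b⟩, h⟩
      have hb : b ≠ 0 := fun hb => by rw [hb] at h; exact absurd h (Fin.not_lt_zero a)
      obtain ⟨j, rfl⟩ := Fin.exists_succ_eq.2 hb
      rcases Fin.eq_zero_or_eq_succ a with rfl | ⟨i, rfl⟩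
      · exact ⟨Sum.inl j, rfl⟩
      · exact ⟨Sum.inr ⟨(i, j), Fin.succ_lt_succ_iff.1 h⟩, rfl⟩

/-- Polynomials in the entries as polynomials in the first row. -/
noncomputable def rowEquiv (N : ℕ) : MvPolynomial (Prs (N + 1)) ℚ ≃ₐ[ℚ]
    MvPolynomial (Fin N) (MvPolynomial (Prs N) ℚ) :=
  (renameEquiv ℚ (prsEquiv N).symm).trans (sumAlgEquiv ℚ (Fin N) (Prs N))

theorem rowEquiv_X_inl (j : Fin N) : rowEquiv N (X ((prsEquiv N) (Sum.inl j))) = X j := by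
  rw [rowEquiv, AlgEquiv.trans_apply, renameEquiv_apply, rename_X, Equiv.symm_apply_apply,
    sumAlgEquiv_X_inl]

theorem rowEquiv_X_inr (p : Prs N) :
    rowEquiv N (X ((prsEquiv N) (Sum.inr p))) = MvPolynomial.C (X p) := by
  rw [rowEquiv, AlgEquiv.trans_apply, renameEquiv_apply, rename_X, Equiv.symm_apply_apply,
    sumAlgEquiv_X_inr]

theorem rowEquiv_gX_zero (j : Fin N) : rowEquiv N (gX (N + 1) ℚ 0 j.succ) = X j := by
  rw [gX_of_lt (Fin.succ_pos j)]
  exact rowEquiv_X_inl j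

theorem rowEquiv_gX_succ (i j : Fin N) :
    rowEquiv N (gX (N + 1) ℚ i.succ j.succ) = MvPolynomial.C (gX N ℚ i j) := by
  have key : ∀ i j : Fin N, i < j →
      rowEquiv N (gX (N + 1) ℚ i.succ j.succ) = MvPolynomial.C (gX N ℚ i j) := fun i j h => by
    rw [gX_of_lt (Fin.succ_lt_succ_iff.2 h), gX_of_lt h]
    exact rowEquiv_X_inr ⟨(i, j), h⟩
  rcases lt_trichotomy i j with h | rfl | h
  · exact key i j h
  · simp [gX_self]
  · rw [gX_skew, map_neg, key j i h, gX_skew i j, map_neg]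

theorem rowEquiv_dx (j : Fin N) (p : MvPolynomial (Prs (N + 1)) ℚ) :
    rowEquiv N (dx 0 j.succ p) = pderiv j (rowEquiv N p) := by
  have hdx : dx 0 j.succ = pderiv (R := ℚ) (prsEquiv N (Sum.inl j)) := by
    rw [dx, dif_pos (Fin.succ_pos j)]; rfl
  rw [hdx]
  induction p using MvPolynomial.induction_on with
  | C a =>
    have : rowEquiv N (MvPolynomial.C a) = MvPolynomial.C (MvPolynomial.C a) :=
      (rowEquiv N).commutes a
    rw [pderiv_C, map_zero, this, pderiv_C]
  | add p q hp hq => simp only [map_add, hp, hq]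
  | mul_X p s hp =>
    classical
    rw [pderiv_mul, map_add, map_mul, map_mul, map_mul, pderiv_mul, hp]
    congr 2
    obtain ⟨s, rfl⟩ := (prsEquiv N).surjective s
    rcases s with k | q
    · rw [rowEquiv_X_inl, pderiv_X, pderiv_X, Pi.single_apply, Pi.single_apply]
      simp only [(prsEquiv N).injective.eq_iff, Sum.inl.injEq]
      split_ifs <;> simp
    · rw [rowEquiv_X_inr, pderiv_C, pderiv_X_of_ne, map_zero]
      simp

/-- The exponent vector of a function. -/
noncomputable abbrev fsp (τ : Fin N → ℕ) : Fin N →₀ ℕ := Finsupp.equivFunOnFinite.symm τ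

/-- The factorial of an exponent vector. -/
def mfac (τ : Fin N → ℕ) : ℚ := ∏ i, ((τ i).factorial : ℚ)

theorem mfac_ne_zero (τ : Fin N → ℕ) : mfac τ ≠ 0 :=
  Finset.prod_ne_zero_iff.2 fun i _ => by positivity

theorem mfac_add_single (τ : Fin N → ℕ) (j : Fin N) :
    mfac (τ + Pi.single j 1) = (τ j + 1) * mfac τ := by
  rw [mfac, mfac, ← Finset.mul_prod_erase _ _ (Finset.mem_univ j),
    ← Finset.mul_prod_erase _ _ (Finset.mem_univ j), ← mul_assoc]
  congr 1
  · simp [Nat.factorial_succ]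
  · exact Finset.prod_congr rfl fun i hi => by simp [Finset.ne_of_mem_erase hi]

/-- Divided-power coefficients with respect to the first row. -/
noncomputable def rowCoeff (N : ℕ) :
    MvPolynomial (Prs (N + 1)) ℚ →+ Mon N (MvPolynomial (Prs N) ℚ) where
  toFun p τ := mfac τ • coeff (fsp τ) (rowEquiv N p)
  map_zero' := Mon.ext fun τ => by
    change mfac τ • coeff (fsp τ) (rowEquiv N 0) = 0
    simp
  map_add' p q := Mon.ext fun τ => by
    change mfac τ • coeff (fsp τ) (rowEquiv N (p + q)) = _ + _
    rw [map_add, coeff_add, smul_add]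

theorem rowCoeff_apply (p : MvPolynomial (Prs (N + 1)) ℚ) (τ : Fin N → ℕ) :
    rowCoeff N p τ = mfac τ • coeff (fsp τ) (rowEquiv N p) := rfl

theorem rowCoeff_injective : Function.Injective (rowCoeff N) := by
  refine (injective_iff_map_eq_zero _).2 fun p hp => ?_
  refine (map_eq_zero_iff _ (rowEquiv N).injective).1 (MvPolynomial.ext _ _ fun α => ?_)
  have h := congrArg (fun z : Mon N _ => z α) hp
  simp only [rowCoeff_apply, Mon.zero_apply, fsp, Finsupp.equivFunOnFinite_symm_coe] at h
  rw [coeff_zero]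
  exact (smul_eq_zero.1 h).resolve_left (mfac_ne_zero _)

theorem exists_rowCoeff_eq (z : Mon N (MvPolynomial (Prs N) ℚ)) (s : Finset (Fin N → ℕ))
    (hz : ∀ τ, z τ ≠ 0 → τ ∈ s) : ∃ p, rowCoeff N p = z := by
  classical
  refine ⟨(rowEquiv N).symm (∑ τ ∈ s, monomial (fsp τ) ((mfac τ)⁻¹ • z τ)), Mon.ext fun τ => ?_⟩
  rw [rowCoeff_apply, AlgEquiv.apply_symm_apply, coeff_sum]
  simp only [coeff_monomial, fsp, Finsupp.equivFunOnFinite.symm.injective.eq_iff]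
  rw [Finset.sum_ite_eq']
  split_ifs with h
  · rw [smul_smul, mul_inv_cancel₀ (mfac_ne_zero _), one_smul]
  · rw [smul_zero]
    by_contra h'
    exact h (hz τ (Ne.symm h'))

theorem rowCoeff_dx (j : Fin N) (p : MvPolynomial (Prs (N + 1)) ℚ) :
    rowCoeff N (dx 0 j.succ p) = mS j (rowCoeff N p) := by
  refine Mon.ext fun τ => ?_
  have h : fsp (τ + Pi.single j 1) = fsp τ + Finsupp.single j 1 := by
    ext i
    simp [Finsupp.single_apply, Pi.single_apply, eq_comm]
  rw [mS_apply, rowCoeff_apply, rowCoeff_apply, rowEquiv_dx, coeff_pderiv, mfac_add_single, h,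
    mul_comm _ (mfac τ), mul_smul]
  congr 1
  rw [smul_eq_C_mul, mul_comm]
  simp

theorem rowCoeff_gX_mul (i j : Fin N) (p : MvPolynomial (Prs (N + 1)) ℚ) :
    rowCoeff N (gX (N + 1) ℚ i.succ j.succ * p) = gX N ℚ i j • rowCoeff N p := by
  refine Mon.ext fun τ => ?_
  rw [Mon.smul_apply, rowCoeff_apply, rowCoeff_apply, map_mul, rowEquiv_gX_succ, coeff_C_mul,
    mul_smul_comm]

theorem rowCoeff_glE_zero (p : MvPolynomial (Prs (N + 1)) ℚ) (τ : Fin N → ℕ) :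
    rowCoeff N (glE 0 0 p) τ = ((∑ i, τ i : ℕ) : ℚ) • rowCoeff N p τ := by
  rw [glE_apply, Fin.sum_univ_succ, dx_self, Derivation.zero_apply, mul_zero, zero_add,
    rowCoeff_apply, map_sum, coeff_sum]
  simp only [map_mul, rowEquiv_gX_zero, rowEquiv_dx, coeff_X_mul_pderiv_self]
  rw [← Finset.sum_mul, rowCoeff_apply, smul_comm]
  congr 1
  rw [smul_eq_C_mul]
  simp

theorem rowCoeff_glE_succ (k : Fin N) (p : MvPolynomial (Prs (N + 1)) ℚ) :
    rowCoeff N (glE k.succ 0 p) = ∑ j, gX N ℚ k j • mS j (rowCoeff N p) := by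
  rw [glE_apply, Fin.sum_univ_succ, dx_self, Derivation.zero_apply, mul_zero, zero_add, map_sum]
  simp only [rowCoeff_gX_mul, rowCoeff_dx]

theorem map_rowCoeff_D (f : Fock (Fin N) (MvPolynomial (Prs (N + 1)) ℚ)) :
    Fock.map (rowCoeff N) ((symRep N).D f) = difT (gX N ℚ) (Fock.map (rowCoeff N) f) := by
  rw [difT_apply, Finset.sum_add_distrib, PRep.D, LinearMap.add_apply, map_add, add_comm, PRep.d,
    PRep.kap, LinearMap.sum_apply, LinearMap.sum_apply, map_sum, map_sum]
  congr 1
  · refine Finset.sum_congr rfl fun j _ => ?_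
    rw [Module.End.mul_apply, Fock.map_an ℚ (MvPolynomial (Prs N) ℚ), ← Module.End.mul_apply (lft _),
      (commute_lft_an _ _).eq, Module.End.mul_apply]
    congr 1
    exact Fock.ext fun I => rowCoeff_dx j (f I)
  · rw [Finset.sum_comm]
    refine Finset.sum_congr rfl fun k _ => ?_
    rw [Module.End.mul_apply, Fock.map_cr ℚ (MvPolynomial (Prs N) ℚ)]
    have : Fock.map (rowCoeff N) (lft ((symRep N).E k.succ 0) f)
        = ∑ j, gX N ℚ k j • lft (mS j) (Fock.map (rowCoeff N) f) := Fock.ext fun I => by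
      rw [Fock.map_apply, Fock.sum_apply]
      exact rowCoeff_glE_succ k (f I)
    rw [this, map_sum]
    refine Finset.sum_congr rfl fun j _ => ?_
    rw [map_smul, ← Module.End.mul_apply, ← (commute_lft_cr _ _).eq, Module.End.mul_apply]

end Bridge

section Rational

variable {N : ℕ}

theorem exists_difT_eq_rat (hN : Odd N) {m b : ℤ} {g : Cx N (MvPolynomial (Prs N) ℚ)}
    (hg : InL m b g) (hb : Even (b - m))
    (h : ∀ I : Finset (Fin N), m ≤ I.card + b - 1 → difT (gX N ℚ) g I = 0) :
    ∃ y : Cx N (MvPolynomial (Prs N) ℚ), InL m (b + 1) y ∧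
      ∀ I : Finset (Fin N), m ≤ I.card + b → difT (gX N ℚ) y I = g I := by
  have hu : ∀ I, ∃ p, rowCoeff N p = g I := fun I =>
    exists_rowCoeff_eq (g I) (Fintype.piFinset fun _ => Finset.range (b.toNat + 1)) fun τ hτ => by
      have h1 := (hg I τ hτ).1
      refine Fintype.mem_piFinset.2 fun i => Finset.mem_range.2 ?_
      have h2 := Finset.single_le_sum (f := τ) (fun _ _ => Nat.zero_le _) (Finset.mem_univ i)
      omega
  obtain ⟨u, hu⟩ : ∃ u : Fock (Fin N) (MvPolynomial (Prs (N + 1)) ℚ), ∀ I, rowCoeff N (u I) = g I :=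
    ⟨fun I => (hu I).choose, fun I => (hu I).choose_spec⟩
  have hmap : Fock.map (rowCoeff N) u = g := Fock.ext hu
  have huZ : u ∈ (symRep N).ZZ (m - b) b := by
    refine ⟨?_, ?_, fun I hI => ?_⟩
    · refine Fock.ext fun I => rowCoeff_injective (Mon.ext fun τ => ?_)
      change rowCoeff N (glE 0 0 (u I)) τ = rowCoeff N ((b : ℚ) • u I) τ
      have e : rowCoeff N ((b : ℚ) • u I) τ = (b : ℚ) • rowCoeff N (u I) τ := by
        rw [rowCoeff_apply, rowCoeff_apply, map_smul, coeff_smul, smul_comm]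
      rw [rowCoeff_glE_zero, e, hu]
      by_cases h0 : g I τ = 0
      · rw [h0, smul_zero, smul_zero]
      · rw [← (hg I τ h0).1, Int.cast_natCast]
    · intro I hI
      have h0 : g I ≠ 0 := fun h0 => hI (rowCoeff_injective (by rw [hu, h0, map_zero]))
      obtain ⟨τ, hτ⟩ : ∃ τ, g I τ ≠ 0 := by
        by_contra! h1
        exact h0 (Mon.ext h1)
      obtain ⟨-, h2, h3⟩ := hg I τ hτ
      rw [Int.even_iff] at *
      refine ⟨Nat.even_iff.2 (by omega), by omega⟩
    · refine rowCoeff_injective ?_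
      rw [map_zero, ← Fock.map_apply, map_rowCoeff_D, hmap]
      exact h I (by omega)
  obtain ⟨w, hw1, hw2, hw3⟩ := (symRep N).truncExact_of_closed hN huZ
  refine ⟨Fock.map (rowCoeff N) w, fun I τ hτ => ?_, fun I hI => ?_⟩
  · have h0 : lft ((symRep N).E 0 0) w I = (((b : ℚ) + 1) • w) I := by rw [hw1]
    have h1 : rowCoeff N (glE 0 0 (w I)) τ = rowCoeff N (((b : ℚ) + 1) • w I) τ := by
      rw [← Fock.smul_apply, ← h0]
      rfl
    have e : rowCoeff N (((b : ℚ) + 1) • w I) τ = ((b : ℚ) + 1) • rowCoeff N (w I) τ := by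
      rw [rowCoeff_apply, rowCoeff_apply, map_smul, coeff_smul, smul_comm]
    rw [rowCoeff_glE_zero, e] at h1
    have h2 := smul_left_injective ℚ (show rowCoeff N (w I) τ ≠ 0 from hτ) h1
    have h3 : w I ≠ 0 := fun h3 => hτ (by rw [Fock.map_apply, h3, map_zero]; rfl)
    obtain ⟨h4, h5⟩ := hw2 I h3
    rw [Nat.odd_iff] at h4
    rw [Int.even_iff] at *
    refine ⟨?_, by omega, by omega⟩
    have : (((∑ i, τ i : ℕ) : ℤ) : ℚ) = ((b + 1 : ℤ) : ℚ) := by push_cast at h2 ⊢; exact h2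
    exact_mod_cast this
  · rw [← map_rowCoeff_D, Fock.map_apply, hw3 I (by omega), hu]

end Rational

section BaseChange

variable {N : ℕ} {R R' : Type*} [CommRing R] [CommRing R']

theorem mapF_mS (φ : R →+ R') (z : Cx N R) (j : Fin N) :
    mapF φ (lft (mS j) z) = lft (mS j) (mapF φ z) := rfl

theorem mapF_difT {φ : R →+ R'} {X : Fin N → Fin N → R} {X' : Fin N → Fin N → R'}
    (h : ∀ i j r, φ (X i j * r) = X' i j * φ r) (z : Cx N R) :
    mapF φ (difT X z) = difT X' (mapF φ z) := by
  simp only [difT_apply, map_sum, map_add, mapF_smul (h _ _), mapF_mS, mapF_an, mapF_cr]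

/-- The `T`-exponents of total degree at most `b`. -/
def expts (N : ℕ) (b : ℤ) : Finset (Fin N → ℕ) :=
  Fintype.piFinset fun _ => Finset.range (b.toNat + 1)

theorem InL.mem_expts {m b : ℤ} {z : Cx N R} (hz : InL m b z) {I τ} (h : z I τ ≠ 0) :
    τ ∈ expts N b := by
  have h1 := (hz I τ h).1
  refine Fintype.mem_piFinset.2 fun i => Finset.mem_range.2 ?_
  have h2 := Finset.single_le_sum (f := τ) (fun _ _ => Nat.zero_le _) (Finset.mem_univ i)
  omega

theorem exists_difT_eq_of_basis {ι : Type*} [Algebra R R'] (𝓑 : Module.Basis ι R R')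
    {X : Fin N → Fin N → R} {X' : Fin N → Fin N → R'}
    (hX : ∀ i j, X' i j = algebraMap R R' (X i j)) {m b : ℤ}
    (hR : ∀ g : Cx N R, InL m b g →
      (∀ I : Finset (Fin N), m ≤ I.card + b - 1 → difT X g I = 0) →
      ∃ y : Cx N R, InL m (b + 1) y ∧
        ∀ I : Finset (Fin N), m ≤ I.card + b → difT X y I = g I) {g : Cx N R'}
    (hg : InL m b g) (h : ∀ I : Finset (Fin N), m ≤ I.card + b - 1 → difT X' g I = 0) :
    ∃ y : Cx N R', InL m (b + 1) y ∧
      ∀ I : Finset (Fin N), m ≤ I.card + b → difT X' y I = g I := by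
  classical
  let φ : ι → R' →+ R := fun i => (𝓑.coord i).toAddMonoidHom
  let ψ : ι → R →+ R' := fun i => (LinearMap.toSpanSingleton R R' (𝓑 i)).toAddMonoidHom
  have hφ : ∀ k i j r, φ k (X' i j * r) = X i j * φ k r := fun k i j r => by
    rw [hX, ← Algebra.smul_def]
    exact (𝓑.coord k).map_smul _ _
  have hψ : ∀ k i j r, ψ k (X i j * r) = X' i j * ψ k r := fun k i j r => by
    rw [hX, ← Algebra.smul_def]
    exact (LinearMap.toSpanSingleton R R' (𝓑 k)).map_smul _ _
  have key : ∀ k, ∃ y : Cx N R, InL m (b + 1) y ∧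
      ∀ I : Finset (Fin N), m ≤ I.card + b → difT X y I = mapF (φ k) g I := fun k =>
    hR _ (hg.mapF _) fun I hI => by
      rw [← mapF_difT (hφ k)]
      refine Mon.ext fun τ => ?_
      rw [mapF_apply, h I hI, Mon.zero_apply, map_zero, Mon.zero_apply]
  choose y hy1 hy2 using key
  let s : Finset ι := Finset.univ.biUnion fun I : Finset (Fin N) =>
    (expts N b).biUnion fun τ => (𝓑.repr (g I τ)).support
  refine ⟨∑ k ∈ s, mapF (ψ k) (y k), InL.sum fun k _ => (hy1 k).mapF _, fun I hI => ?_⟩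
  rw [map_sum, Fock.sum_apply]
  refine Mon.ext fun τ => ?_
  rw [Mon.sum_apply]
  simp only [← mapF_difT (hψ _), mapF_apply, hy2 _ I hI]
  have hs : (𝓑.repr (g I τ)).support ⊆ s := by
    by_cases h0 : g I τ = 0
    · simp [h0]
    · exact (Finset.subset_biUnion_of_mem (fun τ => (𝓑.repr (g I τ)).support)
        (hg.mem_expts h0)).trans (Finset.subset_biUnion_of_mem (fun I => (expts N b).biUnion
          fun τ => (𝓑.repr (g I τ)).support) (Finset.mem_univ I))
  conv_rhs => rw [← 𝓑.linearCombination_repr (g I τ), Finsupp.linearCombination_apply]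
  exact (Finsupp.sum_of_support_subset _ hs _ (by simp)).symm

theorem exists_difT_eq (K : Type*) [Field K] [CharZero K] (hN : Odd N) {m b : ℤ}
    {g : Cx N (MvPolynomial (Prs N) K)} (hg : InL m b g) (hb : Even (b - m))
    (h : ∀ I : Finset (Fin N), m ≤ I.card + b - 1 → difT (gX N K) g I = 0) :
    ∃ y : Cx N (MvPolynomial (Prs N) K), InL m (b + 1) y ∧
      ∀ I : Finset (Fin N), m ≤ I.card + b → difT (gX N K) y I = g I := by
  let : Algebra (MvPolynomial (Prs N) ℚ) (MvPolynomial (Prs N) K) :=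
    MvPolynomial.algebraMvPolynomial
  have ibc : IsBaseChange (MvPolynomial (Prs N) ℚ)
      (IsScalarTower.toAlgHom ℚ K (MvPolynomial (Prs N) K)).toLinearMap :=
    (inferInstance : Algebra.IsPushout ℚ (MvPolynomial (Prs N) ℚ) K (MvPolynomial (Prs N) K)).out
  refine exists_difT_eq_of_basis (ibc.basis (Module.Free.chooseBasis ℚ K)) (X := gX N ℚ)
    (fun i j => ?_) (fun g hg h => exists_difT_eq_rat hN hg hb h) hg h
  rw [MvPolynomial.algebraMap_def]
  rcases lt_trichotomy i j with h | rfl | h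
  · simp [gX_of_lt h]
  · simp [gX_self]
  · rw [gX_skew, gX_skew i j]; simp [gX_of_lt h]

end BaseChange

section ExtResolution

open CategoryTheory

variable {C : Type*} [Category C] [Abelian C]

/-- A sequence of composable morphisms which is exact and ends in an epimorphism gives a projective
resolution. -/
theorem exists_projectiveResolution (P : ℕ → C) (d : ∀ n, P (n + 1) ⟶ P n) (M : C) (ε : P 0 ⟶ M)
    (hP : ∀ n, Projective (P n)) (w0 : d 0 ≫ ε = 0) (w : ∀ n, d (n + 1) ≫ d n = 0)
    (ex0 : (ShortComplex.mk _ _ w0).Exact) (ex : ∀ n, (ShortComplex.mk _ _ (w n)).Exact) [Epi ε] :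
    ∃ Q : ProjectiveResolution M, Q.complex = ChainComplex.of P d w := by
  have e0 : (ChainComplex.of P d w).d 1 0 = d 0 := ChainComplex.of_d P d 0
  have hw : (ChainComplex.of P d w).d 1 0 ≫ ε = 0 := by rw [e0]; exact w0
  have hf := ChainComplex.toSingle₀Equiv_symm_apply_f_zero (C := ChainComplex.of P d w) ε hw
  have hq : QuasiIso ((ChainComplex.toSingle₀Equiv (ChainComplex.of P d w) M).symm ⟨ε, hw⟩) := by
    refine ⟨fun n => ?_⟩
    cases n with
    | zero =>
      rw [ChainComplex.quasiIsoAt₀_iff, ShortComplex.quasiIso_iff_of_zeros' _ rfl rfl rfl]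
      refine (ShortComplex.exact_and_epi_g_iff_of_iso ?_).2
        (⟨ex0, inferInstance⟩ : (ShortComplex.mk _ _ w0).Exact ∧ Epi (ShortComplex.mk _ _ w0).g)
      refine ShortComplex.isoMk (Iso.refl _) (Iso.refl _) (Iso.refl _) ?_ ?_
      · exact (Category.id_comp _).trans (e0.symm.trans (Category.comp_id _).symm)
      · exact (Category.id_comp ε).trans
          ((Category.comp_id ε).symm.trans (congrArg (· ≫ 𝟙 M)
            hf.symm))
    | succ n =>
      rw [quasiIsoAt_iff_exactAt' _ _ (ChainComplex.exactAt_succ_single_obj _ _),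
        HomologicalComplex.exactAt_iff' _ (n + 1 + 1) (n + 1) n (by simp) (by simp)]
      refine (ShortComplex.exact_iff_of_iso ?_).2 (ex n)
      refine ShortComplex.isoMk (Iso.refl _) (Iso.refl _) (Iso.refl _) ?_ ?_
      · exact (Category.id_comp _).trans ((ChainComplex.of_d P d (n + 1)).symm.trans
          (Category.comp_id _).symm)
      · exact (Category.id_comp _).trans ((ChainComplex.of_d P d n).symm.trans
          (Category.comp_id _).symm)
  exact ⟨{ complex := ChainComplex.of P d w, projective := hP, π := _, quasiIso := hq }, rfl⟩

end ExtResolution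

section ExtVanishing

open CategoryTheory

variable {R : Type} [CommRing R]

theorem subsingleton_ext_of_resolution {P : ℕ → ModuleCat.{0} R} {d : ∀ n, P (n + 1) ⟶ P n}
    {w : ∀ n, d (n + 1) ≫ d n = 0} {M : ModuleCat.{0} R} (Q : ProjectiveResolution M)
    (hQ : Q.complex = ChainComplex.of P d w) (Y : ModuleCat.{0} R) (j : ℕ)
    (h0 : j = 0 → ∀ f : P 0 ⟶ Y, d 0 ≫ f = 0 → f = 0)
    (h : ∀ k, j = k + 1 → ∀ f : P (k + 1) ⟶ Y, d (k + 1) ≫ f = 0 → ∃ g : P k ⟶ Y, d k ≫ g = f) :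
    Subsingleton (((Ext R (ModuleCat.{0} R) j).obj (Opposite.op M)).obj Y) := by
  refine ModuleCat.subsingleton_of_isZero (Limits.IsZero.of_iso ?_ (Q.isoExt j Y))
  rw [← HomologicalComplex.exactAt_iff_isZero_homology, hQ]
  cases j with
  | zero =>
    rw [HomologicalComplex.exactAt_iff' _ 0 0 1 (by simp) (by simp), ShortComplex.moduleCat_exact_iff]
    intro f hf
    refine ⟨0, (map_zero _).trans (h0 rfl f ?_).symm⟩
    rw [← ChainComplex.of_d P d 0]
    exact hf
  | succ k =>
    rw [HomologicalComplex.exactAt_iff' _ k (k + 1) (k + 1 + 1) (by simp) (by simp),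
      ShortComplex.moduleCat_exact_iff]
    intro f hf
    obtain ⟨g, hg⟩ := h k rfl f (by rw [← ChainComplex.of_d P d (k + 1)]; exact hf)
    refine ⟨g, ?_⟩
    rw [← hg, ← ChainComplex.of_d P d k]
    rfl

theorem subsingleton_ext {P : ℕ → Type} [∀ n, AddCommGroup (P n)] [∀ n, Module R (P n)]
    (hP : ∀ n, Module.Projective R (P n)) (d : ∀ n, P (n + 1) →ₗ[R] P n) {M : Type}
    [AddCommGroup M] [Module R M] (ε : P 0 →ₗ[R] M) (hε : Function.Surjective ε)
    (ex0 : ∀ x, ε x = 0 ↔ ∃ y, d 0 y = x) (ex : ∀ n x, d n x = 0 ↔ ∃ y, d (n + 1) y = x)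
    (Y : Type) [AddCommGroup Y] [Module R Y] (j : ℕ)
    (h0 : j = 0 → ∀ f : P 0 →ₗ[R] Y, f ∘ₗ d 0 = 0 → f = 0)
    (h : ∀ k, j = k + 1 → ∀ f : P (k + 1) →ₗ[R] Y, f ∘ₗ d (k + 1) = 0 →
      ∃ g : P k →ₗ[R] Y, g ∘ₗ d k = f) :
    Subsingleton (((Ext R (ModuleCat.{0} R) j).obj (Opposite.op (ModuleCat.of R M))).obj
      (ModuleCat.of R Y)) := by
  have w0 : ModuleCat.ofHom (d 0) ≫ ModuleCat.ofHom ε = 0 :=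
    ModuleCat.hom_ext (LinearMap.ext fun x => (ex0 _).2 ⟨x, rfl⟩)
  have w : ∀ n, ModuleCat.ofHom (d (n + 1)) ≫ ModuleCat.ofHom (d n) = 0 := fun n =>
    ModuleCat.hom_ext (LinearMap.ext fun x => (ex n _).2 ⟨x, rfl⟩)
  have : Epi (ModuleCat.ofHom ε) := (ModuleCat.epi_iff_surjective _).2 hε
  obtain ⟨Q, hQ⟩ := exists_projectiveResolution (fun n => ModuleCat.of R (P n))
    (fun n => ModuleCat.ofHom (d n)) (ModuleCat.of R M) (ModuleCat.ofHom ε)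
    (fun n => (IsProjective.iff_projective _).1 (hP n)) w0 w
    ((ShortComplex.moduleCat_exact_iff _).2 fun x hx => (ex0 x).1 hx)
    (fun n => (ShortComplex.moduleCat_exact_iff _).2 fun x hx => (ex n x).1 hx)
  refine subsingleton_ext_of_resolution Q hQ _ j (fun hj f hf => ?_) fun k hk f hf => ?_
  · exact ModuleCat.hom_ext (h0 hj f.hom (congrArg ModuleCat.Hom.hom hf))
  · obtain ⟨g, hg⟩ := h k hk f.hom (congrArg ModuleCat.Hom.hom hf)
    exact ⟨ModuleCat.ofHom g, ModuleCat.hom_ext hg⟩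

end ExtVanishing

section Modules

variable {N : ℕ} {R : Type*} [CommRing R]

/-- The submodule of elements of bidegree `(m, b)`. -/
def subL (N : ℕ) (R : Type*) [CommRing R] (m b : ℤ) : Submodule R (Cx N R) where
  carrier := {z | InL m b z}
  add_mem' := InL.add
  zero_mem' := InL.zero
  smul_mem' r _ h := h.smul r

theorem mem_subL {m b : ℤ} {z : Cx N R} : z ∈ subL N R m b ↔ InL m b z := Iff.rfl

/-- The index set of a basis of `subL N R m b`. -/
def idx (N : ℕ) (m b : ℤ) : Finset (Finset (Fin N) × (Fin N → ℕ)) :=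
  (Finset.univ ×ˢ expts N b).filter fun q => ((∑ i, q.2 i : ℕ) : ℤ) = b ∧
    m ≤ (q.1.card : ℤ) + b ∧ Even ((q.1.card : ℤ) + b - m)

theorem InL.mem_idx {m b : ℤ} {z : Cx N R} (hz : InL m b z) {I τ} (h : z I τ ≠ 0) :
    (I, τ) ∈ idx N m b :=
  Finset.mem_filter.2 ⟨Finset.mem_product.2 ⟨Finset.mem_univ _, hz.mem_expts h⟩, hz I τ h⟩

/-- Coordinates on `subL N R m b`. -/
def subLEquiv (N : ℕ) (R : Type*) [CommRing R] (m b : ℤ) :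
    subL N R m b ≃ₗ[R] (idx N m b → R) where
  toFun z q := z.1 q.1.1 q.1.2
  map_add' _ _ := rfl
  map_smul' _ _ := rfl
  invFun f := ⟨fun I τ => if h : (I, τ) ∈ idx N m b then f ⟨(I, τ), h⟩ else 0, by
    intro I τ h
    by_cases h' : (I, τ) ∈ idx N m b
    · exact (Finset.mem_filter.1 h').2
    · simp [h'] at h⟩
  left_inv z := by
    refine Subtype.ext (Fock.ext fun I => Mon.ext fun τ => ?_)
    by_cases h : z.1 I τ = 0
    · simp [h]
    · simp [InL.mem_idx z.2 h]
  right_inv f := by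
    funext q
    simp

instance (m b : ℤ) : Module.Projective R (subL N R m b) :=
  Module.Projective.of_equiv (subLEquiv N R m b).symm

/-- Restriction of the differential. -/
def difL (X : Fin N → Fin N → R) (m b c : ℤ) (h : c = b + 1) : subL N R m b →ₗ[R] subL N R m c :=
  (dif X).restrict fun z hz => by subst h; exact InL.dif X hz

/-- The cycles of bidegree `(m, b)`. -/
def subZ (X : Fin N → Fin N → R) (m b : ℤ) : Submodule R (Cx N R) :=
  subL N R m b ⊓ LinearMap.ker (dif X)

theorem mem_subZ {X : Fin N → Fin N → R} {m b : ℤ} {z : Cx N R} :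
    z ∈ subZ X m b ↔ InL m b z ∧ dif X z = 0 := Iff.rfl

theorem projective_subZ [Algebra ℚ R] {X : Fin N → Fin N → R} (hX : ∀ i j, X i j = - X j i)
    {m b : ℤ} (hm : m ≤ b + 1) (hb : 0 ≤ b) : Module.Projective R (subZ X m b) := by
  have h0 : ∀ w, dif X (dif X w) = 0 := fun w => by
    rw [← Module.End.mul_apply, dif_mul_dif hX, LinearMap.zero_apply]
  let s : subL N R m b →ₗ[R] subZ X m b :=
    ((1 - hom X * dif X : Module.End R (Cx N R)).domRestrict _).codRestrict _ fun z => by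
      have h1 : InL m (b + 1) (dif X z) := InL.dif X z.2
      refine mem_subZ.2 ⟨InL.sub z.2 ?_, ?_⟩
      · have h2 := h1.hom X hm
        rwa [add_sub_cancel_right] at h2
      · change dif X (z - hom X (dif X z)) = 0
        rw [map_sub, dif_hom hX h1 (by omega) (by omega) (h0 _), sub_self]
  refine Module.Projective.of_split (Submodule.inclusion (inf_le_left)) s ?_
  refine LinearMap.ext fun z => Subtype.ext ?_
  change z.1 - hom X (dif X z.1) = z.1
  rw [(mem_subZ.1 z.2).2, map_zero, sub_zero]

end Modules

section Augmentation

variable {N : ℕ} {R : Type*} [CommRing R]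

/-- The component in exterior degree zero. -/
def atEmpty (N : ℕ) (R : Type*) [CommRing R] : Cx N R →ₗ[R] Mon N R where
  toFun z := z ∅
  map_add' _ _ := rfl
  map_smul' _ _ := rfl

theorem InL.lower {m b : ℤ} {z : Cx N R} (hz : InL (m + 2) b z) : InL m b z := by
  intro I τ h
  obtain ⟨h1, h2, h3⟩ := hz I τ h
  refine ⟨h1, by omega, ?_⟩
  rw [Int.even_iff] at *
  omega

theorem ev_mem_pow {p : Fin N → R} {d : ℕ} (a : Mon N R) : ev p d a ∈ Ideal.span (Set.range p) ^ d := by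
  rw [ev_apply]
  refine Ideal.sum_mem _ fun τ hτ => Ideal.mul_mem_left _ _ ?_
  rw [← mem_antidiag.1 hτ, ← Finset.prod_pow_eq_pow_sum]
  exact Ideal.prod_mem_prod fun i _ =>
    Ideal.pow_mem_pow (Ideal.subset_span (Set.mem_range_self i)) _

theorem exists_ev_eq {p : Fin N → R} {d : ℕ} {x : R} (hx : x ∈ Ideal.span (Set.range p) ^ d) :
    ∃ a, Hmg d a ∧ ev p d a = x := by
  induction d generalizing x with
  | zero =>
    refine ⟨x • mono 0, (hmg_mono (by simp)).smul x, ?_⟩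
    rw [map_smul, ev_apply, Finset.sum_eq_single 0]
    · simp [mono_apply]
    · intro τ hτ h
      rw [mono_apply, if_neg h, zero_mul]
    · intro h
      exact absurd (mem_antidiag.2 (by simp)) h
  | succ d ih =>
    rw [pow_succ'] at hx
    refine Submodule.mul_induction_on hx (fun r hr y hy => ?_) ?_
    · obtain ⟨a, ha, rfl⟩ := ih hy
      obtain ⟨c, rfl⟩ := Ideal.mem_span_range_iff_exists_fun.1 hr
      refine ⟨∑ j, c j • mT j a, Hmg.sum fun j _ => (ha.mT j).smul _, ?_⟩
      rw [map_sum, Finset.sum_mul]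
      refine Finset.sum_congr rfl fun j _ => ?_
      rw [map_smul, ev_mT, smul_eq_mul, mul_assoc]
    · rintro _ _ ⟨a, ha, rfl⟩ ⟨b, hb, rfl⟩
      exact ⟨a + b, ha.add hb, map_add _ _ _⟩

variable [Algebra ℚ R]

/-- The map from cycles to the ring whose image is a power of the ideal generated by `p`. -/
def aug (X : Fin N → Fin N → R) (p : Fin N → R) (d : ℕ) (m b : ℤ) : subZ X m b →ₗ[R] R :=
  ev p d ∘ₗ atEmpty N R ∘ₗ hom X ∘ₗ (subZ X m b).subtype

theorem aug_apply (X : Fin N → Fin N → R) (p : Fin N → R) (d : ℕ) (m b : ℤ) (z : subZ X m b) :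
    aug X p d m b z = ev p d (hom X z.1 ∅) := rfl

variable {X : Fin N → Fin N → R} {p : Fin N → R} {d : ℕ}

theorem ev_hom_dif (hX : ∀ i j, X i j = - X j i) (hp : ∀ k, ∑ j, X k j * p j = 0) (hd : 1 ≤ d)
    (hE : Ex X (d : ℤ)) {y : Cx N R} (hy : InL d d y) :
    ev p d (hom X (dif X y) ∅) = ev p d (y ∅) := by
  have h0 : ∀ w, dif X (dif X w) = 0 := fun w => by
    rw [← Module.End.mul_apply, dif_mul_dif hX, LinearMap.zero_apply]
  have h1 : InL (d : ℤ) (d + 1) (dif X y) := hy.dif X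
  have h2 : InL (d : ℤ) d (hom X (dif X y)) := by
    have := h1.hom X (by omega)
    rwa [add_sub_cancel_right] at this
  obtain ⟨w, hw, e⟩ := hE d _ (h2.sub hy)
    (by rw [map_sub, dif_hom hX h1 (by omega) (by omega) (h0 _), sub_self]) (by omega)
  obtain ⟨d, rfl⟩ : ∃ d', d = d' + 1 := ⟨d - 1, by omega⟩
  have h3 := ev_inF hp ⟨w, hw, rfl⟩
  rw [e, Fock.sub_apply, map_sub, sub_eq_zero] at h3
  exact h3

theorem aug_dif (hX : ∀ i j, X i j = - X j i) (hp : ∀ k, ∑ j, X k j * p j = 0) (hd : 1 ≤ d)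
    (hE : Ex X (d : ℤ)) {y : Cx N R} (hy : InL ((d : ℤ) + 2) d y) :
    ev p d (hom X (dif X y) ∅) = 0 := by
  rw [ev_hom_dif hX hp hd hE hy.lower]
  have : y ∅ = 0 := by
    ext τ
    by_contra h
    have := (hy ∅ τ h).2.1
    simp at this
  rw [this, map_zero]

theorem exists_of_aug_eq_zero (hX : ∀ i j, X i j = - X j i)
    (hlin : ∀ a, Hmg d a → ev p d a = 0 → InF X d a)
    {z : Cx N R} (hz : InL ((d : ℤ) + 2) (d + 1) z) (hz0 : dif X z = 0)
    (h : ev p d (hom X z ∅) = 0) : ∃ y, InL ((d : ℤ) + 2) d y ∧ dif X y = z := by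
  have h0 : ∀ w, dif X (dif X w) = 0 := fun w => by
    rw [← Module.End.mul_apply, dif_mul_dif hX, LinearMap.zero_apply]
  have h2 : InL (d : ℤ) d (hom X z) := by
    have := hz.lower.hom X (by omega)
    rwa [add_sub_cancel_right] at this
  obtain ⟨v, hv, e⟩ := hlin _ (h2.hmg ∅) h
  have h3 : InL (d : ℤ) d (dif X v) := by
    have := hv.dif X
    rwa [sub_add_cancel] at this
  refine ⟨hom X z - dif X v, (h2.sub h3).raise fun I hI => ?_, ?_⟩
  · have : I = ∅ := Finset.card_eq_zero.1 (by omega)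
    rw [this, Fock.sub_apply, e, sub_self]
  · rw [map_sub, h0, sub_zero, dif_hom hX hz.lower (by omega) (by omega) hz0]

theorem exists_aug_eq (hX : ∀ i j, X i j = - X j i) (hp : ∀ k, ∑ j, X k j * p j = 0) (hd : 1 ≤ d)
    (hE : Ex X (d : ℤ)) {a : Mon N R} (ha : Hmg d a) :
    ∃ z : subZ X ((d : ℤ) + 2) (d + 1), aug X p d _ _ z = ev p d a := by
  have h1 : InL (d : ℤ) (d + 1) (dif X (vac a)) := ha.vac.dif X
  refine ⟨⟨dif X (vac a), mem_subZ.2 ⟨h1.raise fun I hI => by omega, ?_⟩⟩, ?_⟩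
  · rw [← Module.End.mul_apply, dif_mul_dif hX, LinearMap.zero_apply]
  · rw [aug_apply, ev_hom_dif hX hp hd hE ha.vac, vac_empty]

end Augmentation

section FirstExt

variable {n : ℕ} {K : Type*} [Field K]

theorem degreeOf_subpf_gX (s : Prs (2 * n + 1)) :
    degreeOf s (subpf (gX (2 * n + 1) K) s.1.1) = 0 := by
  classical
  have key : subpf (gX (2 * n + 1) K) s.1.1 ∈ supported K {t : Prs (2 * n + 1) | t ≠ s} := by
    refine Subalgebra.mul_mem _ (Subalgebra.pow_mem _ (Subalgebra.neg_mem _ (Subalgebra.one_mem _)) _)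
      (Subalgebra.sum_mem _ fun σ _ => Subalgebra.zsmul_mem _ (Subalgebra.prod_mem _ fun i _ => ?_) _)
    have h1 := Fin.succAbove_ne s.1.1 (σ (pa i))
    have h2 := Fin.succAbove_ne s.1.1 (σ (pb i))
    unfold gX
    beta_reduce
    split_ifs with h h'
    · exact Algebra.subset_adjoin ⟨_, fun e => h1 (congrArg (fun t : Prs (2 * n + 1) => t.1.1) e), rfl⟩
    · exact Subalgebra.neg_mem _ (Algebra.subset_adjoin ⟨_, fun e => h2 (congrArg (fun t : Prs (2 * n + 1) => t.1.1) e), rfl⟩)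
    · exact Subalgebra.zero_mem _
  by_contra h
  exact mem_supported.1 key (mem_vars_iff_degreeOf_ne_zero.2 h) rfl

variable [CharZero K]

theorem isUnit_of_dvd_subpf_pow {d : ℕ} {a : MvPolynomial (Prs (2 * n + 1)) K}
    (h : ∀ k, a ∣ subpf (gX (2 * n + 1) K) k ^ d) : IsUnit a := by
  have h1 : a.vars = ∅ := by
    refine Finset.eq_empty_of_forall_notMem fun s hs => mem_vars_iff_degreeOf_ne_zero.1 hs ?_
    obtain ⟨q, hq⟩ := h s.1.1
    have hp := subpf_gX_ne_zero (K := K) s.1.1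
    have h2 := degreeOf_pow_eq s _ d hp
    have h3 : a * q ≠ 0 := hq ▸ pow_ne_zero d hp
    rw [degreeOf_subpf_gX, mul_zero, hq,
      degreeOf_mul_eq (left_ne_zero_of_mul h3) (right_ne_zero_of_mul h3)] at h2
    omega
  have h2 : a ∈ supported K (∅ : Set (Prs (2 * n + 1))) := mem_supported.2 (by simp [h1])
  rw [supported_empty] at h2
  obtain ⟨c, rfl⟩ := Algebra.mem_bot.1 h2
  obtain ⟨q, hq⟩ := h 0
  have h3 : algebraMap K (MvPolynomial (Prs (2 * n + 1)) K) c ≠ 0 := by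
    refine left_ne_zero_of_mul (b := q) ?_
    rw [← hq]
    exact pow_ne_zero d (subpf_gX_ne_zero 0)
  exact (IsUnit.mk0 c fun h => h3 (by rw [h, map_zero])).map _

/-- A functional on the cycles that vanishes on the kernel of the augmentation extends. -/
theorem exists_smul_eq {M : Type*} [AddCommGroup M] [Module (MvPolynomial (Prs (2 * n + 1)) K) M]
    {d : ℕ} {π f : M →ₗ[MvPolynomial (Prs (2 * n + 1)) K] MvPolynomial (Prs (2 * n + 1)) K}
    (hf : ∀ z, π z = 0 → f z = 0)
    (hπ : ∀ k, ∃ z, π z = subpf (gX (2 * n + 1) K) k ^ d) : ∃ c, ∀ z, f z = c * π z := by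
  have h1 : ∀ z w, π w * f z = π z * f w := fun z w => by
    have := hf (π w • z - π z • w) (by
      rw [map_sub, map_smul, map_smul, smul_eq_mul, smul_eq_mul, mul_comm (π w), sub_self])
    rwa [map_sub, map_smul, map_smul, sub_eq_zero] at this
  choose z hz using hπ
  have h0 : π (z 0) ≠ 0 := by rw [hz]; exact pow_ne_zero _ (subpf_gX_ne_zero 0)
  obtain ⟨a, b, e, hab, ha, hb⟩ :=
    UniqueFactorizationMonoid.exists_reduced_factors (π (z 0)) h0 (f (z 0))
  have he : e ≠ 0 := left_ne_zero_of_mul (ha ▸ h0)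
  have hu : IsUnit a := isUnit_of_dvd_subpf_pow (d := d) fun k => by
    refine hab.dvd_of_dvd_mul_right (z := b) ⟨f (z k), mul_left_cancel₀ he ?_⟩
    have h2 := h1 (z 0) (z k)
    rw [← ha, ← hb, hz] at h2
    linear_combination h2
  obtain ⟨u, rfl⟩ := hu
  refine ⟨b * ↑u⁻¹, fun w => mul_left_cancel₀ h0 ?_⟩
  rw [h1, ← ha, ← hb]
  linear_combination (-(e * b * π w)) * u.mul_inv

end FirstExt

section Pairing

variable {N : ℕ} {R : Type*} [CommRing R]

/-- The pairing of homogeneous parts of degree `D`. -/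
def monPair (N : ℕ) (R : Type*) [CommRing R] (D : ℕ) : Mon N R →ₗ[R] Mon N R →ₗ[R] R :=
  LinearMap.mk₂ R (fun a b => ∑ τ ∈ Finset.piAntidiag Finset.univ D, a τ * b τ)
    (fun a b c => by simp [add_mul, Finset.sum_add_distrib])
    (fun r a c => by simp [mul_assoc, Finset.mul_sum])
    (fun a b c => by simp [mul_add, Finset.sum_add_distrib])
    (fun r a c => by simp [mul_left_comm, Finset.mul_sum])

theorem monPair_apply (D : ℕ) (a b : Mon N R) :
    monPair N R D a b = ∑ τ ∈ Finset.piAntidiag Finset.univ D, a τ * b τ := rfl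

theorem monPair_mT (D : ℕ) (j : Fin N) (a b : Mon N R) :
    monPair N R (D + 1) a (mT j b) = monPair N R D (mS j a) b := by
  rw [monPair_apply, monPair_apply]
  symm
  refine Finset.sum_of_injOn (fun τ => τ + Pi.single j 1) (fun _ _ _ _ h => add_right_cancel h)
    ?_ ?_ ?_
  · intro τ hτ
    rw [Finset.mem_coe, mem_antidiag] at *
    rw [sum_add_single, hτ]
  · intro τ hτ h
    by_cases h0 : τ j = 0
    · simp [mT_apply, h0]
    · refine absurd ⟨τ - Pi.single j 1, ?_, sub_add_single h0⟩ h
      rw [Finset.mem_coe, mem_antidiag] at *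
      have := sum_sub_single h0
      omega
  · intro τ _
    have e : τ + Pi.single j 1 - Pi.single j 1 = τ := add_tsub_cancel_right _ _
    rw [mS_apply, mT_apply, e]
    simp

/-- The pairing of the complexes with their transposes. -/
def cxPair (N : ℕ) (R : Type*) [CommRing R] (D : ℕ) : Cx N R →ₗ[R] Cx N R →ₗ[R] R :=
  LinearMap.mk₂ R (fun φ z => ∑ I, monPair N R D (φ I) (z I))
    (fun a b c => by simp [Finset.sum_add_distrib])
    (fun r a c => by simp [Finset.mul_sum])
    (fun a b c => by simp [Finset.sum_add_distrib])
    (fun r a c => by simp [Finset.mul_sum])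

theorem cxPair_apply (D : ℕ) (φ z : Cx N R) :
    cxPair N R D φ z = ∑ I, monPair N R D (φ I) (z I) := rfl

theorem cxPair_lft_mT (D : ℕ) (j : Fin N) (φ z : Cx N R) :
    cxPair N R (D + 1) φ (lft (mT j) z) = cxPair N R D (lft (mS j) φ) z := by
  simp only [cxPair_apply, lft_apply, monPair_mT]

theorem cxPair_an (D : ℕ) (j : Fin N) (φ z : Cx N R) :
    cxPair N R D φ (an R j z) = cxPair N R D (cr R j φ) z := by
  rw [cxPair_apply, cxPair_apply]
  exact (sum_cr_eq_sum_an (R := R) (AddMonoidHom.mk' (fun a => (monPair N R D a).toAddMonoidHom)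
    fun a b => by ext; simp) j φ z).symm

theorem monPair_comm (D : ℕ) (a b : Mon N R) : monPair N R D a b = monPair N R D b a := by
  simp only [monPair_apply, mul_comm]

theorem cxPair_comm (D : ℕ) (φ z : Cx N R) : cxPair N R D φ z = cxPair N R D z φ := by
  simp only [cxPair_apply, monPair_comm D (φ _)]

theorem cxPair_cr (D : ℕ) (j : Fin N) (φ z : Cx N R) :
    cxPair N R D φ (cr R j z) = cxPair N R D (an R j φ) z := by
  rw [cxPair_comm, ← cxPair_an, cxPair_comm]

theorem cxPair_dif (X : Fin N → Fin N → R) (D : ℕ) (φ z : Cx N R) :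
    cxPair N R (D + 1) φ (dif X z) = cxPair N R D (difT X φ) z := by
  have h1 : ∀ j (w : Cx N R), cr R j (lft (mS j) w) = lft (mS j) (cr R j w) := fun j w => by
    rw [← Module.End.mul_apply, ← (commute_lft_cr (mS j) j).eq, Module.End.mul_apply]
  have h2 : ∀ k j (w : Cx N R), cr R k (lft (mS j) w) = lft (mS j) (cr R k w) := fun k j w => by
    rw [← Module.End.mul_apply, ← (commute_lft_cr (mS j) k).eq, Module.End.mul_apply]
  have h3 : ∀ j (w : Cx N R), an R j (lft (mS j) w) = lft (mS j) (an R j w) := fun j w => by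
    rw [← Module.End.mul_apply, ← (commute_lft_an (mS j) j).eq, Module.End.mul_apply]
  rw [difT_apply, dif]
  simp only [LinearMap.sum_apply, Module.End.mul_apply, map_sum, cxPair_lft_mT, theta,
    LinearMap.add_apply, map_add, LinearMap.smul_apply, map_smul, cxPair_cr, cxPair_an, h2, h3]

theorem InL.difT (X : Fin N → Fin N → R) {m b : ℤ} {z : Cx N R} (hz : InL m b z) :
    InL (m - 2) (b - 1) (difT X z) := by
  have h1 : ∀ j, InL (m - 1) b (cr R j z) := by
    intro j I τ h
    rw [cr_apply] at h
    split_ifs at h with hI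
    · have := hz _ τ (fun e => h (by rw [Mon.zsmul_apply, e, smul_zero]))
      rw [Finset.card_erase_of_mem hI] at this
      have h0 := Finset.card_pos.2 ⟨j, hI⟩
      rw [Int.even_iff] at *
      push_cast at *
      omega
    · exact absurd rfl h
  have h2 : ∀ j, InL (m - 1) b (an R j z) := by
    intro j I τ h
    rw [an_apply] at h
    split_ifs at h with hI
    · exact absurd rfl h
    · have := hz _ τ (fun e => h (by rw [Mon.zsmul_apply, e, smul_zero]))
      rw [Finset.card_insert_of_notMem hI] at this
      rw [Int.even_iff] at *
      push_cast at *
      omega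
  rw [difT_apply]
  refine InL.sum fun j _ => InL.add ?_ (InL.sum fun k _ => InL.smul _ ?_)
  · convert (h2 j).mS j using 1; omega
  · convert (h1 k).mS j using 1; omega

end Pairing

section Extend

variable {N : ℕ} {R : Type*} [CommRing R]

/-- The basis elements of the complexes. -/
def del (q : Finset (Fin N) × (Fin N → ℕ)) : Cx N R := fun J => if J = q.1 then mono q.2 else 0

theorem del_apply (q : Finset (Fin N) × (Fin N → ℕ)) (J τ) :
    (del q : Cx N R) J τ = if (J, τ) = q then 1 else 0 := by
  rcases q with ⟨I, σ⟩
  by_cases h : J = I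
  · simp [del, h, mono_apply]
  · simp [del, h]

theorem del_mem {m b : ℤ} {q : Finset (Fin N) × (Fin N → ℕ)} (hq : q ∈ idx N m b) :
    del q ∈ subL N R m b := by
  intro J τ h
  rw [del_apply] at h
  by_cases h' : (J, τ) = q
  · subst h'
    exact (Finset.mem_filter.1 hq).2
  · exact absurd (if_neg h') h

theorem cxPair_eq_sum {m : ℤ} {D : ℕ} (φ : Cx N R) {z : Cx N R} (hz : InL m D z) :
    cxPair N R D φ z = ∑ q ∈ idx N m D, φ q.1 q.2 * z q.1 q.2 := by
  simp only [cxPair_apply, monPair_apply]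
  rw [← Finset.sum_product']
  symm
  refine Finset.sum_subset (fun q hq => ?_) fun q _ hq => ?_
  · refine Finset.mem_product.2 ⟨Finset.mem_univ _, mem_antidiag.2 ?_⟩
    exact_mod_cast (Finset.mem_filter.1 hq).2.1
  · have : z q.1 q.2 = 0 := by
      by_contra h
      exact hq (hz.mem_idx h)
    rw [this, mul_zero]

theorem cxPair_del {m : ℤ} {D : ℕ} (φ : Cx N R) {q : Finset (Fin N) × (Fin N → ℕ)}
    (hq : q ∈ idx N m D) : cxPair N R D φ (del q) = φ q.1 q.2 := by
  rw [cxPair_eq_sum φ (del_mem hq), Finset.sum_eq_single q]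
  · rw [del_apply, if_pos rfl, mul_one]
  · intro r _ hr
    rw [del_apply, if_neg hr, mul_zero]
  · exact fun h => absurd hq h

theorem subL_eq_sum {m b : ℤ} (z : subL N R m b) :
    z = ∑ q : idx N m b, z.1 q.1.1 q.1.2 • (⟨del q.1, del_mem q.2⟩ : subL N R m b) := by
  refine Subtype.ext (Fock.ext fun I => Mon.ext fun τ => ?_)
  rw [Submodule.coe_sum, Fock.sum_apply, Mon.sum_apply]
  simp only [Submodule.coe_smul, Fock.smul_apply, Mon.smul_apply, del_apply]
  by_cases h : z.1 I τ = 0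
  · rw [h, Finset.sum_eq_zero]
    intro q _
    by_cases e : (I, τ) = q.1
    · rw [← e, h, zero_mul]
    · rw [if_neg e, mul_zero]
  · rw [Finset.sum_eq_single ⟨(I, τ), InL.mem_idx z.2 h⟩]
    · rw [if_pos rfl, mul_one]
    · intro q _ hq
      rw [if_neg (fun e => hq (Subtype.ext e.symm)), mul_zero]
    · exact fun h' => absurd (Finset.mem_univ _) h'

theorem exists_cxPair_eq {m : ℤ} {D : ℕ} (f : subL N R m D →ₗ[R] R) :
    ∃ φ : Cx N R, InL m D φ ∧ ∀ z : subL N R m D, f z = cxPair N R D φ z.1 := by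
  let φ : Cx N R := fun I τ => if h : (I, τ) ∈ idx N m D then f ⟨del (I, τ), del_mem h⟩ else 0
  have hφ : ∀ q : idx N m D, φ q.1.1 q.1.2 = f ⟨del q.1, del_mem q.2⟩ := fun q => dif_pos q.2
  refine ⟨φ, ?_, fun z => ?_⟩
  · intro I τ h
    by_cases h' : (I, τ) ∈ idx N m D
    · exact (Finset.mem_filter.1 h').2
    · exact absurd (dif_neg h') h
  · rw [cxPair_eq_sum φ z.2, ← Finset.sum_coe_sort]
    conv_lhs => rw [subL_eq_sum z]
    rw [map_sum]
    refine Finset.sum_congr rfl fun q _ => ?_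
    rw [map_smul, smul_eq_mul, hφ, mul_comm]

/-- Functionals vanishing on boundaries extend along the differential, in even degrees. -/
theorem exists_comp_dif_eq (K : Type*) [Field K] [CharZero K] (hN : Odd N) {m : ℤ} {D : ℕ}
    (hD : Even ((D : ℤ) - m))
    (f : subL N (MvPolynomial (Prs N) K) m D →ₗ[MvPolynomial (Prs N) K] MvPolynomial (Prs N) K)
    (hf : ∀ z w, InL m ((D : ℤ) - 1) w → dif (gX N K) w = z.1 → f z = 0) :
    ∃ g : Cx N (MvPolynomial (Prs N) K) →ₗ[MvPolynomial (Prs N) K] MvPolynomial (Prs N) K,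
      ∀ z, g (dif (gX N K) z.1) = f z := by
  obtain ⟨φ, hφ, e⟩ := exists_cxPair_eq f
  obtain ⟨y, hy, hy'⟩ := exists_difT_eq K hN hφ hD (fun I hI => by
    ext1 τ
    by_contra h
    obtain ⟨h1, h2, h3⟩ := hφ.difT (gX N K) I τ h
    obtain ⟨D, rfl⟩ : ∃ D', D = D' + 1 := ⟨D - 1, by omega⟩
    have hq : (I, τ) ∈ idx N m D := by
      have h4 := (hφ.difT (gX N K)).mem_expts h
      rw [Nat.cast_add_one, add_sub_cancel_right] at h4
      refine Finset.mem_filter.2 ⟨Finset.mem_product.2 ⟨Finset.mem_univ _, h4⟩, ?_⟩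
      rw [Int.even_iff] at *
      push_cast at *
      refine ⟨by omega, by omega, by omega⟩
    have hw : InL m (D : ℤ) (del (I, τ) : Cx N (MvPolynomial (Prs N) K)) := del_mem hq
    have h4 : InL m ((D + 1 : ℕ) : ℤ) (dif (gX N K) (del (I, τ))) := by
      rw [Nat.cast_add_one]
      exact hw.dif _
    have h5 := hf ⟨_, h4⟩ (del (I, τ)) (by
      rwa [Nat.cast_add_one, add_sub_cancel_right]) rfl
    rw [e, cxPair_dif, cxPair_del _ hq] at h5
    exact h h5)
  refine ⟨cxPair N _ (D + 1) y, fun z => ?_⟩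
  rw [e, cxPair_dif, cxPair_apply, cxPair_apply]
  refine Finset.sum_congr rfl fun I _ => ?_
  by_cases h : z.1 I = 0
  · rw [h, map_zero, map_zero]
  · obtain ⟨τ, hτ⟩ : ∃ τ, z.1 I τ ≠ 0 := by
      by_contra! h'
      exact h (Mon.ext h')
    rw [hy' I (z.2 I τ hτ).2.1]

end Extend

section Resolution

variable {N : ℕ} {R : Type} [CommRing R]

/-- The restriction of the differential with values in the cycles. -/
def difZ [Algebra ℚ R] {X : Fin N → Fin N → R} (hX : ∀ i j, X i j = - X j i) (m b c : ℤ)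
    (h : c = b + 1) : subL N R m b →ₗ[R] subZ X m c :=
  ((dif X).domRestrict (subL N R m b)).codRestrict (subZ X m c) fun z => by
    subst h
    refine mem_subZ.2 ⟨InL.dif X z.2, ?_⟩
    rw [LinearMap.domRestrict_apply, ← Module.End.mul_apply, dif_mul_dif hX, LinearMap.zero_apply]

/-- The terms of the free resolution. -/
def resT (X : Fin N → Fin N → R) (d : ℕ) : ℕ → Type
  | 0 => R
  | 1 => subZ X ((d : ℤ) + 2) (d + 1)
  | q + 2 => subL N R ((d : ℤ) + 2) (d - q)

instance (X : Fin N → Fin N → R) (d : ℕ) : ∀ k, AddCommGroup (resT X d k)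
  | 0 => inferInstanceAs (AddCommGroup R)
  | 1 => inferInstanceAs (AddCommGroup (subZ X ((d : ℤ) + 2) (d + 1)))
  | q + 2 => inferInstanceAs (AddCommGroup (subL N R ((d : ℤ) + 2) (d - q)))

instance (X : Fin N → Fin N → R) (d : ℕ) : ∀ k, Module R (resT X d k)
  | 0 => inferInstanceAs (Module R R)
  | 1 => inferInstanceAs (Module R (subZ X ((d : ℤ) + 2) (d + 1)))
  | q + 2 => inferInstanceAs (Module R (subL N R ((d : ℤ) + 2) (d - q)))

variable [Algebra ℚ R] {X : Fin N → Fin N → R}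

/-- The differentials of the free resolution. -/
def resD (hX : ∀ i j, X i j = - X j i) (p : Fin N → R) (d : ℕ) :
    ∀ k, resT X d (k + 1) →ₗ[R] resT X d k
  | 0 => aug X p d ((d : ℤ) + 2) (d + 1)
  | 1 => difZ hX ((d : ℤ) + 2) (d - (0 : ℕ)) (d + 1) (by simp)
  | q + 2 => difL X ((d : ℤ) + 2) (d - (q + 1 : ℕ)) (d - q) (by push_cast; ring)

theorem projective_resT (hX : ∀ i j, X i j = - X j i) (d : ℕ) :
    ∀ k, Module.Projective R (resT X d k)
  | 0 => inferInstanceAs (Module.Projective R R)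
  | 1 => projective_subZ hX (m := (d : ℤ) + 2) (b := d + 1) (by omega) (by omega)
  | q + 2 => inferInstanceAs (Module.Projective R (subL N R ((d : ℤ) + 2) (d - q)))

variable {p : Fin N → R} {d : ℕ}

theorem resD_exact (hX : ∀ i j, X i j = - X j i) (hp : ∀ k, ∑ j, X k j * p j = 0) (hd : 1 ≤ d)
    (hE : ∀ m : ℤ, 1 ≤ m → Ex X m) (hlin : ∀ a, Hmg d a → ev p d a = 0 → InF X d a) :
    ∀ k x, resD hX p d k x = 0 ↔ ∃ y, resD hX p d (k + 1) y = x := by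
  have h0 : ∀ w, dif X (dif X w) = 0 := fun w => by
    rw [← Module.End.mul_apply, dif_mul_dif hX, LinearMap.zero_apply]
  rintro (_ | _ | q) x
  · constructor
    · intro h
      obtain ⟨y, hy, e⟩ := exists_of_aug_eq_zero hX hlin x.2.1 x.2.2 h
      exact ⟨⟨y, by rwa [mem_subL, Nat.cast_zero, sub_zero]⟩, Subtype.ext e⟩
    · rintro ⟨y, rfl⟩
      refine aug_dif hX hp hd (hE _ (by omega)) (y := y.1) ?_
      simpa using mem_subL.1 y.2
  · constructor
    · intro h
      obtain ⟨w, hw, e⟩ := hE ((d : ℤ) + 2) (by omega) _ _ x.2 (congrArg Subtype.val h)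
        (by push_cast; omega)
      exact ⟨⟨w, by rw [mem_subL]; convert hw using 1; push_cast; ring⟩, Subtype.ext e⟩
    · rintro ⟨y, rfl⟩
      exact Subtype.ext (h0 y.1)
  · constructor
    · intro h
      obtain ⟨w, hw, e⟩ := hE ((d : ℤ) + 2) (by omega) _ _ x.2 (congrArg Subtype.val h)
        (by push_cast; omega)
      exact ⟨⟨w, by rw [mem_subL]; convert hw using 1; push_cast; ring⟩, Subtype.ext e⟩
    · rintro ⟨y, rfl⟩
      exact Subtype.ext (h0 y.1)

theorem mem_pow_iff_exists_aug (hX : ∀ i j, X i j = - X j i) (hp : ∀ k, ∑ j, X k j * p j = 0)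
    (hd : 1 ≤ d) (hE : ∀ m : ℤ, 1 ≤ m → Ex X m) (x : R) :
    x ∈ Ideal.span (Set.range p) ^ d ↔ ∃ z : subZ X ((d : ℤ) + 2) (d + 1), aug X p d _ _ z = x := by
  constructor
  · intro h
    obtain ⟨a, ha, rfl⟩ := exists_ev_eq h
    exact exists_aug_eq hX hp hd (hE _ (by omega)) ha
  · rintro ⟨z, rfl⟩
    exact ev_mem_pow _

end Resolution

section Vanishing

open CategoryTheory

variable {n : ℕ} {K : Type} [Field K] [CharZero K]

theorem exists_functional {d q : ℕ} (hq : Even q ∨ 2 * n ≤ q)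
    (f : subL (2 * n + 1) (MvPolynomial (Prs (2 * n + 1)) K) ((d : ℤ) + 2) (d - q)
      →ₗ[MvPolynomial (Prs (2 * n + 1)) K] MvPolynomial (Prs (2 * n + 1)) K)
    (hf : ∀ z w, InL ((d : ℤ) + 2) (d - (q + 1 : ℕ)) w → dif (gX (2 * n + 1) K) w = z.1 → f z = 0) :
    ∃ g : Cx (2 * n + 1) (MvPolynomial (Prs (2 * n + 1)) K)
      →ₗ[MvPolynomial (Prs (2 * n + 1)) K] MvPolynomial (Prs (2 * n + 1)) K,
      ∀ z, g (dif (gX (2 * n + 1) K) z.1) = f z := by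
  by_cases hz : ∀ z : subL (2 * n + 1) (MvPolynomial (Prs (2 * n + 1)) K) ((d : ℤ) + 2) (d - q), z = 0
  · exact ⟨0, fun z => by rw [hz z, map_zero, LinearMap.zero_apply]⟩
  push Not at hz
  obtain ⟨z, hz⟩ := hz
  have hdq : q ≤ d := by
    by_contra h
    exact hz (Subtype.ext (InL.eq_zero_of_neg z.2 (by omega)))
  have hq' : Even q := by
    refine hq.resolve_right fun h => hz (Subtype.ext (Fock.ext fun I => Mon.ext fun τ => ?_))
    by_contra h'
    have h1 := (z.2 I τ h').2.1
    have h2 := Finset.card_le_univ I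
    rw [Fintype.card_fin] at h2
    omega
  obtain ⟨D, rfl⟩ := Nat.exists_eq_add_of_le hdq
  have e : ((q + D : ℕ) : ℤ) - q = D := by push_cast; ring
  revert f
  rw [e]
  intro f hf
  refine exists_comp_dif_eq K ⟨n, rfl⟩ ?_ f fun z w hw h => hf z w ?_ h
  · rw [Int.even_iff]
    rw [Nat.even_iff] at hq'
    push_cast
    omega
  · convert hw using 1
    push_cast
    ring

theorem subsingleton_ext_span_subpf {d : ℕ} (hd : 1 ≤ d) {j : ℕ}
    (hj : ¬ ∃ s : ℕ, 1 ≤ s ∧ s ≤ n ∧ j = 2 * s + 1) :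
    Subsingleton (((Ext (MvPolynomial (Prs (2 * n + 1)) K)
      (ModuleCat.{0} (MvPolynomial (Prs (2 * n + 1)) K)) j).obj
        (Opposite.op (ModuleCat.of _ (MvPolynomial (Prs (2 * n + 1)) K ⧸
          Ideal.span (Set.range (subpf (gX (2 * n + 1) K))) ^ d)))).obj
      (ModuleCat.of _ (MvPolynomial (Prs (2 * n + 1)) K))) := by
  have hX := gX_skew (N := 2 * n + 1) (K := K)
  have hp := sum_mul_subpf (X := gX (2 * n + 1) K) gX_skew gX_self
  have hE := fun m hm => (isGen_gX (2 * n + 1) K).ex (m := m) hm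
  have hlin := fun a ha => inF_of_ev_eq_zero (n := n) (K := K) hd (a := a) ha
  have hpow : ∀ k, ∃ z, aug (gX (2 * n + 1) K) (subpf (gX (2 * n + 1) K)) d ((d : ℤ) + 2) (d + 1) z
      = subpf (gX (2 * n + 1) K) k ^ d := fun k =>
    (mem_pow_iff_exists_aug hX hp hd hE _).1
      (Ideal.pow_mem_pow (Ideal.subset_span (Set.mem_range_self k)) d)
  have hex := resD_exact hX hp hd hE hlin
  let ε : MvPolynomial (Prs (2 * n + 1)) K →ₗ[MvPolynomial (Prs (2 * n + 1)) K]
    (MvPolynomial (Prs (2 * n + 1)) K ⧸ Ideal.span (Set.range (subpf (gX (2 * n + 1) K))) ^ d) :=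
    Submodule.mkQ _
  have hε : ∀ x, ε x = 0 ↔ ∃ z, aug (gX (2 * n + 1) K) (subpf (gX (2 * n + 1) K)) d
      ((d : ℤ) + 2) (d + 1) z = x := fun x =>
    (Submodule.Quotient.mk_eq_zero _).trans (mem_pow_iff_exists_aug hX hp hd hE x)
  have hs : Function.Surjective ε := Submodule.mkQ_surjective _
  have h0 : ∀ f : MvPolynomial (Prs (2 * n + 1)) K →ₗ[MvPolynomial (Prs (2 * n + 1)) K]
      MvPolynomial (Prs (2 * n + 1)) K, (∀ z, f (aug (gX (2 * n + 1) K) (subpf (gX (2 * n + 1) K)) d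
      ((d : ℤ) + 2) (d + 1) z) = 0) → f = 0 := by
    intro f hf
    obtain ⟨z, hz⟩ := hpow 0
    have h1 := hf z
    have h2 : ∀ x, f x = x * f 1 := fun x => by
      have := f.map_smul x 1
      rwa [smul_eq_mul, smul_eq_mul, mul_one] at this
    rw [hz, h2] at h1
    have h3 := (mul_eq_zero.1 h1).resolve_left (pow_ne_zero _ (subpf_gX_ne_zero 0))
    exact LinearMap.ext fun x => by rw [h2, h3, mul_zero, LinearMap.zero_apply]
  have h1 : ∀ c : MvPolynomial (Prs (2 * n + 1)) K, ∃ g : MvPolynomial (Prs (2 * n + 1)) K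
      →ₗ[MvPolynomial (Prs (2 * n + 1)) K] MvPolynomial (Prs (2 * n + 1)) K, ∀ x, g x = c * x :=
    fun c => ⟨c • LinearMap.id, fun x => rfl⟩
  refine subsingleton_ext (projective_resT hX d) (resD hX (subpf (gX (2 * n + 1) K)) d)
    ε hs hε hex _ j ?_ ?_
  · exact fun _ f hf => h0 f (LinearMap.congr_fun hf)
  · rintro (_ | k) rfl f hf
    · obtain ⟨c, hc⟩ := exists_smul_eq (f := f) (fun z hz => by
        obtain ⟨y, rfl⟩ := (hex 0 z).1 hz
        exact LinearMap.congr_fun hf y) hpow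
      obtain ⟨g, hg⟩ := h1 c
      exact ⟨g, LinearMap.ext fun z => (hg _).trans (hc z).symm⟩
    · obtain ⟨g, hg⟩ := exists_functional (d := d) (q := k) (by
        by_contra! h
        rw [Nat.not_even_iff] at h
        exact hj ⟨(k + 1) / 2, by omega, by omega, by omega⟩) f (fun z w hw e => by
        have : resD hX (subpf (gX (2 * n + 1) K)) d (k + 2) ⟨w, hw⟩ = z := Subtype.ext e
        rw [← this]
        exact LinearMap.congr_fun hf _)
      cases k with
      | zero => exact ⟨g ∘ₗ (subZ _ _ _).subtype, LinearMap.ext hg⟩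
      | succ k => exact ⟨g ∘ₗ (subL _ _ _ _).subtype, LinearMap.ext hg⟩

end Vanishing

end PfaffExt

/-- For `d ≥ 1`, the modules `Ext^j_S(S/I^d, S)` vanish when `j` is not of the form
`2s + 1` for some `1 ≤ s ≤ n`, where `I` is the ideal of sub-maximal Pfaffians of the
generic `(2n+1) × (2n+1)` skew-symmetric matrix. -/
theorem ext_quotient_powers_submaximal_pfaffians_vanishing
    (K : Type) [Field K] [CharZero K] (n : ℕ) (hn : 1 ≤ n)
    (X : Matrix (Fin (2 * n + 1)) (Fin (2 * n + 1))
      (MvPolynomial {p : Fin (2 * n + 1) × Fin (2 * n + 1) // p.1 < p.2} K))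
    (hXlt : ∀ (i j : Fin (2 * n + 1)) (h : i < j), X i j = MvPolynomial.X ⟨(i, j), h⟩)
    (hXgt : ∀ (i j : Fin (2 * n + 1)) (h : j < i), X i j = -MvPolynomial.X ⟨(j, i), h⟩)
    (hXdiag : ∀ i, X i i = 0)
    (pf : Matrix (Fin (2 * n)) (Fin (2 * n))
        (MvPolynomial {p : Fin (2 * n + 1) × Fin (2 * n + 1) // p.1 < p.2} K) →
      MvPolynomial {p : Fin (2 * n + 1) × Fin (2 * n + 1) // p.1 < p.2} K)
    (hpf : ∀ A, pf A = (((2 ^ n * Nat.factorial n : ℕ) : K)⁻¹) •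
      ∑ σ : Equiv.Perm (Fin (2 * n)), (Equiv.Perm.sign σ : ℤ) •
        ∏ i : Fin n, A (σ ⟨2 * (i : ℕ), by omega⟩) (σ ⟨2 * (i : ℕ) + 1, by omega⟩))
    (I : Ideal (MvPolynomial {p : Fin (2 * n + 1) × Fin (2 * n + 1) // p.1 < p.2} K))
    (hI : I = Ideal.span (Set.range fun k : Fin (2 * n + 1) =>
      pf (X.submatrix (Fin.succAbove k) (Fin.succAbove k))))
    (d : ℕ) (hd : 1 ≤ d) (j : ℕ) (hj : ¬ ∃ s : ℕ, 1 ≤ s ∧ s ≤ n ∧ j = 2 * s + 1) :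
    Subsingleton
      (((Ext (MvPolynomial {p : Fin (2 * n + 1) × Fin (2 * n + 1) // p.1 < p.2} K) (ModuleCat (MvPolynomial {p : Fin (2 * n + 1) × Fin (2 * n + 1) // p.1 < p.2} K)) j).obj
          (Opposite.op (ModuleCat.of (MvPolynomial {p : Fin (2 * n + 1) × Fin (2 * n + 1) // p.1 < p.2} K) (MvPolynomial {p : Fin (2 * n + 1) × Fin (2 * n + 1) // p.1 < p.2} K ⧸ (I ^ d))))).obj
        (ModuleCat.of (MvPolynomial {p : Fin (2 * n + 1) × Fin (2 * n + 1) // p.1 < p.2} K) (MvPolynomial {p : Fin (2 * n + 1) × Fin (2 * n + 1) // p.1 < p.2} K))) := by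
  have hX : X = PfaffExt.gX (2 * n + 1) K := by
    funext i j
    unfold PfaffExt.gX
    split_ifs with h h'
    · exact hXlt i j h
    · exact hXgt i j h'
    · rw [le_antisymm (not_lt.1 h') (not_lt.1 h)]
      exact hXdiag j
  have hc : (((2 ^ n * Nat.factorial n : ℕ) : K)⁻¹) ≠ 0 :=
    inv_ne_zero (Nat.cast_ne_zero.2 (mul_ne_zero (by positivity) (Nat.factorial_ne_zero n)))
  have hk : ∀ k, pf (X.submatrix (Fin.succAbove k) (Fin.succAbove k)) =
      ((((2 ^ n * Nat.factorial n : ℕ) : K)⁻¹) * (-1) ^ (k : ℕ)) • PfaffExt.subpf (PfaffExt.gX (2 * n + 1) K) k := by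
    intro k
    rw [hpf, hX, mul_smul, PfaffExt.subpf]
    congr 1
    rw [MvPolynomial.smul_eq_C_mul, ← mul_assoc, map_pow, map_neg, map_one, ← mul_pow, neg_mul_neg,
      one_mul, one_pow, one_mul]
    rfl
  have hI' : I = Ideal.span (Set.range (PfaffExt.subpf (PfaffExt.gX (2 * n + 1) K))) := by
    rw [hI]
    refine le_antisymm (Ideal.span_le.2 ?_) (Ideal.span_le.2 ?_)
    · rintro _ ⟨k, rfl⟩
      simp only [hk]
      rw [MvPolynomial.smul_eq_C_mul]
      exact Ideal.mul_mem_left _ _ (Ideal.subset_span (Set.mem_range_self k))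
    · rintro _ ⟨k, rfl⟩
      have hu : ((((2 ^ n * Nat.factorial n : ℕ) : K)⁻¹) * (-1) ^ (k : ℕ)) ≠ 0 :=
        mul_ne_zero hc (pow_ne_zero _ (neg_ne_zero.2 one_ne_zero))
      rw [SetLike.mem_coe, ← inv_smul_smul₀ hu (PfaffExt.subpf (PfaffExt.gX (2 * n + 1) K) k), ← hk,
        MvPolynomial.smul_eq_C_mul]
      exact Ideal.mul_mem_left _ _ (Ideal.subset_span (Set.mem_range_self k))
  subst hI'
  exact PfaffExt.subsingleton_ext_span_subpf hd hj
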